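/- arXiv:1212.1943 — 2 statements merged into one kernel-verified Lean document; each statement's English description precedes it below -/
import Mathlib

section
/- Let P be an injective labeled oriented tree and let T₁ ≠ T₂ be maximal proper sub-LOTs of P with nonempty intersection T₁₂ = T₁ ∩ T₂ (so that P = T₁ ∪ T₂). Then the inclusion-induced homomorphisms G(T₁₂) → G(T₁), G(T₁₂) → G(T₂), and G(Tᵢ) → G(P) (i = 1, 2) are all injective, and G(P) is the amalgamated free product G(T₁) *_{G(T₁₂)} G(T₂); that is, the commutative square of inclusion-induced homomorphisms exhibits G(P) as the pushout of G(T₁) ← G(T₁₂) → G(T₂). -/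
/-- A labeled oriented graph (LOG): each edge `e` has an initial vertex `init e`,
a terminal vertex `term e`, and a label `label e`, which is a vertex.
An edge `e = [x,z,y]` has `init e = x`, `label e = z`, `term e = y`. -/
structure LOG (V E : Type) where
  init : E → V
  label : E → V
  term : E → V

namespace LOG

variable {V E : Type}

/-- The underlying simple graph of a LOG. -/
def graph (G : LOG V E) : SimpleGraph V :=
  SimpleGraph.fromRel fun a b => ∃ e, G.init e = a ∧ G.term e = b

/-- The underlying unoriented multigraph is a tree: there are no loops, distinct
edges have distinct endpoint pairs, and the underlying simple graph is a tree. -/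
def IsTreeGraph (G : LOG V E) : Prop :=
  (∀ e, G.init e ≠ G.term e) ∧
    Function.Injective (fun e => s(G.init e, G.term e)) ∧ G.graph.IsTree

/-- A LOG is injective if each vertex occurs at most once as an edge label. -/
def InjectiveLabels (G : LOG V E) : Prop := Function.Injective G.label

/-- The simple graph induced by a subgraph, given by a vertex set `VS` and an edge set `ES`. -/
def subgraph (G : LOG V E) (VS : Set V) (ES : Set E) : SimpleGraph VS :=
  SimpleGraph.fromRel fun a b => ∃ e ∈ ES, G.init e = (a : V) ∧ G.term e = (b : V)

/-- A sub-LOT: a connected subgraph containing at least one edge, all of whose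
edge labels are vertices of the subgraph. -/
structure IsSubLOT (G : LOG V E) (VS : Set V) (ES : Set E) : Prop where
  edge_nonempty : ES.Nonempty
  init_mem : ∀ e ∈ ES, G.init e ∈ VS
  term_mem : ∀ e ∈ ES, G.term e ∈ VS
  label_mem : ∀ e ∈ ES, G.label e ∈ VS
  connected : (G.subgraph VS ES).Connected

end LOG

namespace LOG

variable {V E : Type}

/-- A proper sub-LOT: a sub-LOT that is not all of `G`. -/
def IsProperSubLOT (G : LOG V E) (VS : Set V) (ES : Set E) : Prop :=
  G.IsSubLOT VS ES ∧ ¬(VS = Set.univ ∧ ES = Set.univ)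

/-- A maximal proper sub-LOT: a proper sub-LOT not properly contained in any
other proper sub-LOT. -/
def IsMaxProperSubLOT (G : LOG V E) (VS : Set V) (ES : Set E) : Prop :=
  G.IsProperSubLOT VS ES ∧
    ∀ VS' ES', G.IsProperSubLOT VS' ES' → VS ⊆ VS' → ES ⊆ ES' → VS = VS' ∧ ES = ES'

end LOG

namespace LOG

variable {V E : Type}

/-- The relators `x z (z y)⁻¹` of the LOT presentation `P(G)`. -/
def rels (G : LOG V E) : Set (FreeGroup V) :=
  Set.range fun e =>
    FreeGroup.of (G.init e) * FreeGroup.of (G.label e) *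
      (FreeGroup.of (G.label e) * FreeGroup.of (G.term e))⁻¹

/-- The relators of the LOT presentation of the sub-LOT given by `(VS, ES)`,
as words in the generators `VS`. -/
def subRels (G : LOG V E) (VS : Set V) (ES : Set E) : Set (FreeGroup VS) :=
  { r | ∃ e ∈ ES, ∃ (hi : G.init e ∈ VS) (hl : G.label e ∈ VS) (ht : G.term e ∈ VS),
      r = FreeGroup.of (⟨G.init e, hi⟩ : VS) * FreeGroup.of (⟨G.label e, hl⟩ : VS) *
        (FreeGroup.of (⟨G.label e, hl⟩ : VS) * FreeGroup.of (⟨G.term e, ht⟩ : VS))⁻¹ }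

end LOG

section Branchings

variable {I : Type*} [Fintype I] [DecidableEq I]

/-- The arcs of `D` that leave `K`, where `hd e b` is the head of the arc `(e, b)` out of `e`. -/
def arcsLeaving (hd : I → Bool → Option I) (D : Finset (I × Bool)) (K : Finset I) :
    Finset (I × Bool) :=
  D.filter fun a => a.1 ∈ K ∧ ∀ e ∈ K, hd a.1 a.2 ≠ some e

theorem card_arcsLeaving_inter_add_union (hd : I → Bool → Option I) (D : Finset (I × Bool))
    (A B : Finset I) :
    (arcsLeaving hd D (A ∩ B)).card + (arcsLeaving hd D (A ∪ B)).card ≤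
      (arcsLeaving hd D A).card + (arcsLeaving hd D B).card := by
  simp only [arcsLeaving, Finset.card_filter]
  rw [← Finset.sum_add_distrib, ← Finset.sum_add_distrib]
  refine Finset.sum_le_sum fun a _ => ?_
  simp only [Finset.mem_inter, Finset.mem_union]
  obtain h | ⟨c, h⟩ : hd a.1 a.2 = none ∨ ∃ c, hd a.1 a.2 = some c := by
    cases hd a.1 a.2 <;> simp
  · by_cases h1 : a.1 ∈ A <;> by_cases h2 : a.1 ∈ B <;> simp [h, h1, h2]
  · have key : ∀ p : I → Prop, (∀ e, p e → (some c : Option I) ≠ some e) ↔ ¬ p c := fun p =>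
      ⟨fun hp hc => hp c hc rfl, fun hp e he hce => hp (Option.some.inj hce ▸ he)⟩
    simp only [h, key]
    by_cases h1 : a.1 ∈ A <;> by_cases h2 : a.1 ∈ B <;> by_cases h3 : c ∈ A <;>
      by_cases h4 : c ∈ B <;> simp [h1, h2, h3, h4]

/-- The arcs other than the arcs `(e, s e)` with `e ∈ R`. -/
def remainingArcs (R : Finset I) (s : I → Bool) : Finset (I × Bool) :=
  Finset.univ.filter fun a => ¬(a.1 ∈ R ∧ a.2 = s a.1)

theorem exists_removable_arc (hd : I → Bool → Option I)
    (h : ∀ K : Finset I, K.Nonempty → 2 ≤ (arcsLeaving hd Finset.univ K).card)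
    (R : Finset I) (s : I → Bool) (hR : R ≠ Finset.univ)
    (h1 : ∀ K : Finset I, K.Nonempty → 1 ≤ (arcsLeaving hd (remainingArcs R s) K).card) :
    ∃ e b, e ∉ R ∧ (∀ e', e' ∉ R → hd e b ≠ some e') ∧
      ∀ K : Finset I, K.Nonempty →
        ∃ a ∈ arcsLeaving hd (remainingArcs R s) K, a ≠ (e, b) := by
  have hdiff : ∀ C : Finset I, ¬ C ⊆ R →
      2 ≤ (arcsLeaving hd (remainingArcs R s) (C \ R)).card := by
    intro C hC
    refine (h (C \ R) (Finset.sdiff_nonempty.2 hC)).trans (Finset.card_le_card ?_)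
    intro a ha
    simp only [arcsLeaving, remainingArcs, Finset.mem_filter, Finset.mem_univ, true_and,
      Finset.mem_sdiff] at ha ⊢
    exact ⟨fun h => ha.1.2 h.1, ha⟩
  by_cases hT : ∃ C : Finset I, ¬ C ⊆ R ∧ (arcsLeaving hd (remainingArcs R s) C).card = 1
  · obtain ⟨C, hC⟩ := hT
    obtain ⟨C, -, hmin⟩ := Finset.exists_le_minimal
      (Finset.univ.filter fun C : Finset I =>
        ¬ C ⊆ R ∧ (arcsLeaving hd (remainingArcs R s) C).card = 1) (a := C) (by simpa using hC)
    obtain ⟨hCR, hC1⟩ : ¬ C ⊆ R ∧ (arcsLeaving hd (remainingArcs R s) C).card = 1 := by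
      simpa using hmin.1
    obtain ⟨⟨e, b⟩, ha, ha'⟩ := Finset.exists_mem_notMem_of_card_lt_card
      (lt_of_lt_of_le (by omega : (arcsLeaving hd (remainingArcs R s) C).card < 2) (hdiff C hCR))
    simp only [arcsLeaving, Finset.mem_filter, Finset.mem_sdiff, not_and, not_forall,
      not_not, exists_prop] at ha ha'
    obtain ⟨haD, ⟨heC, heR⟩, hex⟩ := ha
    obtain ⟨c, hcC, hc⟩ := ha' haD heC
    have hcR : c ∈ R := by
      by_contra hcR
      exact hex c ⟨hcC, hcR⟩ hc
    refine ⟨e, b, heR, fun e' he' hh => he' ?_, fun K hK => ?_⟩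
    · rw [hc] at hh; exact Option.some.inj hh ▸ hcR
    · by_contra! hcon
      have hKsub : arcsLeaving hd (remainingArcs R s) K ⊆ {(e, b)} := fun a ha => by
        simpa using hcon a ha
      have hK1 : (arcsLeaving hd (remainingArcs R s) K).card = 1 :=
        le_antisymm (by simpa using Finset.card_le_card hKsub) (h1 K hK)
      have heq := Finset.eq_of_subset_of_card_le hKsub (by simp [hK1])
      have hmem : (e, b) ∈ arcsLeaving hd (remainingArcs R s) K := by simp [heq]
      simp only [arcsLeaving, Finset.mem_filter] at hmem
      have hsub := card_arcsLeaving_inter_add_union hd (remainingArcs R s) C K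
      have hi := h1 (C ∩ K) ⟨e, by simp [heC, hmem.2.1]⟩
      have hu := h1 (C ∪ K) ⟨e, by simp [heC]⟩
      have hle : C ≤ C ∩ K := hmin.2 (y := C ∩ K)
        (by
          simp only [Finset.mem_filter, Finset.mem_univ, true_and]
          exact ⟨fun hs => heR (hs (by simp [heC, hmem.2.1])), by omega⟩)
        Finset.inter_subset_left
      exact hmem.2.2 c (Finset.mem_inter.1 (hle hcC)).2 hc
  · push Not at hT
    have hne : ¬ (Finset.univ : Finset I) ⊆ R := fun hs => hR (Finset.univ_subset_iff.1 hs)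
    obtain ⟨⟨e, b⟩, ha⟩ := Finset.card_pos.1 (lt_of_lt_of_le (by norm_num) (hdiff _ hne))
    simp only [arcsLeaving, Finset.mem_filter, Finset.mem_sdiff, Finset.mem_univ, true_and] at ha
    refine ⟨e, b, ha.2.1, ha.2.2, fun K hK => ?_⟩
    by_contra! hcon
    have hKsub : arcsLeaving hd (remainingArcs R s) K ⊆ {(e, b)} := fun a ha => by
      simpa using hcon a ha
    have hK1 : (arcsLeaving hd (remainingArcs R s) K).card = 1 :=
      le_antisymm (by simpa using Finset.card_le_card hKsub) (h1 K hK)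
    have heq := Finset.eq_of_subset_of_card_le hKsub (by simp [hK1])
    have hmem : (e, b) ∈ arcsLeaving hd (remainingArcs R s) K := by simp [heq]
    simp only [arcsLeaving, Finset.mem_filter] at hmem
    exact hT K (fun hs => ha.2.1 (hs hmem.2.1)) hK1

/-- **Edmonds' disjoint branchings theorem** for digraphs in which every non-root vertex has
exactly two outgoing arcs: if at least two arcs leave every nonempty set of non-root vertices,
then the arcs split into two spanning branchings towards the root. -/
theorem exists_complementary_branchings (hd : I → Bool → Option I)
    (h : ∀ K : Finset I, K.Nonempty → 2 ≤ (arcsLeaving hd Finset.univ K).card) :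
    ∃ s : I → Bool,
      (∀ K : Finset I, K.Nonempty → ∃ e ∈ K, ∀ e' ∈ K, hd e (s e) ≠ some e') ∧
      ∀ K : Finset I, K.Nonempty → ∃ e ∈ K, ∀ e' ∈ K, hd e (!s e) ≠ some e' := by
  have main : ∀ n ≤ Fintype.card I, ∃ (R : Finset I) (s : I → Bool), R.card = n ∧
      (∀ e ∈ R, ∀ e', e' ∉ R → hd e (s e) ≠ some e') ∧
      (∀ K ⊆ R, K.Nonempty → ∃ e ∈ K, ∀ e' ∈ K, hd e (s e) ≠ some e') ∧
      ∀ K : Finset I, K.Nonempty → 1 ≤ (arcsLeaving hd (remainingArcs R s) K).card := by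
    intro n
    induction n with
    | zero =>
      refine fun _ => ⟨∅, fun _ => true, rfl, by simp, fun K hK hne => ?_, fun K hK => ?_⟩
      · exact absurd (Finset.subset_empty.1 hK) hne.ne_empty
      · have := h K hK
        simp only [remainingArcs, Finset.notMem_empty, false_and, not_false_eq_true,
          Finset.filter_true]
        omega
    | succ n ih =>
      intro hn
      obtain ⟨R, s, hcard, hclosed, hf, hg⟩ := ih (by omega)
      obtain ⟨e, b, heR, hhead, hrem⟩ := exists_removable_arc hd h R s
        (fun hR => by rw [hR, Finset.card_univ] at hcard; omega) hg
      have hupd : ∀ e' ∈ R, Function.update s e b e' = s e' := fun e' he' =>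
        Function.update_of_ne (fun hh => heR (by rw [← hh]; exact he')) _ _
      refine ⟨insert e R, Function.update s e b, by simp [heR, hcard], ?_, ?_, ?_⟩
      · intro e1 he1 e' he'
        simp only [Finset.mem_insert, not_or] at he1 he'
        rcases he1 with rfl | he1
        · simpa using hhead e' he'.2
        · rw [hupd e1 he1]; exact hclosed e1 he1 e' he'.2
      · intro K hK hne
        by_cases hKR : (K ∩ R).Nonempty
        · obtain ⟨e1, he1, hex⟩ := hf (K ∩ R) Finset.inter_subset_right hKR
          simp only [Finset.mem_inter] at he1 hex
          refine ⟨e1, he1.1, fun e' he' => ?_⟩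
          rw [hupd e1 he1.2]
          by_cases he'R : e' ∈ R
          · exact hex e' ⟨he', he'R⟩
          · exact hclosed e1 he1.2 e' he'R
        · have hKe : ∀ e' ∈ K, e' = e := fun e' he' => by
            rcases Finset.mem_insert.1 (hK he') with h | h
            · exact h
            · exact absurd ⟨e', Finset.mem_inter.2 ⟨he', h⟩⟩ hKR
          obtain ⟨e1, he1⟩ := hne
          refine ⟨e1, he1, fun e' he' => ?_⟩
          rw [hKe e1 he1, hKe e' he']
          simpa using hhead e heR
      · intro K hK
        obtain ⟨a, ha, hne⟩ := hrem K hK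
        refine Finset.card_pos.2 ⟨a, ?_⟩
        simp only [arcsLeaving, remainingArcs, Finset.mem_filter, Finset.mem_univ, true_and,
          Finset.mem_insert] at ha ⊢
        refine ⟨?_, ha.2⟩
        rintro ⟨h1 | h1, h2⟩
        · rw [h1, Function.update_self] at h2
          exact hne (Prod.ext h1 h2)
        · rw [hupd _ h1] at h2
          exact ha.1 ⟨h1, h2⟩
  obtain ⟨R, s, hcard, -, hf, hg⟩ := main _ le_rfl
  have hR : R = Finset.univ := Finset.eq_univ_of_card R hcard
  subst hR
  refine ⟨s, fun K hK => hf K (Finset.subset_univ K) hK, fun K hK => ?_⟩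
  obtain ⟨⟨e, b⟩, ha⟩ := Finset.card_pos.1 (hg K hK)
  simp only [arcsLeaving, remainingArcs, Finset.mem_filter, Finset.mem_univ, true_and] at ha
  have hb : b = !s e := by
    cases b <;> cases hs : s e <;> simp_all
  exact ⟨e, ha.2.1, hb ▸ ha.2.2⟩

end Branchings
namespace LOG

section Squares

open scoped Classical

variable {V E Ω : Type}

/-- The vertex `v`, with all vertices of `U` collapsed to the single node `none`. -/
noncomputable def node (U : Set V) (v : V) : Option V := if v ∈ U then none else some v

theorem node_of_mem {U : Set V} {v : V} (h : v ∈ U) : node U v = none := if_pos h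

theorem node_of_notMem {U : Set V} {v : V} (h : v ∉ U) : node U v = some v := if_neg h

theorem node_eq_none {U : Set V} {v : V} : node U v = none ↔ v ∈ U := by
  simp [node]

theorem node_eq_some {U : Set V} {v w : V} : node U v = some w ↔ v ∉ U ∧ v = w := by
  by_cases h : v ∈ U <;> simp [node, h]

/-- The initial (`true`) or terminal (`false`) vertex of an edge. -/
def side (P : LOG V E) (e : E) (j : Bool) : V := if j then P.init e else P.term e

/-- No nonempty set `K` of nodes is closed under following an edge of `B` from its label to the
vertex `m e`, in the sense that each element of `K` is the label of such an edge. -/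
def NoClosedSet (P : LOG V E) (U : Set V) (B : Set E) (m : E → V) : Prop :=
  ∀ K : Finset (Option V),
    (∀ k ∈ K, ∃ e ∈ B, node U (P.label e) = k ∧ node U (m e) ∈ K) → K = ∅

/-- An orientation `ε` of the vertices making the left and right graphs relative to `U` acyclic. -/
structure IsForestOrientation (P : LOG V E) (U : Set V) (B : Set E) (ε : V → Bool) : Prop where
  inj : ∀ e ∈ B, ∀ e' ∈ B, node U (P.label e) = node U (P.label e') → e = e'
  const : ∀ u ∈ U, ∀ u' ∈ U, ε u = ε u'
  left : P.NoClosedSet U B fun e => P.side e (!ε (P.label e))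
  right : P.NoClosedSet U B fun e => P.side e (ε (P.label e))

/-- The corner of the square `f = (e, ω)` at horizontal position `i` and vertical position `j`. -/
def corner (P : LOG V E) (a : V → Equiv.Perm Ω) (f : E × Ω) (i j : Bool) : Ω :=
  if j then a (P.label f.1) (if i then a (P.term f.1) f.2 else f.2)
  else if i then a (P.term f.1) f.2 else f.2

/-- The square `f` closes up: `x z ω = z y ω`. -/
def IsClosedSquare (P : LOG V E) (a : V → Equiv.Perm Ω) (f : E × Ω) : Prop :=
  a (P.init f.1) (a (P.label f.1) f.2) = a (P.label f.1) (a (P.term f.1) f.2)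

/-- The four edges of the square `f`: horizontal ones `inl j` at height `j`, and vertical ones
`inr i` at position `i`. The pair `(v, ω)` is the edge labeled `v` from `ω` to `a v ω`. -/
def slot (P : LOG V E) (a : V → Equiv.Perm Ω) (f : E × Ω) : Bool ⊕ Bool → V × Ω
  | .inl j => (P.side f.1 j, P.corner a f false j)
  | .inr i => (P.label f.1, P.corner a f i false)

/-- The source of an edge, oriented by `ε`. -/
def src (a : V → Equiv.Perm Ω) (ε : V → Bool) (d : V × Ω) : Ω := if ε d.1 then d.2 else a d.1 d.2

/-- The target of an edge, oriented by `ε`. -/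
def tgt (a : V → Equiv.Perm Ω) (ε : V → Bool) (d : V × Ω) : Ω := if ε d.1 then a d.1 d.2 else d.2

theorem src_slot_inr (P : LOG V E) (a : V → Equiv.Perm Ω) (ε : V → Bool) (f : E × Ω) (i : Bool) :
    src a ε (P.slot a f (.inr i)) = P.corner a f i (!ε (P.label f.1)) := by
  cases i <;> cases h : ε (P.label f.1) <;> simp [src, slot, corner, h]

theorem tgt_slot_inr (P : LOG V E) (a : V → Equiv.Perm Ω) (ε : V → Bool) (f : E × Ω) (i : Bool) :
    tgt a ε (P.slot a f (.inr i)) = P.corner a f i (ε (P.label f.1)) := by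
  cases i <;> cases h : ε (P.label f.1) <;> simp [tgt, slot, corner, h]

theorem src_slot_inl (P : LOG V E) {a : V → Equiv.Perm Ω} (ε : V → Bool) {f : E × Ω}
    (hf : P.IsClosedSquare a f) (j : Bool) :
    src a ε (P.slot a f (.inl j)) = P.corner a f (!ε (P.side f.1 j)) j := by
  unfold IsClosedSquare at hf
  cases j <;> cases h : ε (P.side f.1 _) <;> simp_all [src, slot, corner, side]

theorem tgt_slot_inl (P : LOG V E) {a : V → Equiv.Perm Ω} (ε : V → Bool) {f : E × Ω}
    (hf : P.IsClosedSquare a f) (j : Bool) :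
    tgt a ε (P.slot a f (.inl j)) = P.corner a f (ε (P.side f.1 j)) j := by
  unfold IsClosedSquare at hf
  cases j <;> cases h : ε (P.side f.1 _) <;> simp_all [tgt, slot, corner, side]

theorem corner_injective (P : LOG V E) (a : V → Equiv.Perm Ω) (e : E) {ω ω' : Ω} {i j : Bool}
    (h : P.corner a (e, ω) i j = P.corner a (e, ω') i j) : ω = ω' := by
  cases i <;> cases j <;> simpa [corner] using h

theorem tgt_injective (a : V → Equiv.Perm Ω) (ε : V → Bool) {d d' : V × Ω} (h1 : d.1 = d'.1)
    (h : tgt a ε d = tgt a ε d') : d = d' := by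
  obtain ⟨v, ω⟩ := d
  obtain ⟨v', ω'⟩ := d'
  obtain rfl : v = v' := h1
  cases hv : ε v <;> simpa [tgt, hv] using h

/-- A finite square complex with edges `D` labeled outside `U` and squares `Φ` over edges in `B`. -/
structure IsSquareComplex (P : LOG V E) (U : Set V) (B : Set E) (a : V → Equiv.Perm Ω)
    (D : Finset (V × Ω)) (Φ : Finset (E × Ω)) : Prop where
  notMem : ∀ d ∈ D, d.1 ∉ U
  mem : ∀ f ∈ Φ, f.1 ∈ B
  closed : ∀ f ∈ Φ, P.IsClosedSquare a f
  slot_mem : ∀ f ∈ Φ, ∀ t, (P.slot a f t).1 ∉ U → P.slot a f t ∈ D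

/-- Every rational cocycle on the square complex that vanishes on `U` is a coboundary on `D`. -/
def CocyclesExact (P : LOG V E) (U : Set V) (a : V → Equiv.Perm Ω)
    (D : Finset (V × Ω)) (Φ : Finset (E × Ω)) : Prop :=
  ∀ k : V × Ω → ℚ, (∀ u ∈ U, ∀ ω, k (u, ω) = 0) →
    (∀ f ∈ Φ, k (P.slot a f (.inl true)) + k (P.slot a f (.inr false)) =
      k (P.slot a f (.inr true)) + k (P.slot a f (.inl false))) →
    ∃ b : Ω → ℚ, (∀ u ∈ U, ∀ ω, b (a u ω) = b ω) ∧ ∀ d ∈ D, k d = b (a d.1 d.2) - b d.2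

variable {P : LOG V E} {U : Set V} {B : Set E} {a : V → Equiv.Perm Ω} {ε : V → Bool}
  {D : Finset (V × Ω)} {Φ : Finset (E × Ω)}

/-- The endpoints of the edges in `D`. -/
noncomputable def endpoints (a : V → Equiv.Perm Ω) (ε : V → Bool) (D : Finset (V × Ω)) :
    Finset Ω :=
  D.image (src a ε) ∪ D.image (tgt a ε)

/-- The corner of a square from which both of its left edges leave. -/
def leftCorner (P : LOG V E) (a : V → Equiv.Perm Ω) (ε : V → Bool) (f : E × Ω) : Ω :=
  P.corner a f (!ε (P.side f.1 (!ε (P.label f.1)))) (!ε (P.label f.1))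

/-- The corner of a square at which both of its right edges arrive. -/
def rightCorner (P : LOG V E) (a : V → Equiv.Perm Ω) (ε : V → Bool) (f : E × Ω) : Ω :=
  P.corner a f (ε (P.side f.1 (ε (P.label f.1)))) (ε (P.label f.1))

/-- Some edge of a square labeled in `U` leaves `y`. -/
def HasOldExit (P : LOG V E) (U : Set V) (a : V → Equiv.Perm Ω) (ε : V → Bool)
    (Φ : Finset (E × Ω)) (y : Ω) : Prop :=
  ∃ f ∈ Φ, ∃ t, (P.slot a f t).1 ∈ U ∧ src a ε (P.slot a f t) = y

theorem IsForestOrientation.side_notMem (hε : P.IsForestOrientation U B ε) {e : E} (he : e ∈ B)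
    (hl : P.label e ∈ U) (j : Bool) : P.side e j ∉ U := by
  intro hj
  have h : ∀ m : E → V, P.NoClosedSet U B m → m e ∉ U := fun m hm hU => by
    have := hm {none} (by
      simp only [Finset.mem_singleton, forall_eq]
      exact ⟨e, he, node_of_mem hl, node_of_mem hU⟩)
    simp at this
  have h1 := h _ hε.left
  have h2 := h _ hε.right
  cases hb : ε (P.label e) <;> cases j <;> simp_all

theorem corner_mem_endpoints (hε : P.IsForestOrientation U B ε)
    (hX : P.IsSquareComplex U B a D Φ) {f : E × Ω} (hf : f ∈ Φ) (i j : Bool) :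
    P.corner a f i j ∈ endpoints a ε D := by
  have key : ∀ t, (P.slot a f t).1 ∉ U →
      src a ε (P.slot a f t) ∈ endpoints a ε D ∧ tgt a ε (P.slot a f t) ∈ endpoints a ε D :=
    fun t ht => ⟨Finset.mem_union_left _ (Finset.mem_image_of_mem _ (hX.slot_mem f hf t ht)),
      Finset.mem_union_right _ (Finset.mem_image_of_mem _ (hX.slot_mem f hf t ht))⟩
  by_cases hl : P.label f.1 ∈ U
  · have h := key (.inl j) (hε.side_notMem (hX.mem f hf) hl j)
    rw [src_slot_inl P ε (hX.closed f hf), tgt_slot_inl P ε (hX.closed f hf)] at h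
    cases h' : ε (P.side f.1 j) <;> cases i <;> simp_all
  · have h := key (.inr i) hl
    rw [src_slot_inr, tgt_slot_inr] at h
    cases h' : ε (P.label f.1) <;> cases j <;> simp_all

theorem card_leftCorner_lt (hε : P.IsForestOrientation U B ε)
    (hX : P.IsSquareComplex U B a D Φ) {y : Ω}
    (hy : (∃ d ∈ D, src a ε d = y) ∨ P.HasOldExit U a ε Φ y) :
    (Φ.filter fun f => P.leftCorner a ε f = y).card + 1 ≤
      (D.filter fun d => src a ε d = y).card + if P.HasOldExit U a ε Φ y then 1 else 0 := by
  set N : Finset (Option V) := ((D.filter fun d => src a ε d = y).image fun d => some d.1) ∪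
    if P.HasOldExit U a ε Φ y then {none} else ∅ with hN
  have hNmem : ∀ f ∈ Φ, ∀ t, src a ε (P.slot a f t) = y → node U (P.slot a f t).1 ∈ N := by
    intro f hf t ht
    by_cases hU : (P.slot a f t).1 ∈ U
    · rw [node_of_mem hU, hN, if_pos ⟨f, hf, t, hU, ht⟩]
      simp
    · rw [node_of_notMem hU]
      refine Finset.mem_union_left _ (Finset.mem_image.2 ⟨_, ?_, rfl⟩)
      exact Finset.mem_filter.2 ⟨hX.slot_mem f hf t hU, ht⟩
  have hNcard : N.card ≤
      (D.filter fun d => src a ε d = y).card + if P.HasOldExit U a ε Φ y then 1 else 0 := by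
    refine (Finset.card_union_le _ _).trans (add_le_add Finset.card_image_le ?_)
    split_ifs <;> simp
  refine le_trans ?_ hNcard
  have hlabel : ∀ f ∈ Φ, P.leftCorner a ε f = y → node U (P.label f.1) ∈ N := fun f hf hfy =>
    hNmem f hf (.inr (!ε (P.side f.1 (!ε (P.label f.1))))) (by rw [src_slot_inr]; exact hfy)
  have hleft : ∀ f ∈ Φ, P.leftCorner a ε f = y →
      node U (P.side f.1 (!ε (P.label f.1))) ∈ N := fun f hf hfy =>
    hNmem f hf (.inl (!ε (P.label f.1))) (by rw [src_slot_inl P ε (hX.closed f hf)]; exact hfy)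
  have hinj : Set.InjOn (fun f : E × Ω => node U (P.label f.1))
      (Φ.filter fun f => P.leftCorner a ε f = y) := by
    rintro ⟨e, ω⟩ hf ⟨e', ω'⟩ hf' h
    rw [Finset.mem_coe, Finset.mem_filter] at hf hf'
    obtain rfl := hε.inj e (hX.mem _ hf.1) e' (hX.mem _ hf'.1) h
    rw [P.corner_injective a e (hf.2.trans hf'.2.symm)]
  rw [← Finset.card_image_of_injOn hinj]
  refine Finset.card_lt_card (Finset.ssubset_iff_subset_ne.2 ⟨?_, fun heq => ?_⟩)
  · intro k hk
    simp only [Finset.mem_image, Finset.mem_filter] at hk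
    obtain ⟨f, ⟨hf, hfy⟩, rfl⟩ := hk
    exact hlabel f hf hfy
  · have : N = ∅ := hε.left N fun k hk => by
      rw [← heq] at hk
      simp only [Finset.mem_image, Finset.mem_filter] at hk
      obtain ⟨f, ⟨hf, hfy⟩, hfk⟩ := hk
      exact ⟨f.1, hX.mem f hf, hfk, hleft f hf hfy⟩
    rcases hy with ⟨d, hd, hdy⟩ | hy
    · refine absurd (this ▸ ?_ : some d.1 ∈ (∅ : Finset (Option V))) (Finset.notMem_empty _)
      exact Finset.mem_union_left _
        (Finset.mem_image.2 ⟨d, Finset.mem_filter.2 ⟨hd, hdy⟩, rfl⟩)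
    · refine absurd (this ▸ ?_ : none ∈ (∅ : Finset (Option V))) (Finset.notMem_empty _)
      rw [hN, if_pos hy]
      simp

/-- The edge `d` occurs at least twice among the edges of the squares in `Φ`. -/
def OccursTwice (P : LOG V E) (a : V → Equiv.Perm Ω) (Φ : Finset (E × Ω)) (d : V × Ω) : Prop :=
  ∃ f ∈ Φ, ∃ f' ∈ Φ, ∃ t t', (f, t) ≠ (f', t') ∧ P.slot a f t = d ∧ P.slot a f' t' = d

theorem exists_exit (hε : P.IsForestOrientation U B ε)
    (hX : P.IsSquareComplex U B a D Φ) (hD : ∀ d ∈ D, P.OccursTwice a Φ d) {y : Ω}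
    (hy : y ∈ endpoints a ε D) :
    (∃ d ∈ D, src a ε d = y) ∨ P.HasOldExit U a ε Φ y := by
  by_contra! hno
  obtain ⟨hno, hJ⟩ := hno
  have hsrc : ∀ f ∈ Φ, ∀ t, src a ε (P.slot a f t) ≠ y := by
    intro f hf t ht
    by_cases hU : (P.slot a f t).1 ∈ U
    · exact hJ ⟨f, hf, t, hU, ht⟩
    · exact hno _ (hX.slot_mem f hf t hU) ht
  set A := D.filter fun d => tgt a ε d = y with hA
  set D' := Φ.filter fun f => P.rightCorner a ε f = y with hD'
  set q : E → V := fun e => P.side e (ε (P.label e)) with hq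
  -- every edge of `A` only occurs on the right of a square with right corner `y`
  have hocc : ∀ f ∈ Φ, ∀ t, tgt a ε (P.slot a f t) = y → f ∈ D' ∧
      (t = .inl (ε (P.label f.1)) ∨ t = .inr (ε (q f.1))) := by
    intro f hf t ht
    rcases t with j | i
    · rw [tgt_slot_inl P ε (hX.closed f hf)] at ht
      by_cases hj : j = ε (P.label f.1)
      · subst hj
        exact ⟨Finset.mem_filter.2 ⟨hf, ht⟩, Or.inl rfl⟩
      · obtain rfl : j = !ε (P.label f.1) := by
          cases j <;> cases h : ε (P.label f.1) <;> simp_all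
        exact absurd ((src_slot_inr P a ε f _).trans ht) (hsrc f hf _)
    · rw [tgt_slot_inr] at ht
      by_cases hi : i = ε (q f.1)
      · subst hi
        exact ⟨Finset.mem_filter.2 ⟨hf, ht⟩, Or.inr rfl⟩
      · obtain rfl : i = !ε (q f.1) := by
          cases i <;> cases h : ε (q f.1) <;> simp_all
        exact absurd ((src_slot_inl P ε (hX.closed f hf) _).trans ht) (hsrc f hf _)
  have htwice : 2 * A.card ≤ (D'.filter fun f => P.label f.1 ∉ U).card +
      (D'.filter fun f => q f.1 ∉ U).card := by
    set O : Finset ((E × Ω) × (Bool ⊕ Bool)) :=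
      ((D'.filter fun f => P.label f.1 ∉ U).image fun f => (f, Sum.inr (ε (q f.1)))) ∪
      ((D'.filter fun f => q f.1 ∉ U).image fun f => (f, Sum.inl (ε (P.label f.1)))) with hO
    have hOcard : O.card ≤ (D'.filter fun f => P.label f.1 ∉ U).card +
        (D'.filter fun f => q f.1 ∉ U).card :=
      (Finset.card_union_le _ _).trans (add_le_add Finset.card_image_le Finset.card_image_le)
    refine le_trans ?_ hOcard
    refine (Finset.mul_card_image_le_card_of_maps_to
      (f := fun o : (E × Ω) × (Bool ⊕ Bool) => P.slot a o.1 o.2)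
      (s := O.filter fun o => P.slot a o.1 o.2 ∈ A) (t := A) ?_ 2 ?_).trans
      (Finset.card_le_card (Finset.filter_subset _ _))
    · intro o ho
      exact (Finset.mem_filter.1 ho).2
    · intro d hd
      have hdD := (Finset.mem_filter.1 hd).1
      have hdy := (Finset.mem_filter.1 hd).2
      obtain ⟨f, hf, f', hf', t, t', hne, h1, h2⟩ := hD d hdD
      have hmem : ∀ f ∈ Φ, ∀ t, P.slot a f t = d →
          (f, t) ∈ (O.filter fun o => P.slot a o.1 o.2 ∈ A).filter
            fun o => P.slot a o.1 o.2 = d := by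
        intro f hf t ht
        refine Finset.mem_filter.2 ⟨Finset.mem_filter.2 ⟨?_, ?_⟩, ht⟩
        · obtain ⟨hfD, rfl | rfl⟩ := hocc f hf t (by rw [ht]; exact hdy)
          · refine Finset.mem_union_right _ (Finset.mem_image_of_mem _ ?_)
            refine Finset.mem_filter.2 ⟨hfD, ?_⟩
            have := hX.notMem d hdD
            rwa [← ht] at this
          · refine Finset.mem_union_left _ (Finset.mem_image_of_mem _ ?_)
            refine Finset.mem_filter.2 ⟨hfD, ?_⟩
            have := hX.notMem d hdD
            rwa [← ht] at this
        · show P.slot a f t ∈ A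
          rw [ht]; exact hd
      exact Finset.one_lt_card.2 ⟨_, hmem f hf t h1, _, hmem f' hf' t' h2, hne⟩
  have hAne : A.Nonempty := by
    rcases Finset.mem_union.1 hy with hy | hy
    · obtain ⟨d, hd, hdy⟩ := Finset.mem_image.1 hy
      exact absurd hdy (hno d hd)
    · obtain ⟨d, hd, hdy⟩ := Finset.mem_image.1 hy
      exact ⟨d, Finset.mem_filter.2 ⟨hd, hdy⟩⟩
  set N : Finset (Option V) := A.image fun d => some d.1 with hN
  have hNcard : N.card = A.card := Finset.card_image_of_injOn fun d hd d' hd' h => by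
    rw [Finset.mem_coe, Finset.mem_filter] at hd hd'
    exact tgt_injective a ε (Option.some.inj h) (hd.2.trans hd'.2.symm)
  have hNne : N.Nonempty := hAne.image _
  have hNmem : ∀ f ∈ Φ, ∀ t, tgt a ε (P.slot a f t) = y → (P.slot a f t).1 ∉ U →
      node U (P.slot a f t).1 ∈ N := by
    intro f hf t ht hU
    rw [node_of_notMem hU]
    exact Finset.mem_image.2 ⟨_, Finset.mem_filter.2 ⟨hX.slot_mem f hf t hU, ht⟩, rfl⟩
  have hlabel : ∀ f ∈ D', P.label f.1 ∉ U → node U (P.label f.1) ∈ N := fun f hf => by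
    obtain ⟨hf, hfy⟩ := Finset.mem_filter.1 hf
    exact hNmem f hf (.inr (ε (q f.1))) (by rw [tgt_slot_inr]; exact hfy)
  have hside : ∀ f ∈ D', q f.1 ∉ U → node U (q f.1) ∈ N := fun f hf => by
    obtain ⟨hf, hfy⟩ := Finset.mem_filter.1 hf
    exact hNmem f hf (.inl (ε (P.label f.1)))
      (by rw [tgt_slot_inl P ε (hX.closed f hf)]; exact hfy)
  have hinj : Set.InjOn (fun f : E × Ω => node U (P.label f.1)) D' := by
    rintro ⟨e, ω⟩ hf ⟨e', ω'⟩ hf' h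
    rw [Finset.mem_coe, Finset.mem_filter] at hf hf'
    obtain rfl := hε.inj e (hX.mem _ hf.1) e' (hX.mem _ hf'.1) h
    rw [P.corner_injective a e (hf.2.trans hf'.2.symm)]
  have hMcard := Finset.card_image_of_injOn hinj
  have hclosed : ∀ K : Finset (Option V), K ⊆ D'.image (fun f => node U (P.label f.1)) →
      (∀ f ∈ D', node U (q f.1) ∈ K) → K = ∅ := fun K hK hKq => hε.right K fun k hk => by
    obtain ⟨f, hf, hfk⟩ := Finset.mem_image.1 (hK hk)
    exact ⟨f.1, hX.mem f (Finset.mem_filter.1 hf).1, hfk, hKq f hf⟩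
  have hl1 := Finset.card_filter_le D' fun f => P.label f.1 ∉ U
  have hl2 := Finset.card_filter_le D' fun f => q f.1 ∉ U
  by_cases hold : ∃ f ∈ D', P.label f.1 ∈ U
  · have hlt : (D'.filter fun f => P.label f.1 ∉ U).card < D'.card := by
      obtain ⟨f, hf, hfU⟩ := hold
      exact Finset.card_lt_card (Finset.filter_ssubset.2 ⟨f, hf, not_not.2 hfU⟩)
    have hsub : D'.image (fun f => node U (P.label f.1)) ⊆ insert none N := fun k hk => by
      obtain ⟨f, hf, rfl⟩ := Finset.mem_image.1 hk
      by_cases hU : P.label f.1 ∈ U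
      · simp [node_of_mem hU]
      · exact Finset.mem_insert_of_mem (hlabel f hf hU)
    have hcard : (insert none N).card ≤ A.card + 1 := hNcard ▸ Finset.card_insert_le _ _
    have hle := Finset.card_le_card hsub
    have heq := Finset.eq_of_subset_of_card_le hsub (by omega)
    have := hclosed _ heq.ge fun f hf => by
      by_cases hU : q f.1 ∈ U
      · simp [node_of_mem hU]
      · exact Finset.mem_insert_of_mem (hside f hf hU)
    simp at this
  · push Not at hold
    have hsub : D'.image (fun f => node U (P.label f.1)) ⊆ N := fun k hk => by
      obtain ⟨f, hf, rfl⟩ := Finset.mem_image.1 hk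
      exact hlabel f hf (hold f hf)
    have hle := Finset.card_le_card hsub
    have heq := Finset.eq_of_subset_of_card_le hsub (by omega)
    have hfil : D'.filter (fun f => q f.1 ∉ U) = D' :=
      Finset.eq_of_subset_of_card_le (Finset.filter_subset _ _) (by omega)
    refine hNne.ne_empty (hclosed N heq.ge fun f hf => hside f hf ?_)
    rw [← hfil] at hf
    exact (Finset.mem_filter.1 hf).2

/-- Two points in the same orbit of the generators in `U`. -/
def OldStep (U : Set V) (a : V → Equiv.Perm Ω) (ω ω' : Ω) : Prop := ∃ u ∈ U, a u ω = ω'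

/-- The components of the endpoints of `D` under the moves by generators in `U`. -/
noncomputable def components (U : Set V) (a : V → Equiv.Perm Ω) (ε : V → Bool)
    (D : Finset (V × Ω)) : Finset (Quot (OldStep U a)) :=
  (endpoints a ε D).image (Quot.mk _)

theorem head_mem_endpoints {d : V × Ω} (hd : d ∈ D) :
    a d.1 d.2 ∈ endpoints a ε D ∧ d.2 ∈ endpoints a ε D := by
  have h1 : src a ε d ∈ endpoints a ε D := Finset.mem_union_left _ (Finset.mem_image_of_mem _ hd)
  have h2 : tgt a ε d ∈ endpoints a ε D := Finset.mem_union_right _ (Finset.mem_image_of_mem _ hd)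
  cases h : ε d.1 <;> simp_all [src, tgt]

theorem card_edges_lt (hD : D.Nonempty) (hZ : P.CocyclesExact U a D Φ)
    (hnot : ∀ d ∈ D, d.1 ∉ U) :
    D.card + 1 ≤ Φ.card + (components U a ε D).card := by
  obtain ⟨d₀, hd₀⟩ := hD
  have hmem : ∀ d ∈ D, Quot.mk _ (a d.1 d.2) ∈ components U a ε D ∧
      Quot.mk _ d.2 ∈ components U a ε D := fun d hd =>
    ⟨Finset.mem_image_of_mem _ (head_mem_endpoints hd).1,
      Finset.mem_image_of_mem _ (head_mem_endpoints hd).2⟩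
  set c₀ : Quot (OldStep U a) := Quot.mk _ d₀.2
  have hc₀ : c₀ ∈ components U a ε D := (hmem d₀ hd₀).2
  set C := (components U a ε D).erase c₀ with hC
  let ext : (D → ℚ) →ₗ[ℚ] (V × Ω → ℚ) :=
    { toFun := fun k d => if h : d ∈ D then k ⟨d, h⟩ else 0
      map_add' := fun k l => by ext d; by_cases h : d ∈ D <;> simp [h]
      map_smul' := fun r k => by ext d; by_cases h : d ∈ D <;> simp [h] }
  let bd : (D → ℚ) →ₗ[ℚ] (Φ → ℚ) :=
    { toFun := fun k f => ext k (P.slot a f (.inl true)) + ext k (P.slot a f (.inr false)) -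
        (ext k (P.slot a f (.inr true)) + ext k (P.slot a f (.inl false)))
      map_add' := fun k l => by ext f; simp only [map_add, Pi.add_apply]; ring
      map_smul' := fun r k => by
        ext f
        simp only [map_smul, Pi.smul_apply, smul_eq_mul, RingHom.id_apply]
        ring }
  let extC : (C → ℚ) →ₗ[ℚ] (Quot (OldStep U a) → ℚ) :=
    { toFun := fun b c => if h : c ∈ C then b ⟨c, h⟩ else 0
      map_add' := fun k l => by ext d; by_cases h : d ∈ C <;> simp [h]
      map_smul' := fun r k => by ext d; by_cases h : d ∈ C <;> simp [h] }
  let cobd : (C → ℚ) →ₗ[ℚ] (D → ℚ) :=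
    { toFun := fun b d => extC b (Quot.mk _ (a d.1.1 d.1.2)) - extC b (Quot.mk _ d.1.2)
      map_add' := fun k l => by ext f; simp only [map_add, Pi.add_apply]; ring
      map_smul' := fun r k => by
        ext f
        simp only [map_smul, Pi.smul_apply, smul_eq_mul, RingHom.id_apply]
        ring }
  have hker : LinearMap.ker bd ≤ LinearMap.range cobd := by
    intro k hk
    obtain ⟨b, hbU, hb⟩ := hZ (ext k)
      (fun u hu ω => dif_neg fun h => hnot _ h hu)
      (fun f hf => sub_eq_zero.1 (congrFun (LinearMap.mem_ker.1 hk) ⟨f, hf⟩))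
    let b' : Quot (OldStep U a) → ℚ := Quot.lift b fun ω ω' ⟨u, hu, h⟩ => by rw [← h, hbU u hu]
    have hext : ∀ c ∈ components U a ε D,
        extC (fun c => b' c - b' c₀) c = b' c - b' c₀ := by
      intro c hc
      by_cases h : c = c₀
      · subst h
        show dite _ _ _ = _
        rw [dif_neg (by simp [hC])]
        simp
      · show dite _ _ _ = _
        rw [dif_pos (Finset.mem_erase.2 ⟨h, hc⟩)]
    refine ⟨fun c => b' c - b' c₀, funext fun d => ?_⟩
    show extC _ _ - extC _ _ = _
    rw [hext _ (hmem d d.2).1, hext _ (hmem d d.2).2]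
    have h1 := hb d d.2
    have h2 : ext k d = k d := dif_pos d.2
    show b _ - _ - (b _ - _) = _
    rw [← h2, h1]
    ring
  have h1 := LinearMap.finrank_range_add_finrank_ker bd
  have h2 := Submodule.finrank_mono hker
  have h3 := LinearMap.finrank_range_le cobd
  have h4 := Submodule.finrank_le (LinearMap.range bd)
  simp only [Module.finrank_fintype_fun_eq_card, Fintype.card_coe] at h1 h3 h4
  have h5 : C.card + 1 = (components U a ε D).card := Finset.card_erase_add_one hc₀
  omega

theorem card_components_le (hε : P.IsForestOrientation U B ε)
    (hX : P.IsSquareComplex U B a D Φ) (ht : Ω → ℤ) (hht : ∀ v ω, ht (a v ω) = ht ω + 1) :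
    (components U a ε D).card ≤
      ((endpoints a ε D).filter fun y => ¬ P.HasOldExit U a ε Φ y).card := by
  obtain ⟨σ, hσ⟩ : ∃ σ : ℤ, ∀ u ∈ U, ∀ ω, σ * ht (src a ε (u, ω)) < σ * ht (tgt a ε (u, ω)) := by
    by_cases h : ∃ u ∈ U, ε u = false
    · obtain ⟨u, hu, hεu⟩ := h
      refine ⟨-1, fun u' hu' ω => ?_⟩
      have := hε.const u' hu' u hu
      simp [src, tgt, this, hεu, hht]
    · push Not at h
      refine ⟨1, fun u' hu' ω => ?_⟩
      have := h u' hu'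
      simp [src, tgt, this, hht]
  refine (Finset.card_le_card (t := ((endpoints a ε D).filter
    fun y => ¬ P.HasOldExit U a ε Φ y).image (Quot.mk (OldStep U a))) ?_).trans
    Finset.card_image_le
  intro c hc
  obtain ⟨y, hy, hyc⟩ := Finset.mem_image.1 hc
  obtain ⟨z, hz, hmax⟩ := Finset.exists_max_image
    ((endpoints a ε D).filter fun y => Quot.mk (OldStep U a) y = c) (fun y => σ * ht y)
    ⟨y, Finset.mem_filter.2 ⟨hy, hyc⟩⟩
  obtain ⟨hz, hzc⟩ := Finset.mem_filter.1 hz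
  refine Finset.mem_image.2 ⟨z, Finset.mem_filter.2 ⟨hz, ?_⟩, hzc⟩
  rintro ⟨f, hf, t, hU, hsrc⟩
  have hlt := hσ _ hU (P.slot a f t).2
  have htgt : tgt a ε (P.slot a f t) ∈ endpoints a ε D := by
    rcases t with j | i
    · rw [tgt_slot_inl P ε (hX.closed f hf)]
      exact corner_mem_endpoints hε hX hf _ _
    · rw [tgt_slot_inr]
      exact corner_mem_endpoints hε hX hf _ _
  have hcls : Quot.mk (OldStep U a) (tgt a ε (P.slot a f t)) = c := by
    rw [← hzc, ← hsrc]
    have : Quot.mk (OldStep U a) (P.slot a f t).2 =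
        Quot.mk (OldStep U a) (a (P.slot a f t).1 (P.slot a f t).2) :=
      Quot.sound ⟨_, hU, rfl⟩
    unfold src tgt
    split_ifs
    · exact this.symm
    · exact this
  have := hmax _ (Finset.mem_filter.2 ⟨htgt, hcls⟩)
  rw [← hsrc] at this
  exact absurd hlt (not_lt.2 this)

/-- A square complex whose cocycles are exact has an edge that occurs at most once. -/
theorem exists_free_edge (hε : P.IsForestOrientation U B ε)
    (hX : P.IsSquareComplex U B a D Φ) (hZ : P.CocyclesExact U a D Φ) (hD : D.Nonempty)
    (ht : Ω → ℤ) (hht : ∀ v ω, ht (a v ω) = ht ω + 1) :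
    ∃ d ∈ D, ¬ P.OccursTwice a Φ d := by
  by_contra! hall
  have hsum := Finset.sum_le_sum fun y (hy : y ∈ endpoints a ε D) =>
    card_leftCorner_lt hε hX (exists_exit hε hX hall hy)
  rw [Finset.sum_add_distrib, Finset.sum_add_distrib, ← Finset.card_filter,
    ← Finset.card_eq_sum_card_fiberwise (f := P.leftCorner a ε) fun f hf =>
      corner_mem_endpoints hε hX hf _ _,
    ← Finset.card_eq_sum_card_fiberwise (s := D) (f := src a ε) (t := endpoints a ε D) fun _ hd =>
      Finset.mem_union_left _ (Finset.mem_image_of_mem _ hd),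
    ← Finset.card_eq_sum_ones] at hsum
  have h1 : ((endpoints a ε D).filter fun y => P.HasOldExit U a ε Φ y).card +
      ((endpoints a ε D).filter fun y => ¬ P.HasOldExit U a ε Φ y).card =
        (endpoints a ε D).card :=
    Finset.card_filter_add_card_filter_not _
  have h2 := card_components_le hε hX ht hht
  have h3 := card_edges_lt (ε := ε) hD hZ hX.notMem
  omega

/-- The edge labels `k` multiply consistently around the square `f`. -/
def IsFlatOn {H : Type} [Group H] (P : LOG V E) (a : V → Equiv.Perm Ω) (k : V × Ω → H)
    (f : E × Ω) : Prop :=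
  k (P.slot a f (.inl true)) * k (P.slot a f (.inr false)) =
    k (P.slot a f (.inr true)) * k (P.slot a f (.inl false))

theorem exists_update_isFlatOn {H : Type} [Group H] {d : V × Ω} (hd : ¬ P.OccursTwice a Φ d)
    (k : V × Ω → H) (hk : ∀ f ∈ Φ, (∀ t, P.slot a f t ≠ d) → P.IsFlatOn a k f) :
    ∃ x, ∀ f ∈ Φ, P.IsFlatOn a (Function.update k d x) f := by
  have hother : ∀ x, ∀ f ∈ Φ, (∀ t, P.slot a f t ≠ d) →
      P.IsFlatOn a (Function.update k d x) f := fun x f hf hfd => by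
    have := hk f hf hfd
    unfold IsFlatOn at this ⊢
    rwa [Function.update_of_ne (hfd _), Function.update_of_ne (hfd _),
      Function.update_of_ne (hfd _), Function.update_of_ne (hfd _)]
  by_cases hex : ∃ f ∈ Φ, ∃ t, P.slot a f t = d
  · obtain ⟨f, hf, t, hft⟩ := hex
    have huniq : ∀ f' ∈ Φ, ∀ t', P.slot a f' t' = d → (f', t') = (f, t) := fun f' hf' t' h => by
      by_contra hne
      exact hd ⟨f', hf', f, hf, t', t, hne, h, hft⟩
    have hslot : ∀ t', t' ≠ t → P.slot a f t' ≠ d := fun t' ht' h =>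
      ht' (congrArg Prod.snd (huniq f hf t' h))
    suffices ∃ x, P.IsFlatOn a (Function.update k d x) f by
      obtain ⟨x, hx⟩ := this
      refine ⟨x, fun f' hf' => ?_⟩
      by_cases hff : f' = f
      · exact hff ▸ hx
      · exact hother x f' hf' fun t' h => hff (congrArg Prod.fst (huniq f' hf' t' h))
    unfold IsFlatOn
    rcases t with (_ | _) | (_ | _)
    · refine ⟨(k (P.slot a f (.inr true)))⁻¹ *
        (k (P.slot a f (.inl true)) * k (P.slot a f (.inr false))), ?_⟩
      rw [hft, Function.update_self, Function.update_of_ne (hslot _ (by simp)),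
        Function.update_of_ne (hslot _ (by simp)), Function.update_of_ne (hslot _ (by simp))]
      group
    · refine ⟨k (P.slot a f (.inr true)) * k (P.slot a f (.inl false)) *
        (k (P.slot a f (.inr false)))⁻¹, ?_⟩
      rw [hft, Function.update_self, Function.update_of_ne (hslot _ (by simp)),
        Function.update_of_ne (hslot _ (by simp)), Function.update_of_ne (hslot _ (by simp))]
      group
    · refine ⟨(k (P.slot a f (.inl true)))⁻¹ *
        (k (P.slot a f (.inr true)) * k (P.slot a f (.inl false))), ?_⟩
      rw [hft, Function.update_self, Function.update_of_ne (hslot _ (by simp)),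
        Function.update_of_ne (hslot _ (by simp)), Function.update_of_ne (hslot _ (by simp))]
      group
    · refine ⟨k (P.slot a f (.inl true)) * k (P.slot a f (.inr false)) *
        (k (P.slot a f (.inl false)))⁻¹, ?_⟩
      rw [hft, Function.update_self, Function.update_of_ne (hslot _ (by simp)),
        Function.update_of_ne (hslot _ (by simp)), Function.update_of_ne (hslot _ (by simp))]
      group
  · push Not at hex
    exact ⟨1, fun f hf => hother 1 f hf (hex f hf)⟩

/-- Edge labels prescribed on `U` extend to labels that are flat on every square, provided that
the cocycles of the square complex are exact. -/
theorem exists_isFlatOn (hε : P.IsForestOrientation U B ε)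
    (ht : Ω → ℤ) (hht : ∀ v ω, ht (a v ω) = ht ω + 1)
    (hX : P.IsSquareComplex U B a D Φ) (hZ : P.CocyclesExact U a D Φ)
    {H : Type} [Group H] (η : V × Ω → H) :
    ∃ k : V × Ω → H, (∀ u ∈ U, ∀ ω, k (u, ω) = η (u, ω)) ∧ ∀ f ∈ Φ, P.IsFlatOn a k f := by
  induction hn : D.card generalizing D Φ with
  | zero =>
    obtain rfl := Finset.card_eq_zero.1 hn
    refine ⟨η, fun _ _ _ => rfl, fun f hf => ?_⟩
    by_cases hl : P.label f.1 ∈ U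
    · exact absurd (hX.slot_mem f hf (.inl true) (hε.side_notMem (hX.mem f hf) hl true))
        (Finset.notMem_empty _)
    · exact absurd (hX.slot_mem f hf (.inr true) hl) (Finset.notMem_empty _)
  | succ n ih =>
    obtain ⟨d, hd, hfree⟩ := exists_free_edge hε hX hZ (Finset.card_pos.1 (by omega)) ht hht
    have hdU := hX.notMem d hd
    set Φ' := Φ.filter fun f => ∀ t, P.slot a f t ≠ d with hΦ'
    have hX' : P.IsSquareComplex U B a (D.erase d) Φ' :=
      { notMem := fun d' hd' => hX.notMem d' (Finset.mem_of_mem_erase hd')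
        mem := fun f hf => hX.mem f (Finset.mem_filter.1 hf).1
        closed := fun f hf => hX.closed f (Finset.mem_filter.1 hf).1
        slot_mem := fun f hf t hU => Finset.mem_erase.2
          ⟨(Finset.mem_filter.1 hf).2 t, hX.slot_mem f (Finset.mem_filter.1 hf).1 t hU⟩ }
    have hne : ∀ u ∈ U, ∀ ω, (u, ω) ≠ d := fun u hu ω h => hdU (h ▸ hu)
    have hZ' : P.CocyclesExact U a (D.erase d) Φ' := by
      intro k hkU hk
      obtain ⟨x, hx⟩ := exists_update_isFlatOn (H := Multiplicative ℚ) hfree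
        (fun d => Multiplicative.ofAdd (k d)) fun f hf hfd => by
          have := hk f (Finset.mem_filter.2 ⟨hf, hfd⟩)
          exact congrArg Multiplicative.ofAdd this
      obtain ⟨b, hbU, hb⟩ := hZ (Function.update k d x.toAdd)
        (fun u hu ω => by rw [Function.update_of_ne (hne u hu ω)]; exact hkU u hu ω)
        (fun f hf => by
          have := congrArg Multiplicative.toAdd (hx f hf)
          have hup : ∀ d', (Function.update (fun d => Multiplicative.ofAdd (k d)) d x d').toAdd =
              Function.update k d x.toAdd d' := fun d' => by
            by_cases h : d' = d
            · subst h; simp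
            · simp [Function.update_of_ne h]
          simpa only [toAdd_mul, hup] using this)
      refine ⟨b, hbU, fun d' hd' => ?_⟩
      have := hb d' (Finset.mem_of_mem_erase hd')
      rwa [Function.update_of_ne (Finset.ne_of_mem_erase hd')] at this
    obtain ⟨k, hkU, hk⟩ := ih hX' hZ' (by rw [Finset.card_erase_of_mem hd]; omega)
    obtain ⟨x, hx⟩ := exists_update_isFlatOn hfree k fun f hf hfd =>
      hk f (Finset.mem_filter.2 ⟨hf, hfd⟩)
    refine ⟨Function.update k d x, fun u hu ω => ?_, hx⟩
    rw [Function.update_of_ne (hne u hu ω)]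
    exact hkU u hu ω

end Squares

end LOG
namespace LOG

section Cover

variable {V E : Type}

/-- The relator `x z (z y)⁻¹` of an edge. -/
def relator (P : LOG V E) (e : E) : FreeGroup V :=
  FreeGroup.of (P.init e) * FreeGroup.of (P.label e) *
    (FreeGroup.of (P.label e) * FreeGroup.of (P.term e))⁻¹

/-- The subgroup generated by the conjugates `u r u⁻¹` of relators indexed by `Θ`. -/
def conjSubgroup (P : LOG V E) (Θ : Set (FreeGroup V × E)) : Subgroup (FreeGroup V) :=
  Subgroup.closure ((fun p => p.1 * P.relator p.2 * p.1⁻¹) '' Θ)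

theorem exists_finset_mem_conjSubgroup (P : LOG V E) (A : Set E) {g : FreeGroup V}
    (hg : g ∈ Subgroup.normalClosure (P.relator '' A)) :
    ∃ Θ : Finset (FreeGroup V × E), (∀ p ∈ Θ, p.2 ∈ A) ∧ g ∈ P.conjSubgroup Θ := by
  classical
  have hmono : ∀ Θ Θ' : Finset (FreeGroup V × E), Θ ⊆ Θ' →
      P.conjSubgroup Θ ≤ P.conjSubgroup Θ' := fun Θ Θ' h =>
    Subgroup.closure_mono (Set.image_mono (Finset.coe_subset.2 h))
  induction hg using Subgroup.closure_induction with
  | mem x hx =>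
    obtain ⟨r, ⟨e, he, rfl⟩, hr⟩ := Group.mem_conjugatesOfSet_iff.1 hx
    obtain ⟨u, rfl⟩ := isConj_iff.1 hr
    refine ⟨{(u, e)}, by simpa using he, Subgroup.subset_closure ⟨(u, e), by simp, rfl⟩⟩
  | one => exact ⟨∅, by simp, one_mem _⟩
  | mul x y _ _ hx hy =>
    obtain ⟨Θ, hΘ, hx⟩ := hx
    obtain ⟨Θ', hΘ', hy⟩ := hy
    refine ⟨Θ ∪ Θ', fun p hp => ?_, mul_mem (hmono _ _ Finset.subset_union_left hx)
      (hmono _ _ Finset.subset_union_right hy)⟩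
    rcases Finset.mem_union.1 hp with h | h
    exacts [hΘ p h, hΘ' p h]
  | inv x _ hx =>
    obtain ⟨Θ, hΘ, hx⟩ := hx
    exact ⟨Θ, hΘ, inv_mem hx⟩

/-- The action of a generator on the cosets of `S`. -/
def cosetPerm (S : Subgroup (FreeGroup V)) (v : V) : Equiv.Perm (FreeGroup V ⧸ S) :=
  MulAction.toPerm (FreeGroup.of v)

/-- The base point of the square of the relator of `p.2` conjugated by `p.1`. -/
def squareBase (P : LOG V E) (S : Subgroup (FreeGroup V)) (p : FreeGroup V × E) :
    FreeGroup V ⧸ S :=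
  ((FreeGroup.of (P.label p.2) * FreeGroup.of (P.term p.2))⁻¹ * p.1⁻¹ : FreeGroup V)

theorem isClosedSquare_squareBase (P : LOG V E) {Θ : Set (FreeGroup V × E)}
    {S : Subgroup (FreeGroup V)} (hS : S = P.conjSubgroup Θ)
    {p : FreeGroup V × E} (hp : p ∈ Θ) :
    P.IsClosedSquare (cosetPerm S) (p.2, P.squareBase S p) := by
  have hmem : p.1 * P.relator p.2 * p.1⁻¹ ∈ S := hS ▸ Subgroup.subset_closure ⟨p, hp, rfl⟩
  refine QuotientGroup.eq.2 ?_
  convert inv_mem hmem using 1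
  simp only [smul_eq_mul, relator]
  group

/-- A flat labeling of the edges of the coset graph is the coboundary of a potential. -/
theorem exists_potential (P : LOG V E) {Θ : Set (FreeGroup V × E)}
    {S : Subgroup (FreeGroup V)} (hS : S = P.conjSubgroup Θ) {K : Type} [Group K]
    (k : V × (FreeGroup V ⧸ S) → K)
    (hk : ∀ p ∈ Θ, P.IsFlatOn (cosetPerm S) k (p.2, P.squareBase S p)) :
    ∃ φ : FreeGroup V ⧸ S → K, ∀ v ω, φ (cosetPerm S v ω) = k (v, ω) * φ ω := by
  let Ψ : FreeGroup V →* Equiv.Perm ((FreeGroup V ⧸ S) × K) := FreeGroup.lift fun v =>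
    { toFun := fun p => (cosetPerm S v p.1, k (v, p.1) * p.2)
      invFun := fun p => ((cosetPerm S v).symm p.1, (k (v, (cosetPerm S v).symm p.1))⁻¹ * p.2)
      left_inv := fun p => by simp
      right_inv := fun p => by simp }
  have hof : ∀ v p, Ψ (FreeGroup.of v) p = (cosetPerm S v p.1, k (v, p.1) * p.2) := fun v p => by
    simp only [Ψ, FreeGroup.lift_apply_of]
    rfl
  have hinv : ∀ w p, Ψ w (Ψ w⁻¹ p) = p := fun w p => by
    rw [← Equiv.Perm.mul_apply, ← map_mul, mul_inv_cancel, map_one, Equiv.Perm.one_apply]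
  have hfst : ∀ w p, (Ψ w p).1 = w • p.1 := by
    intro w
    induction w using FreeGroup.induction_on with
    | C1 => simp
    | of v => intro p; rw [hof]; rfl
    | inv_of v h =>
      intro p
      rw [eq_inv_smul_iff, ← h, hinv]
    | mul x y hx hy => intro p; rw [map_mul, Equiv.Perm.mul_apply, hx, hy, mul_smul]
  set q : (FreeGroup V ⧸ S) × K := (((1 : FreeGroup V) : FreeGroup V ⧸ S), 1) with hq
  have hfix : ∀ s ∈ S, Ψ s q = q := by
    intro s hs
    rw [hS] at hs
    have : P.conjSubgroup Θ ≤ (MulAction.stabilizer _ q).comap Ψ := by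
      rw [conjSubgroup, Subgroup.closure_le]
      rintro _ ⟨⟨u, e⟩, hp, rfl⟩
      have hflat := hk _ hp
      show Ψ _ _ = _
      set p₀ := Ψ (FreeGroup.of (P.label e) * FreeGroup.of (P.term e))⁻¹ (Ψ u⁻¹ q) with hp₀
      have h1 : p₀.1 = P.squareBase S (u, e) := by
        rw [hp₀, hfst, hfst]
        show ((_ * (_ * 1) : FreeGroup V) : FreeGroup V ⧸ S) = _
        rw [mul_one]
        rfl
      have h2 : Ψ (FreeGroup.of (P.init e) * FreeGroup.of (P.label e)) p₀ =
          Ψ (FreeGroup.of (P.label e) * FreeGroup.of (P.term e)) p₀ := by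
        simp only [map_mul, Equiv.Perm.mul_apply, hof, h1]
        refine Prod.ext (P.isClosedSquare_squareBase hS hp) ?_
        show _ * (_ * _) = _ * (_ * _)
        rw [← mul_assoc, ← mul_assoc]
        exact congrArg (· * p₀.2) hflat
      have h3 : Ψ (P.relator e) (Ψ u⁻¹ q) = Ψ u⁻¹ q := by
        rw [relator, map_mul, Equiv.Perm.mul_apply, ← hp₀, h2, hp₀, hinv]
      rw [map_mul, map_mul, Equiv.Perm.mul_apply, Equiv.Perm.mul_apply, h3, hinv]
    exact this hs
  refine ⟨Quotient.lift (s := QuotientGroup.leftRel S) (fun w => (Ψ w q).2)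
    fun w w' hww => ?_, fun v ω => ?_⟩
  · have h := hfix _ (QuotientGroup.leftRel_apply.1 hww)
    rw [map_mul, Equiv.Perm.mul_apply] at h
    show (Ψ w q).2 = (Ψ w' q).2
    rw [← congrArg (Ψ w) h, hinv]
  · obtain ⟨w, rfl⟩ := QuotientGroup.mk_surjective ω
    show (Ψ (FreeGroup.of v * w) q).2 = _ * (Ψ w q).2
    rw [map_mul, Equiv.Perm.mul_apply, hof, hfst]
    show k (v, ((w * 1 : FreeGroup V) : FreeGroup V ⧸ S)) * _ = _
    rw [mul_one]

open scoped Classical in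
/-- Relators on edges outside `O` have no consequences over the generators in `U` beyond those
of the relators on `O`, provided that a suitable orientation exists. -/
theorem mem_normalClosure_of_isForestOrientation (P : LOG V E) {U : Set V} {A O : Set E}
    (hO : ∀ e ∈ O, P.init e ∈ U ∧ P.label e ∈ U ∧ P.term e ∈ U) {ε : V → Bool}
    (hε : P.IsForestOrientation U (A \ O) ε) {g : FreeGroup V}
    (hgU : g ∈ Subgroup.closure (FreeGroup.of '' U))
    (hg : g ∈ Subgroup.normalClosure (P.relator '' A)) :
    g ∈ Subgroup.normalClosure (P.relator '' O) := by
  obtain ⟨Θ, hΘA, hgΘ⟩ := P.exists_finset_mem_conjSubgroup A hg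
  generalize hS : P.conjSubgroup Θ = S at hgΘ
  set a := cosetPerm S with ha
  set Φ : Finset (E × (FreeGroup V ⧸ S)) :=
    (Θ.filter fun p => p.2 ∉ O).image fun p => (p.2, P.squareBase S p) with hΦ
  set D : Finset (V × (FreeGroup V ⧸ S)) :=
    ((Φ ×ˢ Finset.univ).image fun q => P.slot a q.1 q.2).filter fun d => d.1 ∉ U with hD
  have hX : P.IsSquareComplex U (A \ O) a D Φ :=
    { notMem := fun d hd => (Finset.mem_filter.1 hd).2
      mem := fun f hf => by
        obtain ⟨p, hp, rfl⟩ := Finset.mem_image.1 hf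
        obtain ⟨hp, hpO⟩ := Finset.mem_filter.1 hp
        exact ⟨hΘA p hp, hpO⟩
      closed := fun f hf => by
        obtain ⟨p, hp, rfl⟩ := Finset.mem_image.1 hf
        exact P.isClosedSquare_squareBase hS.symm (Finset.mem_filter.1 hp).1
      slot_mem := fun f hf t hU => Finset.mem_filter.2
        ⟨Finset.mem_image.2 ⟨(f, t), Finset.mem_product.2 ⟨hf, Finset.mem_univ _⟩, rfl⟩, hU⟩ }
  have hpot : ∀ {K : Type} [Group K] (k : V × (FreeGroup V ⧸ S) → K),
      (∀ f ∈ Φ, P.IsFlatOn a k f) → (∀ e ∈ O, ∀ ω, P.IsFlatOn a k (e, ω)) →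
      ∃ φ : FreeGroup V ⧸ S → K, ∀ v ω, φ (a v ω) = k (v, ω) * φ ω := by
    intro K _ k hkΦ hkO
    refine P.exists_potential hS.symm k fun p hp => ?_
    by_cases hpO : p.2 ∈ O
    · exact hkO _ hpO _
    · exact hkΦ _ (Finset.mem_image.2 ⟨p, Finset.mem_filter.2 ⟨hp, hpO⟩, rfl⟩)
  have hslotO : ∀ e ∈ O, ∀ ω t, (P.slot a (e, ω) t).1 ∈ U := by
    intro e he ω t
    obtain ⟨h1, h2, h3⟩ := hO e he
    rcases t with (_ | _) | _
    exacts [h3, h1, h2]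
  obtain ⟨ht, hht⟩ := hpot (K := Multiplicative ℤ) (fun _ => Multiplicative.ofAdd 1)
    (fun _ _ => rfl) (fun _ _ _ => rfl)
  have hZ : P.CocyclesExact U a D Φ := by
    intro k hkU hk
    obtain ⟨φ, hφ⟩ := hpot (K := Multiplicative ℚ) (fun d => Multiplicative.ofAdd (k d))
      (fun f hf => congrArg Multiplicative.ofAdd (hk f hf))
      (fun e he ω => by
        have h0 : ∀ t, k (P.slot a (e, ω) t) = 0 := fun t => hkU _ (hslotO e he ω t) _
        simp only [IsFlatOn, h0])
    refine ⟨fun ω => (φ ω).toAdd, fun u hu ω => ?_, fun d _ => ?_⟩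
    · dsimp only
      rw [hφ, hkU u hu, ofAdd_zero, one_mul]
    · dsimp only
      rw [hφ, toAdd_mul, toAdd_ofAdd]
      ring
  obtain ⟨k, hkU, hk⟩ := exists_isFlatOn hε (fun ω => (ht ω).toAdd)
    (fun v ω => by rw [hht, toAdd_mul, toAdd_ofAdd, add_comm]) hX hZ
    (fun d => (QuotientGroup.mk (FreeGroup.of d.1) :
      FreeGroup V ⧸ Subgroup.normalClosure (P.relator '' O)))
  obtain ⟨φ, hφ⟩ := hpot k hk fun e he ω => by
    unfold IsFlatOn
    rw [hkU _ (hslotO e he ω _), hkU _ (hslotO e he ω _), hkU _ (hslotO e he ω _),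
      hkU _ (hslotO e he ω _)]
    have : P.relator e ∈ Subgroup.normalClosure (P.relator '' O) :=
      Subgroup.subset_normalClosure ⟨e, he, rfl⟩
    rw [← QuotientGroup.eq_one_iff] at this
    exact mul_inv_eq_one.1 this
  have hφg : ∀ ω, φ (g • ω) = QuotientGroup.mk g * φ ω := by
    clear hg hgΘ
    induction hgU using Subgroup.closure_induction with
    | mem x hx =>
      obtain ⟨u, hu, rfl⟩ := hx
      intro ω
      rw [← hkU u hu ω]
      exact hφ u ω
    | one => intro ω; rw [one_smul, QuotientGroup.mk_one, one_mul]
    | mul x y _ _ hx hy => intro ω; rw [mul_smul, hx, hy, QuotientGroup.mk_mul, mul_assoc]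
    | inv x _ hx =>
      intro ω
      have := hx (x⁻¹ • ω)
      rw [smul_inv_smul] at this
      rw [this, QuotientGroup.mk_inv, inv_mul_cancel_left]
  have hfix : g • ((1 : FreeGroup V) : FreeGroup V ⧸ S) = ((1 : FreeGroup V) : FreeGroup V ⧸ S) :=
    QuotientGroup.eq.2 (by simpa using hgΘ)
  have := hφg ((1 : FreeGroup V) : FreeGroup V ⧸ S)
  rw [hfix] at this
  exact (QuotientGroup.eq_one_iff g).1 (mul_eq_right.1 this.symm)

end Cover

end LOG
namespace LOG

section Reduction

open scoped Classical

variable {V E : Type}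

/-- The node at the `b`-side of `e` is not the label of an edge in `K`. -/
def IsExit (P : LOG V E) (U : Set V) (K : Finset E) (e : E) (b : Bool) : Prop :=
  ∀ e' ∈ K, node U (P.label e') ≠ node U (P.side e b)

/-- The edges in `A` outside `O` have distinct labels relative to `U`, and every nonempty set of
them has an exit; the edges in `O` are supported in `U`. -/
structure IsExtension (P : LOG V E) (U : Set V) (O A : Finset E) : Prop where
  subset : O ⊆ A
  old : ∀ e ∈ O, P.init e ∈ U ∧ P.label e ∈ U ∧ P.term e ∈ U
  inj : ∀ e ∈ A \ O, ∀ e' ∈ A \ O, node U (P.label e) = node U (P.label e') → e = e'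
  exit : ∀ K ⊆ A \ O, K.Nonempty → ∃ e ∈ K, ∃ b, P.IsExit U K e b

variable {P : LOG V E} {U : Set V} {O A : Finset E}

theorem IsExtension.exists_isForestOrientation (h : P.IsExtension U O A)
    (h2 : ∀ K ⊆ A \ O, K.Nonempty → ∃ e ∈ K, ∃ b, P.IsExit U K e b ∧
      ∃ e' ∈ K, ∃ b', P.IsExit U K e' b' ∧ (e', b') ≠ (e, b)) :
    ∃ ε, P.IsForestOrientation U (↑A \ ↑O) ε := by
  let I := {e // e ∈ A \ O}
  have hinj : ∀ e e' : I, node U (P.label e) = node U (P.label e') → e = e' := fun e e' he =>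
    Subtype.ext (h.inj e e.2 e' e'.2 he)
  let hd : I → Bool → Option I := fun e b =>
    if hx : ∃ e' : I, node U (P.label e') = node U (P.side e b) then some hx.choose else none
  have hhd : ∀ e b e', hd e b = some e' ↔ node U (P.label e') = node U (P.side e b) := by
    intro e b e'
    by_cases hx : ∃ e' : I, node U (P.label e') = node U (P.side e b)
    · simp only [hd, dif_pos hx, Option.some.injEq]
      exact ⟨fun he => he ▸ hx.choose_spec, fun he => hinj _ _ (hx.choose_spec.trans he.symm)⟩
    · simp only [hd, dif_neg hx, reduceCtorEq, false_iff]
      exact fun he => hx ⟨e', he⟩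
  obtain ⟨s, hs, hs'⟩ := exists_complementary_branchings hd fun K hK => by
    obtain ⟨e, he, b, hb, e', he', b', hb', hne⟩ := h2 (K.map (Function.Embedding.subtype _))
      (fun e he => by
        obtain ⟨e', -, rfl⟩ := Finset.mem_map.1 he
        exact e'.2) (hK.map)
    obtain ⟨e, heK, rfl⟩ := Finset.mem_map.1 he
    obtain ⟨e', heK', rfl⟩ := Finset.mem_map.1 he'
    have hleave : ∀ e ∈ K, ∀ b, P.IsExit U (K.map (Function.Embedding.subtype _)) (e : E) b →
        (e, b) ∈ arcsLeaving hd Finset.univ K := fun e he b hb => by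
      refine Finset.mem_filter.2 ⟨Finset.mem_univ _, he, fun e' he' hh => ?_⟩
      exact hb e' (Finset.mem_map.2 ⟨e', he', rfl⟩) ((hhd _ _ _).1 hh)
    refine Finset.one_lt_card.2 ⟨_, hleave e' heK' b' hb', _, hleave e heK b hb, fun heq => hne ?_⟩
    rw [Prod.mk.injEq] at heq
    rw [heq.1, heq.2]
  let σ : Option V → Bool := fun k =>
    if hx : ∃ e : I, node U (P.label e) = k then s hx.choose else false
  have hσ : ∀ e : I, σ (node U (P.label e)) = s e := fun e => by
    have hx : ∃ e' : I, node U (P.label e') = node U (P.label e) := ⟨e, rfl⟩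
    simp only [σ, dif_pos hx]
    rw [hinj _ _ hx.choose_spec]
  have hclosed : ∀ s : I → Bool,
      (∀ K : Finset I, K.Nonempty → ∃ e ∈ K, ∀ e' ∈ K, hd e (s e) ≠ some e') →
      ∀ m : E → V, (∀ e : I, m e = P.side e (s e)) → P.NoClosedSet U (↑A \ ↑O) m := by
    intro s hs m hm K hK
    by_contra hne
    obtain ⟨k, hk⟩ := Finset.nonempty_iff_ne_empty.2 hne
    have hlift : ∀ k ∈ K, ∃ e : I, node U (P.label e) = k ∧ node U (m e) ∈ K := fun k hk => by
      obtain ⟨e, he, h⟩ := hK k hk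
      exact ⟨⟨e, Finset.mem_sdiff.2 he⟩, h⟩
    obtain ⟨e, he, hex⟩ := hs (Finset.univ.filter fun e : I => node U (P.label e) ∈ K) (by
      obtain ⟨e, he, -⟩ := hlift k hk
      exact ⟨e, by simpa [he] using hk⟩)
    obtain ⟨e', he', hm'⟩ := hlift _ (Finset.mem_filter.1 he).2
    obtain rfl := hinj _ _ he'
    obtain ⟨e₃, he₃, -⟩ := hlift _ hm'
    refine hex e₃ (by simpa [he₃] using hm') ((hhd _ _ _).2 ?_)
    rw [he₃, hm]
  refine ⟨fun v => σ (node U v), ?_, ?_, ?_, ?_⟩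
  · exact fun e he e' he' => h.inj e (Finset.mem_sdiff.2 he) e' (Finset.mem_sdiff.2 he')
  · intro u hu u' hu'
    rw [node_of_mem hu, node_of_mem hu']
  · exact hclosed (fun e => !s e) hs' _ fun e => by rw [hσ]
  · exact hclosed s hs _ fun e => by rw [hσ]

theorem map_mem_normalClosure {F H : Type} [Group F] [Group H] (φ : F →* H) {R : Set F} {N : Subgroup H}
    [N.Normal] (h : ∀ r ∈ R, φ r ∈ N) {g : F} (hg : g ∈ Subgroup.normalClosure R) : φ g ∈ N := by
  have : Subgroup.normalClosure R ≤ N.comap φ := Subgroup.normalClosure_le_normal h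
  exact this hg

theorem eqOn_closure_of {H : Type} [Group H] {φ ψ : FreeGroup V →* H}
    (h : ∀ u ∈ U, φ (FreeGroup.of u) = ψ (FreeGroup.of u)) {g : FreeGroup V}
    (hg : g ∈ Subgroup.closure (FreeGroup.of '' U)) : φ g = ψ g := by
  refine MonoidHom.eqOn_closure (fun x hx => ?_) hg
  obtain ⟨u, hu, rfl⟩ := hx
  exact h u hu

/-- The LOG obtained by replacing each vertex `v` by `c v`. -/
def relabel (P : LOG V E) (c : V → V) : LOG V E := ⟨c ∘ P.init, c ∘ P.label, c ∘ P.term⟩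

theorem side_relabel (c : V → V) (e : E) (b : Bool) : (P.relabel c).side e b = c (P.side e b) := by
  cases b <;> rfl

theorem map_relator (c : V → V) (e : E) :
    FreeGroup.map c (P.relator e) = (P.relabel c).relator e := by
  simp [relator, relabel]

variable {K : Finset E} {e₀ : E} {b₀ : Bool}

theorem IsExit.side_label_or_eq
    (huniq : ∀ e ∈ K, ∀ b, P.IsExit U K e b → e = e₀ ∧ b = b₀) {e : E} (he : e ∈ K) (b : Bool) :
    (e = e₀ ∧ b = b₀) ∨ ∃ e' ∈ K, node U (P.label e') = node U (P.side e b) := by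
  by_cases hex : P.IsExit U K e b
  · exact Or.inl (huniq e he b hex)
  · right
    simpa [IsExit] using hex

/-- An exit of `K₁ ∪ K` is an exit of `K₁` when the only exit of `K` leads to a label of `K₁`. -/
theorem IsExtension.exists_exit_of_label (h : P.IsExtension U O A) (hK : K ⊆ A \ O)
    (huniq : ∀ e ∈ K, ∀ b, P.IsExit U K e b → e = e₀ ∧ b = b₀) {K₁ : Finset E}
    (hK₁ : K₁ ⊆ A \ O) {e₁ : E} (he₁ : e₁ ∈ K₁)
    (hl : node U (P.label e₁) = node U (P.side e₀ b₀)) :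
    ∃ e ∈ K₁, ∃ b, P.IsExit U (K₁ ∪ K) e b := by
  obtain ⟨e, he, b, hb⟩ := h.exit (K₁ ∪ K) (Finset.union_subset hK₁ hK)
    ⟨e₁, Finset.mem_union_left _ he₁⟩
  rcases Finset.mem_union.1 he with he | he
  · exact ⟨e, he, b, hb⟩
  · obtain ⟨rfl, rfl⟩ := huniq e he b fun e' he' => hb e' (Finset.mem_union_right _ he')
    exact absurd hl (hb e₁ (Finset.mem_union_left _ he₁))

/-- If no label of `K` lies in `U`, then identifying all labels of `K` with the unique exit
vertex of `K` trivializes the relators in `K`. -/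
theorem IsExtension.exists_relabel (h : P.IsExtension U O A) (hK : K ⊆ A \ O)
    (he₀ : e₀ ∈ K) (hexit : P.IsExit U K e₀ b₀)
    (huniq : ∀ e ∈ K, ∀ b, P.IsExit U K e b → e = e₀ ∧ b = b₀)
    (hKU : ∀ e ∈ K, P.label e ∉ U) :
    ∃ c : V → V, (∀ u ∈ U, c u = u) ∧ (∀ e ∈ K, (P.relabel c).relator e = 1) ∧
      (P.relabel c).IsExtension U O (A \ K) := by
  set y := P.side e₀ b₀ with hy
  set c : V → V := fun v => if ∃ e ∈ K, P.label e = v then y else v with hc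
  have hcid : ∀ v, (∀ e ∈ K, P.label e ≠ v) → c v = v := fun v hv => if_neg (by push Not; exact hv)
  have hcl : ∀ e ∈ K, c (P.label e) = y := fun e he => if_pos ⟨e, he, rfl⟩
  have hcy : c y = y := hcid y fun e he hey => hexit e he (by rw [hey])
  have hcU : ∀ u ∈ U, c u = u := fun u hu => hcid u fun e he heu => hKU e he (heu ▸ hu)
  have hside : ∀ e ∈ K, ∀ b, c (P.side e b) = y := by
    intro e he b
    rcases IsExit.side_label_or_eq huniq he b with ⟨rfl, rfl⟩ | ⟨e', he', h'⟩
    · exact hcy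
    · rw [node_of_notMem (hKU e' he')] at h'
      rw [(node_eq_some.1 h'.symm).2]
      exact hcl e' he'
  have hclabel : ∀ e ∈ A \ O, e ∉ K → c (P.label e) = P.label e := fun e he heK =>
    hcid _ fun e' he' h' => heK (h.inj e' (hK he') e he (by rw [h']) ▸ he')
  have hsdiff : ∀ e ∈ (A \ K) \ O, e ∈ A \ O ∧ e ∉ K := fun e he => by
    simp only [Finset.mem_sdiff] at he ⊢
    tauto
  refine ⟨c, hcU, fun e he => ?_, ⟨fun e he => ?_, fun e he => ?_, ?_, ?_⟩⟩
  · have h1 : c (P.init e) = y := hside e he true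
    have h2 : c (P.term e) = y := hside e he false
    simp [relator, relabel, h1, h2, hcl e he]
  · exact Finset.mem_sdiff.2 ⟨h.subset he, fun heK => (Finset.mem_sdiff.1 (hK heK)).2 he⟩
  · obtain ⟨h1, h2, h3⟩ := h.old e he
    simp only [relabel, Function.comp, hcU _ h1, hcU _ h2, hcU _ h3]
    exact ⟨h1, h2, h3⟩
  · intro e he e' he' hee
    obtain ⟨he, heK⟩ := hsdiff e he
    obtain ⟨he', heK'⟩ := hsdiff e' he'
    simp only [relabel, Function.comp, hclabel e he heK, hclabel e' he' heK'] at hee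
    exact h.inj e he e' he' hee
  · intro K₁ hK₁ hne
    have hK₁A : K₁ ⊆ A \ O := fun e he => (hsdiff e (hK₁ he)).1
    have hcK₁ : ∀ e ∈ K₁, (P.relabel c).label e = P.label e := fun e he =>
      hclabel e (hK₁A he) (hsdiff e (hK₁ he)).2
    by_cases hy₁ : ∃ e₁ ∈ K₁, node U (P.label e₁) = node U y
    · obtain ⟨e₁, he₁, hl⟩ := hy₁
      obtain ⟨e, he, b, hb⟩ := h.exists_exit_of_label hK huniq hK₁A he₁ hl
      refine ⟨e, he, b, fun e' he' => ?_⟩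
      rw [hcK₁ e' he', side_relabel, hcid _ fun e'' he'' h'' =>
        hb e'' (Finset.mem_union_right _ he'') (by rw [h''])]
      exact hb e' (Finset.mem_union_left _ he')
    · push Not at hy₁
      obtain ⟨e, he, b, hb⟩ := h.exit K₁ hK₁A hne
      refine ⟨e, he, b, fun e' he' => ?_⟩
      rw [hcK₁ e' he', side_relabel]
      by_cases hlab : ∃ e'' ∈ K, P.label e'' = P.side e b
      · rw [show c (P.side e b) = y from if_pos hlab]
        exact hy₁ e' he'
      · push Not at hlab
        rw [hcid _ hlab]
        exact hb e' he'

/-- If some label of `K` lies in `U`, then adding `K` to the old edges gives an extension. -/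
theorem IsExtension.enlarge (h : P.IsExtension U O A) (hK : K ⊆ A \ O)
    (huniq : ∀ e ∈ K, ∀ b, P.IsExit U K e b → e = e₀ ∧ b = b₀)
    {e₁ : E} (he₁ : e₁ ∈ K) (hl₁ : P.label e₁ ∈ U) :
    P.IsExtension (insert (P.side e₀ b₀) (U ∪ P.label '' K)) (O ∪ K) A := by
  set y := P.side e₀ b₀ with hy
  set U' : Set V := insert y (U ∪ P.label '' K) with hU'
  have hUU' : U ⊆ U' := fun u hu => Or.inr (Or.inl hu)
  have hlU' : ∀ e ∈ K, P.label e ∈ U' := fun e he => Or.inr (Or.inr ⟨e, he, rfl⟩)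
  have hyU' : y ∈ U' := Or.inl rfl
  have hside : ∀ e ∈ K, ∀ b, P.side e b ∈ U' := by
    intro e he b
    rcases IsExit.side_label_or_eq huniq he b with ⟨rfl, rfl⟩ | ⟨e', he', h'⟩
    · exact hyU'
    · by_cases hs : P.side e b ∈ U
      · exact hUU' hs
      · rw [node_of_notMem hs] at h'
        rw [← (node_eq_some.1 h').2]
        exact hlU' e' he'
  have hsdiff : ∀ e ∈ A \ (O ∪ K), e ∈ A \ O ∧ e ∉ K := fun e he => by
    simp only [Finset.mem_sdiff, Finset.mem_union] at he ⊢
    tauto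
  have hlabel : ∀ e ∈ A \ (O ∪ K), P.label e ∈ U' → P.label e = y := by
    intro e he hl
    obtain ⟨he, heK⟩ := hsdiff e he
    rcases hl with hl | hl | ⟨e', he', hl⟩
    · exact hl
    · exact absurd (h.inj e he e₁ (hK he₁) (by rw [node_of_mem hl, node_of_mem hl₁]))
        fun h' => heK (h' ▸ he₁)
    · exact absurd (h.inj e' (hK he') e he (by rw [hl])) fun h' => heK (h' ▸ he')
  refine ⟨Finset.union_subset h.subset (hK.trans Finset.sdiff_subset), fun e he => ?_, ?_, ?_⟩
  · rcases Finset.mem_union.1 he with he | he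
    · obtain ⟨h1, h2, h3⟩ := h.old e he
      exact ⟨hUU' h1, hUU' h2, hUU' h3⟩
    · exact ⟨hside e he true, hlU' e he, hside e he false⟩
  · intro e he e' he' hee
    refine h.inj e (hsdiff e he).1 e' (hsdiff e' he').1 (congrArg (node U) ?_)
    by_cases hl : P.label e ∈ U'
    · rw [node_of_mem hl] at hee
      rw [hlabel e he hl, hlabel e' he' (node_eq_none.1 hee.symm)]
    · rw [node_of_notMem hl] at hee
      exact (node_eq_some.1 hee.symm).2.symm
  · intro K₁ hK₁ hne
    have hK₁A : K₁ ⊆ A \ O := fun e he => (hsdiff e (hK₁ he)).1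
    by_cases hex : ∃ e ∈ K₁, P.label e ∈ U'
    · obtain ⟨e₂, he₂, hl₂⟩ := hex
      have hl₂y := hlabel e₂ (hK₁ he₂) hl₂
      obtain ⟨e, he, b, hb⟩ := h.exists_exit_of_label hK huniq hK₁A he₂ (by rw [hl₂y])
      have hs : P.side e b ∉ U' := by
        rintro (hs | hs | ⟨e', he', hs⟩)
        · exact hb e₂ (Finset.mem_union_left _ he₂) (by rw [hl₂y, hs])
        · exact hb e₁ (Finset.mem_union_right _ he₁) (by rw [node_of_mem hl₁, node_of_mem hs])
        · exact hb e' (Finset.mem_union_right _ he') (by rw [hs])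
      refine ⟨e, he, b, fun e' he' hn => hb e' (Finset.mem_union_left _ he') ?_⟩
      rw [node_of_notMem hs] at hn
      rw [(node_eq_some.1 hn).2]
    · push Not at hex
      obtain ⟨e, he, b, hb⟩ := h.exit K₁ hK₁A hne
      refine ⟨e, he, b, fun e' he' hn => hb e' he' ?_⟩
      rw [node_of_notMem (hex e' he')] at hn
      rw [(node_eq_some.1 hn.symm).2]

/-- A relator with a free vertex `y` has no consequences over generators other than `y`. -/
theorem mem_normalClosure_of_free_vertex {R : Set E} {y : V} (he₀ : P.side e₀ b₀ = y)
    (hlab : P.label e₀ ≠ y) (hside : P.side e₀ (!b₀) ≠ y)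
    (hR : ∀ e ∈ R, P.init e ≠ y ∧ P.label e ≠ y ∧ P.term e ≠ y) (hyU : y ∉ U)
    {g : FreeGroup V} (hgU : g ∈ Subgroup.closure (FreeGroup.of '' U))
    (hg : g ∈ Subgroup.normalClosure (P.relator '' insert e₀ R)) :
    g ∈ Subgroup.normalClosure (P.relator '' R) := by
  set N := Subgroup.normalClosure (P.relator '' R) with hN
  let q : FreeGroup V →* FreeGroup V ⧸ N := QuotientGroup.mk' N
  let z := q (FreeGroup.of (P.label e₀))
  let w := q (FreeGroup.of (P.side e₀ (!b₀)))
  let x : FreeGroup V ⧸ N := if b₀ then z * w * z⁻¹ else z⁻¹ * w * z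
  let ψ : FreeGroup V →* FreeGroup V ⧸ N :=
    FreeGroup.lift fun v => if v = y then x else q (FreeGroup.of v)
  have hψy : ψ (FreeGroup.of y) = x := by simp [ψ]
  have hψ : ∀ v, v ≠ y → ψ (FreeGroup.of v) = q (FreeGroup.of v) := fun v hv => by simp [ψ, hv]
  have hker : ∀ r ∈ P.relator '' insert e₀ R, ψ r ∈ (⊥ : Subgroup (FreeGroup V ⧸ N)) := by
    rintro _ ⟨e, rfl | he, rfl⟩
    · rw [Subgroup.mem_bot, relator, map_mul, map_inv, map_mul, map_mul, hψ _ hlab, mul_inv_eq_one]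
      cases b₀
      · have h1 : P.term e = y := he₀
        rw [h1, hψy, hψ (P.init e) hside]
        show w * z = z * (z⁻¹ * w * z)
        group
      · have h1 : P.init e = y := he₀
        rw [h1, hψy, hψ (P.term e) hside]
        show z * w * z⁻¹ * z = z * w
        group
    · obtain ⟨h1, h2, h3⟩ := hR e he
      have : q (P.relator e) = 1 :=
        (QuotientGroup.eq_one_iff _).2 (Subgroup.subset_normalClosure ⟨e, he, rfl⟩)
      rw [Subgroup.mem_bot, ← this]
      simp only [relator, map_mul, map_inv, hψ _ h1, hψ _ h2, hψ _ h3]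
  have h1 : ψ g = 1 := Subgroup.mem_bot.1 (map_mem_normalClosure ψ hker hg)
  have h2 : ψ g = q g := eqOn_closure_of (fun u hu => hψ u fun h => hyU (h ▸ hu)) hgU
  exact (QuotientGroup.eq_one_iff g).1 (h2.symm.trans h1)

/-- In an extension, the new relators have no consequences over the generators in `U` beyond
those of the old relators. -/
theorem IsExtension.mem_normalClosure (h : P.IsExtension U O A) {g : FreeGroup V}
    (hgU : g ∈ Subgroup.closure (FreeGroup.of '' U))
    (hg : g ∈ Subgroup.normalClosure (P.relator '' A)) :
    g ∈ Subgroup.normalClosure (P.relator '' O) := by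
  induction hn : (A \ O).card using Nat.strong_induction_on generalizing P U O A with
  | _ n ih =>
    by_cases h2 : ∀ K ⊆ A \ O, K.Nonempty → ∃ e ∈ K, ∃ b, P.IsExit U K e b ∧
      ∃ e' ∈ K, ∃ b', P.IsExit U K e' b' ∧ (e', b') ≠ (e, b)
    · obtain ⟨ε, hε⟩ := h.exists_isForestOrientation h2
      exact P.mem_normalClosure_of_isForestOrientation h.old hε hgU hg
    push Not at h2
    obtain ⟨K, hK, hKne, hone⟩ := h2
    obtain ⟨e₀, he₀, b₀, hexit⟩ := h.exit K hK hKne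
    have huniq : ∀ e ∈ K, ∀ b, P.IsExit U K e b → e = e₀ ∧ b = b₀ := fun e he b hb =>
      Prod.mk.injEq .. ▸ hone e₀ he₀ b₀ hexit e he b hb
    have hKO : ∀ e ∈ K, e ∉ O := fun e he => (Finset.mem_sdiff.1 (hK he)).2
    by_cases hKU : ∀ e ∈ K, P.label e ∉ U
    · obtain ⟨c, hcU, hcK, hext⟩ := h.exists_relabel hK he₀ hexit huniq hKU
      have hcg : FreeGroup.map c g = g :=
        eqOn_closure_of (ψ := MonoidHom.id _) (fun u hu => by simp [hcU u hu]) hgU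
      have hmap : FreeGroup.map c g ∈
          Subgroup.normalClosure ((P.relabel c).relator '' ((A \ K : Finset E) : Set E)) := by
        refine map_mem_normalClosure _ ?_ hg
        rintro _ ⟨e, he, rfl⟩
        rw [map_relator]
        by_cases heK : e ∈ K
        · rw [hcK e heK]
          exact one_mem _
        · exact Subgroup.subset_normalClosure ⟨e, by simp_all, rfl⟩
      rw [hcg] at hmap
      have hlt : ((A \ K) \ O).card < n := by
        rw [← hn]
        refine Finset.card_lt_card ⟨?_, fun hs => ?_⟩
        · exact Finset.sdiff_subset_sdiff Finset.sdiff_subset le_rfl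
        · have := hs (hK he₀)
          simp [he₀] at this
      have := ih _ hlt hext hgU hmap rfl
      convert this using 2
      refine Set.image_congr fun e he => ?_
      obtain ⟨h1, h2, h3⟩ := h.old e he
      simp [relator, relabel, hcU _ h1, hcU _ h2, hcU _ h3]
    · push Not at hKU
      obtain ⟨e₁, he₁, hl₁⟩ := hKU
      have hyU : P.side e₀ b₀ ∉ U := fun hy =>
        hexit e₁ he₁ (by rw [node_of_mem hl₁, node_of_mem hy])
      have hg1 := ih _ (by
        rw [← hn]
        refine Finset.card_lt_card ⟨?_, fun hs => ?_⟩
        · exact Finset.sdiff_subset_sdiff le_rfl Finset.subset_union_left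
        · have := hs (hK he₀)
          simp [he₀] at this) (h.enlarge hK huniq he₁ hl₁)
        (Subgroup.closure_mono (Set.image_mono fun u hu => Or.inr (Or.inl hu)) hgU) hg rfl
      have hsideK : ∀ e ∈ K, ∀ b, P.side e b = P.side e₀ b₀ → e = e₀ ∧ b = b₀ :=
        fun e he b hb => huniq e he b fun e' he' => by rw [hb]; exact hexit e' he'
      have hlabK : ∀ e ∈ K, P.label e ≠ P.side e₀ b₀ := fun e he hl => hexit e he (by rw [hl])
      have hg2 : g ∈ Subgroup.normalClosure (P.relator '' ((O ∪ K.erase e₀ : Finset E) : Set E)) := by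
        refine mem_normalClosure_of_free_vertex (e₀ := e₀) (b₀ := b₀) rfl (hlabK e₀ he₀)
          (fun hs => ?_) (fun e he => ?_) hyU hgU ?_
        · have := (hsideK e₀ he₀ _ hs).2
          cases b₀ <;> simp at this
        · rcases Finset.mem_union.1 he with he | he
          · obtain ⟨h1, h2, h3⟩ := h.old e he
            exact ⟨fun h' => hyU (h' ▸ h1), fun h' => hyU (h' ▸ h2), fun h' => hyU (h' ▸ h3)⟩
          · obtain ⟨hne, he⟩ := Finset.mem_erase.1 he
            exact ⟨fun h' => hne (hsideK e he true h').1, hlabK e he,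
              fun h' => hne (hsideK e he false h').1⟩
        · convert hg1 using 3
          rw [← Finset.coe_insert]
          congr 1
          ext e
          by_cases hee : e = e₀ <;> simp [hee, he₀]
      have hsub : (O ∪ K.erase e₀) \ O ⊆ K.erase e₀ := fun e he => by
        simp only [Finset.mem_sdiff, Finset.mem_union] at he
        tauto
      have hsub' : (O ∪ K.erase e₀) \ O ⊆ A \ O :=
        hsub.trans ((Finset.erase_subset _ _).trans hK)
      refine ih _ ?_ (A := O ∪ K.erase e₀)
        ⟨Finset.subset_union_left, h.old, fun e he e' he' => h.inj e (hsub' he) e' (hsub' he'),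
          fun K₁ hK₁ => h.exit K₁ (hK₁.trans hsub')⟩ hgU hg2 rfl
      rw [← hn]
      exact Finset.card_lt_card ⟨hsub', fun hs => Finset.notMem_erase e₀ K (hsub (hs (hK he₀)))⟩

end Reduction

end LOG
namespace LOG

section Trees

variable {V E : Type} {P : LOG V E}

theorem IsTreeGraph.ncard_add_one_le [Finite V] [Finite E] (h : P.IsTreeGraph) {W : Set V}
    {B : Set E} (hW : W.Nonempty) (hB : ∀ e ∈ B, P.init e ∈ W ∧ P.term e ∈ W) :
    B.ncard + 1 ≤ W.ncard := by
  classical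
  have := Fintype.ofFinite V
  obtain ⟨hloop, hends, htree⟩ := h
  have : Nonempty W := hW.to_subtype
  obtain ⟨T, hT, -, hTtree⟩ := SimpleGraph.connected_top.exists_isTree_le_of_le_of_isAcyclic
    (le_top : P.graph.induce W ≤ ⊤) (htree.isAcyclic.induce W)
  have hcard := hTtree.card_edgeFinset
  rw [← Nat.card_coe_set_eq W, Nat.card_eq_fintype_card, ← hcard, add_le_add_iff_right,
    ← Nat.card_coe_set_eq B, SimpleGraph.edgeFinset_card, ← Nat.card_eq_fintype_card]
  refine Nat.card_le_card_of_injective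
    (fun e : B => (⟨s(⟨P.init e, (hB e e.2).1⟩, ⟨P.term e, (hB e e.2).2⟩), hT ?_⟩ : T.edgeSet))
    fun e e' he => ?_
  · simp only [SimpleGraph.comap_adj, graph, SimpleGraph.fromRel_adj]
    exact ⟨hloop e, Or.inl ⟨e, rfl, rfl⟩⟩
  · have := congrArg (Sym2.map Subtype.val) (Subtype.ext_iff.1 he)
    exact Subtype.ext (hends this)

theorem ncard_le_of_connected [Finite V] [Finite E] {VS : Set V} {ES : Set E}
    (h : (P.subgraph VS ES).Connected) : VS.ncard ≤ ES.ncard + 1 := by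
  refine (Nat.card_coe_set_eq VS).symm.le.trans
    (h.card_vert_le_card_edgeSet_add_one.trans (Nat.add_le_add_right ?_ 1))
  have hex : ∀ d : (P.subgraph VS ES).edgeSet, ∃ e : ES,
      s(P.init e, P.term e) = Sym2.map Subtype.val (d : Sym2 VS) := by
    rintro ⟨d, hd⟩
    induction d using Sym2.ind with
    | _ x y =>
      rw [SimpleGraph.mem_edgeSet, subgraph, SimpleGraph.fromRel_adj] at hd
      obtain ⟨-, ⟨e, he, hx, hy⟩ | ⟨e, he, hx, hy⟩⟩ := hd
      · exact ⟨⟨e, he⟩, by simp [hx, hy]⟩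
      · exact ⟨⟨e, he⟩, by simp [hx, hy, Sym2.eq_swap]⟩
  choose f hf using hex
  rw [← Nat.card_coe_set_eq ES]
  refine Nat.card_le_card_of_injective f fun d d' hdd => ?_
  have := (hf d).symm.trans (hdd ▸ hf d')
  exact Subtype.ext (Sym2.map.injective Subtype.val_injective this)

theorem IsTreeGraph.ncard_inter_le [Finite V] [Finite E] (h : P.IsTreeGraph)
    {VS₁ VS₂ : Set V} {ES₁ ES₂ : Set E} (h₁ : P.IsSubLOT VS₁ ES₁) (h₂ : P.IsSubLOT VS₂ ES₂)
    (hne : (VS₁ ∩ VS₂).Nonempty) : (VS₁ ∩ VS₂).ncard ≤ (ES₁ ∩ ES₂).ncard + 1 := by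
  have hV := Set.ncard_union_add_ncard_inter VS₁ VS₂
  have hE := Set.ncard_union_add_ncard_inter ES₁ ES₂
  have h1 := ncard_le_of_connected h₁.connected
  have h2 := ncard_le_of_connected h₂.connected
  have h3 := h.ncard_add_one_le (W := VS₁ ∪ VS₂) (B := ES₁ ∪ ES₂) (hne.mono fun v hv => Or.inl hv.1)
    fun e he => he.elim (fun he => ⟨Or.inl (h₁.init_mem e he), Or.inl (h₁.term_mem e he)⟩)
      fun he => ⟨Or.inr (h₂.init_mem e he), Or.inr (h₂.term_mem e he)⟩
  omega

open scoped Classical in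
theorem IsTreeGraph.isExtension [Finite V] [Finite E] (h : P.IsTreeGraph)
    (hinj : P.InjectiveLabels) {U : Set V} {O A : Finset E} (hU : U.Nonempty) (hOA : O ⊆ A)
    (hO : ∀ e ∈ O, P.init e ∈ U ∧ P.label e ∈ U ∧ P.term e ∈ U) (hcard : U.ncard ≤ O.card + 1) :
    P.IsExtension U O A where
  subset := hOA
  old := hO
  inj e he e' he' hee := by
    by_contra hne
    by_cases hl : P.label e ∈ U
    · have hl' : P.label e' ∈ U := by rwa [← node_eq_none, ← hee, node_eq_none]
      have := Set.ncard_le_ncard (s := P.label '' (insert e (insert e' O) : Finset E)) (t := U)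
        (by
          rintro _ ⟨x, hx, rfl⟩
          simp only [Finset.coe_insert, Set.mem_insert_iff, Finset.mem_coe] at hx
          obtain rfl | rfl | hx := hx
          · exact hl
          · exact hl'
          · exact (hO x hx).2.1)
      rw [Set.ncard_image_of_injective _ hinj, Set.ncard_coe_finset, Finset.card_insert_of_notMem,
        Finset.card_insert_of_notMem] at this
      · omega
      · exact (Finset.mem_sdiff.1 he').2
      · simp [hne, (Finset.mem_sdiff.1 he).2]
    · rw [node_of_notMem hl, eq_comm, node_eq_some] at hee
      exact hne (hinj hee.2.symm)
  exit K hK hKne := by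
    by_contra hcon
    have hside : ∀ e ∈ K, ∀ b, ∃ e' ∈ K, node U (P.label e') = node U (P.side e b) := by
      simpa only [IsExit, not_exists, not_and, not_forall, not_not, exists_prop] using hcon
    have hlab : ∀ e ∈ K, ∀ b, P.side e b ∉ U →
        ∃ e' ∈ K, P.label e' = P.side e b := fun e he b hb => by
      obtain ⟨e', he', h'⟩ := hside e he b
      rw [node_of_notMem hb, node_eq_some] at h'
      exact ⟨e', he', h'.2⟩
    by_cases hx : ∃ e ∈ K, P.label e ∈ U
    · obtain ⟨e₁, he₁, hl₁⟩ := hx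
      have hmem : ∀ e ∈ K, ∀ b, P.side e b ∈ U ∪ P.label '' (K.erase e₁ : Finset E) :=
        fun e he b => by
          by_cases hb : P.side e b ∈ U
          · exact Or.inl hb
          · obtain ⟨e', he', h'⟩ := hlab e he b hb
            exact Or.inr ⟨e', Finset.mem_coe.2 (Finset.mem_erase.2
              ⟨fun hee => hb (h' ▸ hee ▸ hl₁), he'⟩), h'⟩
      have h1 := h.ncard_add_one_le (W := U ∪ P.label '' (K.erase e₁ : Finset E))
        (B := (O ∪ K : Finset E)) (hU.mono Set.subset_union_left) fun e he => by
          rcases Finset.mem_union.1 (Finset.mem_coe.1 he) with he | he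
          · exact ⟨Or.inl (hO e he).1, Or.inl (hO e he).2.2⟩
          · exact ⟨hmem e he true, hmem e he false⟩
      have h2 := Set.ncard_union_le U (P.label '' (K.erase e₁ : Finset E))
      have hdisj : Disjoint O K :=
        Finset.disjoint_left.2 fun e heO heK => (Finset.mem_sdiff.1 (hK heK)).2 heO
      have h3 := Finset.card_erase_add_one he₁
      rw [Set.ncard_image_of_injective _ hinj, Set.ncard_coe_finset] at h2
      rw [Set.ncard_coe_finset, Finset.card_union_of_disjoint hdisj] at h1
      omega
    · push Not at hx
      have hmem : ∀ e ∈ K, ∀ b, P.side e b ∈ P.label '' K := fun e he b => by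
        obtain ⟨e', he', h'⟩ := hside e he b
        rw [node_of_notMem (hx e' he'), eq_comm, node_eq_some] at h'
        exact ⟨e', he', h'.2.symm⟩
      have h1 := h.ncard_add_one_le (W := P.label '' K) (B := K)
        ((Finset.coe_nonempty.2 hKne).image _) fun e he => ⟨hmem e he true, hmem e he false⟩
      rw [Set.ncard_image_of_injective _ hinj] at h1
      omega

theorem IsTreeGraph.mem_normalClosure [Finite V] [Finite E] (h : P.IsTreeGraph)
    (hinj : P.InjectiveLabels) {U : Set V} {O A : Set E} (hU : U.Nonempty) (hOA : O ⊆ A)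
    (hO : ∀ e ∈ O, P.init e ∈ U ∧ P.label e ∈ U ∧ P.term e ∈ U) (hcard : U.ncard ≤ O.ncard + 1)
    {g : FreeGroup V} (hgU : g ∈ Subgroup.closure (FreeGroup.of '' U))
    (hg : g ∈ Subgroup.normalClosure (P.relator '' A)) :
    g ∈ Subgroup.normalClosure (P.relator '' O) := by
  lift O to Finset E using O.toFinite
  lift A to Finset E using A.toFinite
  rw [Set.ncard_coe_finset] at hcard
  exact (h.isExtension hinj hU (Finset.coe_subset.1 hOA) hO hcard).mem_normalClosure hgU hg

theorem IsMaxProperSubLOT.union_eq_univ {VS₁ VS₂ : Set V} {ES₁ ES₂ : Set E}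
    (h₁ : P.IsMaxProperSubLOT VS₁ ES₁) (h₂ : P.IsMaxProperSubLOT VS₂ ES₂)
    (hdist : ¬(VS₁ = VS₂ ∧ ES₁ = ES₂)) (hne : (VS₁ ∩ VS₂).Nonempty) :
    VS₁ ∪ VS₂ = Set.univ ∧ ES₁ ∪ ES₂ = Set.univ := by
  by_contra hcon
  have hsub : ∀ {VS : Set V} {ES : Set E} (hV : VS ⊆ VS₁ ∪ VS₂), ES ⊆ ES₁ ∪ ES₂ →
      ∀ {x y : VS}, (P.subgraph VS ES).Reachable x y →
        (P.subgraph (VS₁ ∪ VS₂) (ES₁ ∪ ES₂)).Reachable ⟨x, hV x.2⟩ ⟨y, hV y.2⟩ := by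
    intro VS ES hV hE x y hxy
    refine hxy.map (⟨fun v => ⟨v, hV v.2⟩, fun {a b} hab => ?_⟩ :
      P.subgraph VS ES →g P.subgraph (VS₁ ∪ VS₂) (ES₁ ∪ ES₂))
    rw [subgraph, SimpleGraph.fromRel_adj] at hab ⊢
    refine ⟨fun hh => hab.1 (Subtype.ext (by simpa using hh)), ?_⟩
    exact hab.2.imp (fun ⟨e, he, h⟩ => ⟨e, hE he, h⟩) fun ⟨e, he, h⟩ => ⟨e, hE he, h⟩
  have hunion : P.IsProperSubLOT (VS₁ ∪ VS₂) (ES₁ ∪ ES₂) := by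
    refine ⟨⟨h₁.1.1.edge_nonempty.mono Set.subset_union_left, fun e he => ?_, fun e he => ?_,
      fun e he => ?_, ?_⟩, hcon⟩
    · exact he.imp (h₁.1.1.init_mem e) (h₂.1.1.init_mem e)
    · exact he.imp (h₁.1.1.term_mem e) (h₂.1.1.term_mem e)
    · exact he.imp (h₁.1.1.label_mem e) (h₂.1.1.label_mem e)
    · obtain ⟨v, hv₁, hv₂⟩ := hne
      rw [SimpleGraph.connected_iff_exists_forall_reachable]
      refine ⟨⟨v, Or.inl hv₁⟩, ?_⟩
      rintro ⟨w, hw | hw⟩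
      · exact hsub Set.subset_union_left Set.subset_union_left
          (h₁.1.1.connected.preconnected ⟨v, hv₁⟩ ⟨w, hw⟩)
      · exact hsub Set.subset_union_right Set.subset_union_right
          (h₂.1.1.connected.preconnected ⟨v, hv₂⟩ ⟨w, hw⟩)
  have e₁ := h₁.2 _ _ hunion Set.subset_union_left Set.subset_union_left
  have e₂ := h₂.2 _ _ hunion Set.subset_union_right Set.subset_union_right
  exact hdist ⟨e₁.1.trans e₂.1.symm, e₁.2.trans e₂.2.symm⟩

end Trees

section Presentations

variable {V E : Type} {P : LOG V E}

theorem map_val_mem_closure {U : Set V} (w : FreeGroup U) :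
    FreeGroup.map Subtype.val w ∈ Subgroup.closure (FreeGroup.of '' U : Set (FreeGroup V)) := by
  induction w using FreeGroup.induction_on with
  | C1 => simp
  | of u => exact Subgroup.subset_closure ⟨u, u.2, by simp⟩
  | inv_of u hu => simpa using hu
  | mul x y hx hy => simpa using mul_mem hx hy

theorem map_val_mem_normalClosure {VS : Set V} {ES : Set E} {w : FreeGroup VS}
    (hw : w ∈ Subgroup.normalClosure (P.subRels VS ES)) :
    FreeGroup.map Subtype.val w ∈ Subgroup.normalClosure (P.relator '' ES) := by
  refine map_mem_normalClosure _ ?_ hw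
  rintro _ ⟨e, he, hi, hl, ht, rfl⟩
  exact Subgroup.subset_normalClosure ⟨e, he, by simp [relator]⟩

theorem mem_normalClosure_subRels {VS : Set V} {ES : Set E}
    (hES : ∀ e ∈ ES, P.init e ∈ VS ∧ P.label e ∈ VS ∧ P.term e ∈ VS) {w : FreeGroup VS}
    (hw : FreeGroup.map Subtype.val w ∈ Subgroup.normalClosure (P.relator '' ES)) :
    w ∈ Subgroup.normalClosure (P.subRels VS ES) := by
  classical
  let φ : FreeGroup V →* FreeGroup VS :=
    FreeGroup.lift fun v => if hv : v ∈ VS then FreeGroup.of ⟨v, hv⟩ else 1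
  have hφ : φ.comp (FreeGroup.map Subtype.val) = MonoidHom.id _ := by
    ext v
    simp [φ]
  have := map_mem_normalClosure φ (N := Subgroup.normalClosure (P.subRels VS ES)) ?_ hw
  · rwa [← MonoidHom.comp_apply, hφ] at this
  · rintro _ ⟨e, he, rfl⟩
    obtain ⟨hi, hl, ht⟩ := hES e he
    exact Subgroup.subset_normalClosure ⟨e, he, hi, hl, ht, by simp [relator, φ, hi, hl, ht]⟩

theorem mk_eq_one_iff {X : Type} {R : Set (FreeGroup X)} {w : FreeGroup X} :
    PresentedGroup.mk R w = 1 ↔ w ∈ Subgroup.normalClosure R :=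
  QuotientGroup.eq_one_iff w

/-- A homomorphism out of the group of `(U, O)` that becomes the inclusion after lifting to free
groups is injective, if `O` is large enough. -/
theorem IsTreeGraph.injective_of_comp_mk [Finite V] [Finite E] (h : P.IsTreeGraph)
    (hinj : P.InjectiveLabels) {U : Set V} {O A : Set E} (hU : U.Nonempty) (hOA : O ⊆ A)
    (hO : ∀ e ∈ O, P.init e ∈ U ∧ P.label e ∈ U ∧ P.term e ∈ U) (hcard : U.ncard ≤ O.ncard + 1)
    {H : Type} [Group H] (ι : PresentedGroup (P.subRels U O) →* H)
    (hι : ∀ w : FreeGroup U, ι (PresentedGroup.mk _ w) = 1 →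
      FreeGroup.map Subtype.val w ∈ Subgroup.normalClosure (P.relator '' A)) :
    Function.Injective ι := by
  refine (injective_iff_map_eq_one ι).2 fun x hx => ?_
  obtain ⟨w, rfl⟩ := PresentedGroup.mk_surjective _ x
  exact mk_eq_one_iff.2 (mem_normalClosure_subRels hO
    (h.mem_normalClosure hinj hU hOA hO hcard (map_val_mem_closure w) (hι w hx)))

theorem mem_normalClosure_of_map_subRels {U VS : Set V} {O ES : Set E} (hUV : U ⊆ VS)
    (ι : PresentedGroup (P.subRels U O) →* PresentedGroup (P.subRels VS ES))
    (hι : ∀ v : U, ι (PresentedGroup.of v) = PresentedGroup.of ⟨v, hUV v.2⟩) (w : FreeGroup U)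
    (hw : ι (PresentedGroup.mk _ w) = 1) :
    FreeGroup.map Subtype.val w ∈ Subgroup.normalClosure (P.relator '' ES) := by
  have hcomp : ι.comp (PresentedGroup.mk _) =
      (PresentedGroup.mk _).comp (FreeGroup.map fun v : U => (⟨v, hUV v.2⟩ : VS)) := by
    ext v
    exact hι v
  have := DFunLike.congr_fun hcomp w
  rw [MonoidHom.comp_apply, hw, eq_comm, MonoidHom.comp_apply, mk_eq_one_iff] at this
  have := map_val_mem_normalClosure this
  rwa [FreeGroup.map.comp] at this

theorem mem_normalClosure_of_map_rels {U : Set V} {O : Set E}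
    (κ : PresentedGroup (P.subRels U O) →* PresentedGroup P.rels)
    (hκ : ∀ v : U, κ (PresentedGroup.of v) = PresentedGroup.of (v : V)) (w : FreeGroup U)
    (hw : κ (PresentedGroup.mk _ w) = 1) :
    FreeGroup.map Subtype.val w ∈ Subgroup.normalClosure (P.relator '' Set.univ) := by
  have hcomp : κ.comp (PresentedGroup.mk _) =
      (PresentedGroup.mk _).comp (FreeGroup.map Subtype.val) := by
    ext v
    exact hκ v
  have := DFunLike.congr_fun hcomp w
  rw [MonoidHom.comp_apply, hw, eq_comm, MonoidHom.comp_apply, mk_eq_one_iff] at this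
  rwa [Set.image_univ]

/-- A homomorphism from the group of a sub-LOT kills the relators of its edges. -/
theorem map_relator_eq {VS : Set V} {ES : Set E} {K : Type} [Group K]
    (f : PresentedGroup (P.subRels VS ES) →* K) (F : V → K)
    (hF : ∀ v : VS, F v = f (PresentedGroup.of v)) (hES : P.IsSubLOT VS ES) {e : E} (he : e ∈ ES) :
    F (P.init e) * F (P.label e) * (F (P.label e) * F (P.term e))⁻¹ = 1 := by
  rw [hF ⟨_, hES.init_mem e he⟩, hF ⟨_, hES.label_mem e he⟩, hF ⟨_, hES.term_mem e he⟩,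
    ← map_mul, ← map_mul, ← map_inv, ← map_mul]
  convert map_one f
  exact mk_eq_one_iff.2 (Subgroup.subset_normalClosure
    ⟨e, he, hES.init_mem e he, hES.label_mem e he, hES.term_mem e he, rfl⟩)

end Presentations

end LOG

/-- **Amalgamated product decomposition.**
Let `P` be an injective labeled oriented tree, and let `T₁ = (VS₁, ES₁) ≠ T₂ = (VS₂, ES₂)`
be maximal proper sub-LOTs of `P` with nonempty intersection `T₁₂` (so that `P = T₁ ∪ T₂`).
Then the inclusion-induced homomorphisms `G(T₁₂) → G(Tᵢ)` and `G(Tᵢ) → G(P)` are all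
injective, the square commutes, and `G(P)` is the pushout (amalgamated free product)
`G(T₁) *_{G(T₁₂)} G(T₂)`. -/
theorem amalgamated_product_of_maximal_sublots {V E : Type} [Fintype V] [Fintype E]
    (P : LOG V E) (htree : P.IsTreeGraph) (hinj : P.InjectiveLabels)
    (VS₁ VS₂ : Set V) (ES₁ ES₂ : Set E)
    (h₁ : P.IsMaxProperSubLOT VS₁ ES₁) (h₂ : P.IsMaxProperSubLOT VS₂ ES₂)
    (hdist : ¬(VS₁ = VS₂ ∧ ES₁ = ES₂))
    (hne : (VS₁ ∩ VS₂).Nonempty)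
    (ι₁ : PresentedGroup (P.subRels (VS₁ ∩ VS₂) (ES₁ ∩ ES₂)) →* PresentedGroup (P.subRels VS₁ ES₁))
    (hι₁ : ∀ v : (VS₁ ∩ VS₂ : Set V),
      ι₁ (PresentedGroup.of v) = PresentedGroup.of (⟨(v : V), v.2.1⟩ : VS₁))
    (ι₂ : PresentedGroup (P.subRels (VS₁ ∩ VS₂) (ES₁ ∩ ES₂)) →* PresentedGroup (P.subRels VS₂ ES₂))
    (hι₂ : ∀ v : (VS₁ ∩ VS₂ : Set V),
      ι₂ (PresentedGroup.of v) = PresentedGroup.of (⟨(v : V), v.2.2⟩ : VS₂))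
    (κ₁ : PresentedGroup (P.subRels VS₁ ES₁) →* PresentedGroup P.rels)
    (hκ₁ : ∀ v : VS₁, κ₁ (PresentedGroup.of v) = PresentedGroup.of (v : V))
    (κ₂ : PresentedGroup (P.subRels VS₂ ES₂) →* PresentedGroup P.rels)
    (hκ₂ : ∀ v : VS₂, κ₂ (PresentedGroup.of v) = PresentedGroup.of (v : V)) :
    Function.Injective ι₁ ∧ Function.Injective ι₂ ∧
      Function.Injective κ₁ ∧ Function.Injective κ₂ ∧
      κ₁.comp ι₁ = κ₂.comp ι₂ ∧
      ∀ (K : Type) [Group K]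
        (f₁ : PresentedGroup (P.subRels VS₁ ES₁) →* K)
        (f₂ : PresentedGroup (P.subRels VS₂ ES₂) →* K),
        f₁.comp ι₁ = f₂.comp ι₂ →
          ∃! f : PresentedGroup P.rels →* K, f.comp κ₁ = f₁ ∧ f.comp κ₂ = f₂ := by
  have hs₁ := h₁.1.1
  have hs₂ := h₂.1.1
  have hO : ∀ e ∈ ES₁ ∩ ES₂, P.init e ∈ VS₁ ∩ VS₂ ∧ P.label e ∈ VS₁ ∩ VS₂ ∧
      P.term e ∈ VS₁ ∩ VS₂ := fun e he =>
    ⟨⟨hs₁.init_mem e he.1, hs₂.init_mem e he.2⟩, ⟨hs₁.label_mem e he.1, hs₂.label_mem e he.2⟩,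
      ⟨hs₁.term_mem e he.1, hs₂.term_mem e he.2⟩⟩
  have hcard := htree.ncard_inter_le hs₁ hs₂ hne
  obtain ⟨hV, hE⟩ := h₁.union_eq_univ h₂ hdist hne
  have hcomm : κ₁.comp ι₁ = κ₂.comp ι₂ := by
    ext v
    simp [hι₁, hι₂, hκ₁, hκ₂]
  refine ⟨htree.injective_of_comp_mk hinj hne Set.inter_subset_left hO hcard ι₁
      (LOG.mem_normalClosure_of_map_subRels Set.inter_subset_left ι₁ hι₁),
    htree.injective_of_comp_mk hinj hne Set.inter_subset_right hO hcard ι₂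
      (LOG.mem_normalClosure_of_map_subRels Set.inter_subset_right ι₂ hι₂),
    htree.injective_of_comp_mk hinj (hne.mono Set.inter_subset_left) (Set.subset_univ ES₁)
      (fun e he => ⟨hs₁.init_mem e he, hs₁.label_mem e he, hs₁.term_mem e he⟩)
      (LOG.ncard_le_of_connected hs₁.connected) κ₁ (LOG.mem_normalClosure_of_map_rels κ₁ hκ₁),
    htree.injective_of_comp_mk hinj (hne.mono Set.inter_subset_right) (Set.subset_univ ES₂)
      (fun e he => ⟨hs₂.init_mem e he, hs₂.label_mem e he, hs₂.term_mem e he⟩)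
      (LOG.ncard_le_of_connected hs₂.connected) κ₂ (LOG.mem_normalClosure_of_map_rels κ₂ hκ₂),
    hcomm, fun K _ f₁ f₂ hf => ?_⟩
  classical
  have hmem₂ : ∀ v, v ∉ VS₁ → v ∈ VS₂ := fun v hv =>
    ((Set.eq_univ_iff_forall.1 hV v).resolve_left hv)
  let F : V → K := fun v => if hv : v ∈ VS₁ then f₁ (PresentedGroup.of ⟨v, hv⟩)
    else f₂ (PresentedGroup.of ⟨v, hmem₂ v hv⟩)
  have hF₁ : ∀ v : VS₁, F v = f₁ (PresentedGroup.of v) := fun v => by simp [F]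
  have hF₂ : ∀ v : VS₂, F v = f₂ (PresentedGroup.of v) := fun v => by
    by_cases hv : (v : V) ∈ VS₁
    · have := DFunLike.congr_fun hf (PresentedGroup.of ⟨v, hv, v.2⟩)
      rw [MonoidHom.comp_apply, MonoidHom.comp_apply, hι₁, hι₂] at this
      rw [← this]
      exact hF₁ ⟨v, hv⟩
    · simp [F, hv]
  have hrel : ∀ r ∈ P.rels, FreeGroup.lift F r = 1 := by
    rintro _ ⟨e, rfl⟩
    simp only [map_mul, map_inv, FreeGroup.lift_apply_of]
    rcases Set.eq_univ_iff_forall.1 hE e with he | he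
    · exact LOG.map_relator_eq f₁ F hF₁ hs₁ he
    · exact LOG.map_relator_eq f₂ F hF₂ hs₂ he
  refine ⟨PresentedGroup.toGroup hrel, ⟨?_, ?_⟩, ?_⟩
  · ext v
    simp [hκ₁, hF₁]
  · ext v
    simp [hκ₂, hF₂]
  · rintro f ⟨rfl, rfl⟩
    ext v
    rw [PresentedGroup.toGroup.of]
    rcases Set.eq_univ_iff_forall.1 hV v with hv | hv
    · rw [hF₁ ⟨v, hv⟩, MonoidHom.comp_apply, hκ₁]
    · rw [hF₂ ⟨v, hv⟩, MonoidHom.comp_apply, hκ₂]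
end

section
/- Let P be a reduced labeled oriented tree whose maximal proper sub-LOTs T₁, …, Tₙ are pairwise disjoint, let T = T₁ ∪ … ∪ Tₙ, and assume P is injective relative to T. Then there exists a reorientation Q of P in which only edges of P − T are reversed such that W⁺(Q/T) is a tree relative to W⁺(T/T) and W⁻(Q/T) is a tree relative to W⁻(T/T); equivalently, for each sign ± the multigraph obtained from W^±(Q) by deleting the edges contributed by the edges of T and identifying, for each i, all vertices belonging to Tᵢ to a single vertex, is a tree. In particular, the presentation Q = P(Q) satisfies the Stallings test relative to T = P(T). -/
namespace LOG

variable {V E : Type}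

/-- A LOG is compressed if no edge is labeled with one of its own endpoints. -/
def Compressed (G : LOG V E) : Prop := ∀ e, G.label e ≠ G.init e ∧ G.label e ≠ G.term e

/-- A LOG is boundary reduced if every boundary vertex (vertex of valency one)
occurs as an edge label. -/
def BoundaryReduced (G : LOG V E) : Prop :=
  ∀ v : V, (∃! e, G.init e = v ∨ G.term e = v) → ∃ e, G.label e = v

/-- A LOG is interior reduced if no vertex has two adjacent edges with the same label
that both point away from, or both point towards, that vertex. -/
def InteriorReduced (G : LOG V E) : Prop :=
  ∀ e f, e ≠ f → G.label e = G.label f → G.init e ≠ G.init f ∧ G.term e ≠ G.term f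

/-- A LOG is reduced if it is compressed, boundary reduced and interior reduced. -/
def Reduced (G : LOG V E) : Prop := G.Compressed ∧ G.BoundaryReduced ∧ G.InteriorReduced

end LOG

/-- A multigraph: each element of the edge index type `E` has two (possibly equal)
endpoints in `V`; loops and multiple edges are allowed. -/
structure Multigraph (V E : Type) where
  fst : E → V
  snd : E → V

namespace Multigraph

variable {V E : Type}

/-- The initial vertex of a dart (an edge together with an orientation). -/
def dstart (G : Multigraph V E) (d : E × Bool) : V := if d.2 then G.fst d.1 else G.snd d.1

/-- The final vertex of a dart. -/
def dfin (G : Multigraph V E) (d : E × Bool) : V := if d.2 then G.snd d.1 else G.fst d.1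

/-- An edge cycle: a nonempty list of darts in which consecutive darts match up, cyclically. -/
def IsCycle (G : Multigraph V E) (c : List (E × Bool)) : Prop :=
  c ≠ [] ∧ List.Chain' (fun d d' => G.dfin d = G.dstart d') c ∧
    ∀ h : c ≠ [], G.dfin (c.getLast h) = G.dstart (c.head h)

/-- A cycle is homology reduced relative to an edge set `E₀` if it does not contain a
pair of darts, with underlying edge outside `E₀`, that are reverses of each other. -/
def HomReducedRel (E₀ : Set E) (c : List (E × Bool)) : Prop :=
  ∀ d ∈ c, d.1 ∉ E₀ → (d.1, !d.2) ∉ c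

/-- A cycle is homology reduced if it does not contain a dart together with its reverse. -/
def HomReduced (c : List (E × Bool)) : Prop := HomReducedRel (∅ : Set E) c

/-- `G` is a forest relative to the subgraph with edge set `E₀`: every cycle which is
homology reduced relative to `E₀` is contained in `E₀`. -/
def IsForestRel (G : Multigraph V E) (E₀ : Set E) : Prop :=
  ∀ c, G.IsCycle c → HomReducedRel E₀ c → ∀ d ∈ c, d.1 ∈ E₀

/-- A forest: there is no nonempty homology reduced cycle. -/
def IsForest (G : Multigraph V E) : Prop := G.IsForestRel ∅

/-- Two vertices are adjacent if they are the two endpoints of some edge. -/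
def Adj (G : Multigraph V E) (v w : V) : Prop :=
  ∃ e, (G.fst e = v ∧ G.snd e = w) ∨ (G.fst e = w ∧ G.snd e = v)

/-- A multigraph is connected if any two vertices are joined by an edge path. -/
def Connected (G : Multigraph V E) : Prop := ∀ v w, Relation.ReflTransGen G.Adj v w

/-- A tree: connected and a forest. -/
def IsTree (G : Multigraph V E) : Prop := G.Connected ∧ G.IsForest

/-- A tree relative to the subgraph with edge set `E₀`. -/
def IsTreeRel (G : Multigraph V E) (E₀ : Set E) : Prop := G.Connected ∧ G.IsForestRel E₀

/-- Reachability inside the subgraph with edge set `E₀`. -/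
def ReachIn (G : Multigraph V E) (E₀ : Set E) : V → V → Prop :=
  Relation.ReflTransGen fun a b =>
    ∃ e ∈ E₀, (G.fst e = a ∧ G.snd e = b) ∨ (G.fst e = b ∧ G.snd e = a)

end Multigraph

/-- A word in generators `X` and their inverses: a letter `(x, true)` is `x`,
a letter `(x, false)` is `x⁻¹`. -/
abbrev Word (X : Type) := List (X × Bool)

/-- The total exponent sum of a word. -/
def expSum {X : Type} (w : Word X) : ℤ := (w.map fun l => if l.2 then (1 : ℤ) else -1).sum

namespace LOG

variable {V E : Type}

/-- The relator word `x z y⁻¹ z⁻¹` of an edge `e = [x,z,y]`. -/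
def relWord (G : LOG V E) (e : E) : Word V :=
  [(G.init e, true), (G.label e, true), (G.term e, false), (G.label e, false)]

/-- `P` is injective relative to the family of pairwise disjoint sub-LOTs `Tᵢ = (VS i, ES i)`:
after replacing each edge label lying in `Tᵢ` by a chosen vertex `tᵢ ∈ Tᵢ` and collapsing
each `Tᵢ` to `tᵢ` (encoded by the collapsing map `π`), each vertex occurs at most once
as an edge label. -/
def RelInjective {n : ℕ} (P : LOG V E) (VS : Fin n → Set V) (ES : Fin n → Set E) : Prop :=
  ∀ π : V → V, (∀ v, (∀ i, v ∉ VS i) → π v = v) → (∀ i, ∃ t ∈ VS i, ∀ v ∈ VS i, π v = t) →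
    ∀ e f : E, e ∉ (⋃ i, ES i) → f ∉ (⋃ i, ES i) → π (P.label e) = π (P.label f) → e = f

end LOG

/-- `Q` is a reorientation of `G`: `Q` is obtained from `G` by reversing the orientation
of each edge in some subset of the edges, keeping all labels. -/
def IsReorientation {V E : Type} (G Q : LOG V E) : Prop :=
  Q.label = G.label ∧
    ∀ e, (Q.init e = G.init e ∧ Q.term e = G.term e) ∨
      (Q.init e = G.term e ∧ Q.term e = G.init e)

namespace LOG

variable {V E : Type}

/-- The positive graph `W⁺` of a LOG: for each edge `[x,z,y]` one edge joining `x` and `z`. -/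
def Wplus (G : LOG V E) : Multigraph V E := ⟨G.init, G.label⟩

/-- The negative graph `W⁻` of a LOG: for each edge `[x,z,y]` one edge joining `z` and `y`. -/
def Wminus (G : LOG V E) : Multigraph V E := ⟨G.label, G.term⟩

end LOG

/-- The multigraph obtained from `W⁺(Q)` by deleting the edges contributed by the edges
in `ET` and identifying vertices along the collapsing map `π`. -/
def collapsedWplus {V E : Type} (Q : LOG V E) (ET : Set E) (π : V → V) :
    Multigraph (Set.range π) { e : E // e ∉ ET } where
  fst e := ⟨π (Q.init e.1), Set.mem_range_self _⟩
  snd e := ⟨π (Q.label e.1), Set.mem_range_self _⟩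

/-- The multigraph obtained from `W⁻(Q)` by deleting the edges contributed by the edges
in `ET` and identifying vertices along the collapsing map `π`. -/
def collapsedWminus {V E : Type} (Q : LOG V E) (ET : Set E) (π : V → V) :
    Multigraph (Set.range π) { e : E // e ∉ ET } where
  fst e := ⟨π (Q.label e.1), Set.mem_range_self _⟩
  snd e := ⟨π (Q.term e.1), Set.mem_range_self _⟩


section Branchings

variable {V : Type} [DecidableEq V]

/-- The indicator that the arc from `z` to `y` leaves the set `X`. -/
def crossing (X : Finset V) (z y : V) : ℕ := if z ∈ X ∧ y ∉ X then 1 else 0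

theorem crossing_inter_add_union_le (X Y : Finset V) (z y : V) :
    crossing (X ∩ Y) z y + crossing (X ∪ Y) z y ≤ crossing X z y + crossing Y z y := by
  by_cases h1 : z ∈ X <;> by_cases h2 : z ∈ Y <;> by_cases h3 : y ∈ X <;> by_cases h4 : y ∈ Y <;>
    simp [crossing, h1, h2, h3, h4]

variable [Fintype V]

/-- The number of arcs leaving `X` among all arcs `z ⟶ g z` and those arcs `z ⟶ f z`
with `z ∉ S`. -/
def outWeight (S : Finset V) (f g : V → V) (X : Finset V) : ℕ :=
  ∑ z, (crossing X z (g z) + if z ∈ S then 0 else crossing X z (f z))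

theorem outWeight_inter_add_union_le (S : Finset V) (f g : V → V) (X Y : Finset V) :
    outWeight S f g (X ∩ Y) + outWeight S f g (X ∪ Y) ≤ outWeight S f g X + outWeight S f g Y := by
  unfold outWeight
  rw [← Finset.sum_add_distrib, ← Finset.sum_add_distrib]
  refine Finset.sum_le_sum fun z _ => ?_
  have h1 := crossing_inter_add_union_le X Y z (g z)
  have h2 := crossing_inter_add_union_le X Y z (f z)
  split_ifs <;> omega

/-- A partial packing: a branching `f` on `S` rooted at `r` such that the root is still reachable
from everywhere along the arcs not used by the branching. -/
structure PartialBranching (r : V) (a b : V → V) (S : Finset V) (f g : V → V) : Prop where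
  root_mem : r ∈ S
  split : ∀ z, f z = a z ∧ g z = b z ∨ f z = b z ∧ g z = a z
  map_mem : ∀ z ∈ S, z ≠ r → f z ∈ S
  exits : ∀ X : Finset V, X ⊆ S → X.Nonempty → r ∉ X → ∃ z ∈ X, f z ∉ X
  residual : ∀ X : Finset V, X.Nonempty → r ∉ X → 1 ≤ outWeight S f g X

theorem PartialBranching.exists_arc {r : V} {a b : V → V} {S : Finset V} {f g : V → V}
    (hcut : ∀ X : Finset V, X.Nonempty → r ∉ X → 2 ≤ outWeight ∅ a b X)
    (h : PartialBranching r a b S f g) {X : Finset V} (hX : ¬ X ⊆ S)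
    (hX' : (r ∉ X ∧ outWeight S f g X ≤ 1) ∨ X = Finset.univ) :
    ∃ u ∈ X, u ∉ S ∧ (f u ∈ X ∩ S ∨ g u ∈ X ∩ S) := by
  by_contra! hcon
  have hne : (X \ S).Nonempty := Finset.sdiff_nonempty.2 hX
  have h2 := hcut (X \ S) hne (by simp [h.root_mem])
  have h3 : outWeight ∅ a b (X \ S) ≤ outWeight S f g X := by
    unfold outWeight
    refine Finset.sum_le_sum fun z _ => ?_
    by_cases hz : z ∈ X
    · by_cases hzS : z ∈ S
      · simp [crossing, hzS]
      · have h4 := hcon z hz hzS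
        simp only [Finset.mem_inter, not_and] at h4
        rcases h.split z with h5 | h5 <;> rw [← h5.1, ← h5.2] <;>
          simp only [crossing, hz, hzS, Finset.notMem_empty, Finset.mem_sdiff, if_false] <;>
          by_cases h6 : f z ∈ X <;> by_cases h7 : g z ∈ X <;> simp [h6, h7, h4.1, h4.2]
    · simp [crossing, hz]
  rcases hX' with hX' | rfl
  · omega
  · have : outWeight S f g Finset.univ = 0 := by simp [outWeight, crossing]
    omega

theorem PartialBranching.extend {r : V} {a b : V → V} {S : Finset V} {f g : V → V}
    (hcut : ∀ X : Finset V, X.Nonempty → r ∉ X → 2 ≤ outWeight ∅ a b X)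
    (h : PartialBranching r a b S f g) (hS : S ≠ Finset.univ) :
    ∃ u ∉ S, ∃ f' g', PartialBranching r a b (insert u S) f' g' := by
  classical
  let F : Finset (Finset V) := Finset.univ.filter fun X =>
    ¬ X ⊆ S ∧ ((r ∉ X ∧ outWeight S f g X ≤ 1) ∨ X = Finset.univ)
  have hF : F.Nonempty := ⟨Finset.univ, by
    simp only [F, Finset.mem_filter, Finset.mem_univ, true_and, or_true, and_true]
    exact fun hu => hS (Finset.univ_subset_iff.1 hu)⟩
  obtain ⟨X, hXF, hXmin⟩ := F.exists_min_image Finset.card hF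
  simp only [F, Finset.mem_filter, Finset.mem_univ, true_and] at hXF hXmin
  obtain ⟨u, huX, huS, hu⟩ := h.exists_arc hcut hXF.1 hXF.2
  obtain ⟨v, w, hvX, hvS, hsplit⟩ : ∃ v w, v ∈ X ∧ v ∈ S ∧
      ((v = f u ∧ w = g u) ∨ (v = g u ∧ w = f u)) := by
    rcases hu with hu | hu
    · exact ⟨f u, g u, (Finset.mem_inter.1 hu).1, (Finset.mem_inter.1 hu).2, by simp⟩
    · exact ⟨g u, f u, (Finset.mem_inter.1 hu).1, (Finset.mem_inter.1 hu).2, by simp⟩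
  have hfS : ∀ z ∈ S, Function.update f u v z = f z := fun z hz =>
    Function.update_of_ne (fun e : z = u => huS (e ▸ hz)) _ _
  have hweight : ∀ Y : Finset V, outWeight S f g Y =
      outWeight (insert u S) (Function.update f u v) (Function.update g u w) Y
        + crossing Y u v := by
    intro Y
    unfold outWeight
    rw [← Finset.add_sum_erase _ _ (Finset.mem_univ u),
      ← Finset.add_sum_erase (a := u) _ (fun z => crossing Y z (Function.update g u w z) + _)
        (Finset.mem_univ u)]
    have : ∀ z ∈ Finset.univ.erase u,
        (crossing Y z (g z) + if z ∈ S then 0 else crossing Y z (f z)) =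
        crossing Y z (Function.update g u w z) +
          if z ∈ insert u S then 0 else crossing Y z (Function.update f u v z) := by
      intro z hz
      have hzu := Finset.ne_of_mem_erase hz
      simp [hzu]
    rw [Finset.sum_congr rfl this]
    simp only [huS, if_false, Function.update_self, Finset.mem_insert_self, if_true, add_zero]
    rcases hsplit with ⟨rfl, rfl⟩ | ⟨rfl, rfl⟩ <;> ring
  refine ⟨u, huS, Function.update f u v, Function.update g u w,
    Finset.mem_insert_of_mem h.root_mem, ?_, ?_, ?_, ?_⟩
  · intro z
    by_cases hz : z = u
    · subst hz
      simp only [Function.update_self]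
      have := h.split z
      rcases hsplit with ⟨rfl, rfl⟩ | ⟨rfl, rfl⟩
      · exact this
      · tauto
    · simpa [Function.update_of_ne hz] using h.split z
  · intro z hz hzr
    rcases Finset.mem_insert.1 hz with rfl | hz
    · simp [hvS]
    · rw [hfS z hz]
      exact Finset.mem_insert_of_mem (h.map_mem z hz hzr)
  · intro Y hYS hY hrY
    by_cases hYe : (Y.erase u).Nonempty
    · have hsub : Y.erase u ⊆ S := by
        rwa [← Finset.subset_insert_iff]
      obtain ⟨z, hz, hfz⟩ := h.exits _ hsub hYe (fun hr => hrY (Finset.mem_of_mem_erase hr))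
      have hzY := Finset.mem_of_mem_erase hz
      refine ⟨z, hzY, ?_⟩
      rw [hfS z (hsub hz)]
      intro hc
      have h1 := h.map_mem z (hsub hz) (fun e => hrY (e ▸ hzY))
      exact hfz (Finset.mem_erase.2 ⟨fun e => huS (e ▸ h1), hc⟩)
    · rw [Finset.not_nonempty_iff_eq_empty, Finset.erase_eq_empty_iff] at hYe
      rcases hYe with rfl | rfl
      · simp at hY
      · refine ⟨u, by simp, ?_⟩
        simp only [Function.update_self, Finset.mem_singleton]
        exact fun e => huS (e ▸ hvS)
  · intro Y hY hrY
    by_contra hlt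
    have hw := hweight Y
    have h1 := h.residual Y hY hrY
    have hc : crossing Y u v ≤ 1 := by unfold crossing; split_ifs <;> simp
    have huv : u ∈ Y ∧ v ∉ Y := by
      by_contra hn
      have : crossing Y u v = 0 := by simp only [crossing, if_neg hn]
      omega
    have hY1 : outWeight S f g Y ≤ 1 := by omega
    have hI : outWeight S f g (X ∩ Y) ≤ 1 := by
      rcases hXF.2 with hX | rfl
      · have h2 := outWeight_inter_add_union_le S f g X Y
        have h3 := h.residual (X ∪ Y) (hY.mono Finset.subset_union_right) (by simp [hX.1, hrY])
        omega
      · simpa using hY1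
    have hmin := hXmin (X ∩ Y) ⟨fun hs => huS (hs (Finset.mem_inter.2 ⟨huX, huv.1⟩)),
      Or.inl ⟨fun hr => hrY (Finset.mem_inter.1 hr).2, hI⟩⟩
    have hss : X ∩ Y ⊂ X := by
      refine (Finset.ssubset_iff_of_subset Finset.inter_subset_left).2 ⟨v, hvX, ?_⟩
      simp [huv.2]
    exact absurd (Finset.card_lt_card hss) (not_lt.2 hmin)

/-- Edmonds' disjoint branchings theorem for two branchings in a digraph in which every vertex
`z` has the two out-arcs `z ⟶ a z` and `z ⟶ b z`. -/
theorem exists_split_branchings (r : V) (a b : V → V)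
    (hcut : ∀ X : Finset V, X.Nonempty → r ∉ X → 2 ≤ outWeight ∅ a b X) :
    ∃ f g : V → V, (∀ z, f z = a z ∧ g z = b z ∨ f z = b z ∧ g z = a z) ∧
      (∀ X : Finset V, X.Nonempty → r ∉ X → ∃ z ∈ X, f z ∉ X) ∧
      (∀ X : Finset V, X.Nonempty → r ∉ X → ∃ z ∈ X, g z ∉ X) := by
  have key : ∀ (n : ℕ) (S : Finset V) (f g : V → V), Sᶜ.card = n →
      PartialBranching r a b S f g →
      ∃ f g, PartialBranching r a b Finset.univ f g := by
    intro n
    induction n with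
    | zero =>
      intro S f g hn h
      rw [Finset.card_eq_zero, Finset.compl_eq_empty_iff] at hn
      exact ⟨f, g, hn ▸ h⟩
    | succ n ih =>
      intro S f g hn h
      obtain ⟨u, hu, f', g', h'⟩ := h.extend hcut (by rintro rfl; simp at hn)
      refine ih _ f' g' ?_ h'
      rw [Finset.compl_insert, Finset.card_erase_of_mem (by simpa using hu), hn]
      rfl
  have hinit : PartialBranching r a b {r} a b := by
    refine ⟨by simp, by simp, ?_, ?_, ?_⟩
    · intro z hz hzr
      exact absurd (Finset.mem_singleton.1 hz) hzr
    · intro X hX hne hr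
      obtain ⟨x, hx⟩ := hne
      exact absurd (Finset.mem_singleton.1 (hX hx) ▸ hx) hr
    · intro X hne hr
      have h1 := hcut X hne hr
      have h2 : outWeight {r} a b X = outWeight ∅ a b X := by
        unfold outWeight
        refine Finset.sum_congr rfl fun z _ => ?_
        by_cases hz : z = r
        · subst hz; simp [crossing, hr]
        · simp [hz]
      omega
  obtain ⟨f, g, h⟩ := key _ _ _ _ rfl hinit
  refine ⟨f, g, h.split, fun X => h.exits X (Finset.subset_univ X), fun X hne hr => ?_⟩
  by_contra! hcon
  have h1 := h.residual X hne hr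
  have h2 : outWeight Finset.univ f g X = 0 := by
    simp only [outWeight, Finset.mem_univ, if_true, add_zero, crossing]
    refine Finset.sum_eq_zero fun z _ => if_neg ?_
    rintro ⟨hz, hgz⟩
    exact hgz (hcon z hz)
  omega

end Branchings
namespace Multigraph

variable {A B : Type}

theorem Adj.symm {G : Multigraph A B} {v w : A} (h : G.Adj v w) : G.Adj w v := by
  obtain ⟨e, he⟩ := h
  exact ⟨e, he.symm⟩

theorem card_le_of_connected_sup [Fintype A] [Fintype B] (G : Multigraph A B) (Y : Finset A)
    (hY : Y.Nonempty)
    (hconn : ∀ v w, Relation.ReflTransGen (fun x y => G.Adj x y ∨ (x ∈ Y ∧ y ∈ Y)) v w) :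
    Fintype.card A ≤ Fintype.card B + Y.card := by
  classical
  obtain ⟨y₀, hy₀⟩ := hY
  let D : Finset (Sym2 A) := Finset.univ.image (fun e => s(G.fst e, G.snd e)) ∪
    (Y.erase y₀).image (fun y => s(y₀, y))
  let K : SimpleGraph A := SimpleGraph.fromEdgeSet (D : Set (Sym2 A))
  have hD : ∀ x y, s(x, y) ∈ D → K.Reachable x y := by
    intro x y hxy
    by_cases hne : x = y
    · rw [hne]
    · exact SimpleGraph.Adj.reachable ((SimpleGraph.fromEdgeSet_adj _).2 ⟨hxy, hne⟩)
  have hstar : ∀ y ∈ Y, K.Reachable y₀ y := by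
    intro y hy
    by_cases hne : y = y₀
    · rw [hne]
    · exact hD _ _ (Finset.mem_union_right _
        (Finset.mem_image_of_mem _ (Finset.mem_erase.2 ⟨hne, hy⟩)))
  have hstep : ∀ x y, (G.Adj x y ∨ (x ∈ Y ∧ y ∈ Y)) → K.Reachable x y := by
    rintro x y (⟨e, ⟨rfl, rfl⟩ | ⟨rfl, rfl⟩⟩ | ⟨hx, hy⟩)
    · exact hD _ _ (Finset.mem_union_left _ (Finset.mem_image_of_mem _ (Finset.mem_univ e)))
    · exact (hD _ _ (Finset.mem_union_left _
        (Finset.mem_image_of_mem _ (Finset.mem_univ e)))).symm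
    · exact (hstar x hx).symm.trans (hstar y hy)
  have hK : K.Connected := by
    have : Nonempty A := ⟨y₀⟩
    refine ⟨fun v w => ?_⟩
    induction hconn v w with
    | refl => exact SimpleGraph.Reachable.refl _
    | tail _ h ih => exact ih.trans (hstep _ _ h)
  have h1 := hK.card_vert_le_card_edgeSet_add_one
  have h2 : Nat.card K.edgeSet ≤ D.card := by
    have : K.edgeSet ⊆ (D : Set (Sym2 A)) := by
      simp [K, SimpleGraph.edgeSet_fromEdgeSet]
    rw [Nat.card_coe_set_eq, ← Set.ncard_coe_finset]
    exact Set.ncard_le_ncard this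
  have h3 : D.card ≤ Fintype.card B + (Y.card - 1) := by
    refine (Finset.card_union_le _ _).trans (add_le_add ?_ ?_)
    · exact Finset.card_image_le
    · exact Finset.card_image_le.trans (Finset.card_erase_of_mem hy₀).le
  have h4 : 0 < Y.card := Finset.card_pos.2 ⟨y₀, hy₀⟩
  rw [Nat.card_eq_fintype_card] at h1
  omega

theorem Connected.card_le [Fintype A] [Fintype B] [Nonempty A] {G : Multigraph A B}
    (h : G.Connected) : Fintype.card A ≤ Fintype.card B + 1 := by
  classical
  obtain ⟨a⟩ := ‹Nonempty A›
  simpa using G.card_le_of_connected_sup {a} (by simp)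
    fun v w => Relation.ReflTransGen.mono (fun _ _ => Or.inl) _ _ (h v w)

/-- In a connected multigraph with one more vertex than edges, any nonempty vertex set `Y` spans
fewer than `|Y|` edges. -/
theorem Connected.card_inner_lt [Fintype A] [Fintype B] [DecidableEq A] {G : Multigraph A B}
    (h : G.Connected) (hcard : Fintype.card A = Fintype.card B + 1) (Y : Finset A)
    (hY : Y.Nonempty) :
    (Finset.univ.filter fun e => G.fst e ∈ Y ∧ G.snd e ∈ Y).card < Y.card := by
  let G' : Multigraph A {e // ¬ (G.fst e ∈ Y ∧ G.snd e ∈ Y)} :=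
    ⟨fun e => G.fst e.1, fun e => G.snd e.1⟩
  have h1 := G'.card_le_of_connected_sup Y hY fun v w => Relation.ReflTransGen.mono (by
    rintro x y ⟨e, he⟩
    by_cases hin : G.fst e ∈ Y ∧ G.snd e ∈ Y
    · right
      rcases he with ⟨rfl, rfl⟩ | ⟨rfl, rfl⟩
      · exact hin
      · exact hin.symm
    · exact Or.inl ⟨⟨e, hin⟩, he⟩) _ _ (h v w)
  rw [Fintype.card_subtype_compl, Fintype.card_subtype] at h1
  have h2 : (Finset.univ.filter fun e => G.fst e ∈ Y ∧ G.snd e ∈ Y).card ≤ Fintype.card B :=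
    Finset.card_le_univ _
  have h3 : 0 < Y.card := Finset.card_pos.2 hY
  omega

theorem IsCycle.exists_pred {G : Multigraph A B} {l : List (B × Bool)} (hl : G.IsCycle l)
    {d : B × Bool} (hd : d ∈ l) : ∃ d' ∈ l, G.dfin d' = G.dstart d := by
  obtain ⟨hne, hchain, hclose⟩ := hl
  obtain ⟨i, hi, rfl⟩ := List.getElem_of_mem hd
  rcases i with _ | i
  · refine ⟨l.getLast hne, List.getLast_mem hne, ?_⟩
    rw [hclose hne, List.head_eq_getElem]
  · exact ⟨l[i], List.getElem_mem _, List.isChain_iff_getElem.1 hchain i hi⟩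

theorem IsCycle.exists_succ {G : Multigraph A B} {l : List (B × Bool)} (hl : G.IsCycle l)
    {d : B × Bool} (hd : d ∈ l) : ∃ d' ∈ l, G.dstart d' = G.dfin d := by
  obtain ⟨hne, hchain, hclose⟩ := hl
  obtain ⟨i, hi, rfl⟩ := List.getElem_of_mem hd
  by_cases hi' : i + 1 < l.length
  · exact ⟨l[i + 1], List.getElem_mem _, (List.isChain_iff_getElem.1 hchain i hi').symm⟩
  · refine ⟨l.head hne, List.head_mem hne, ?_⟩
    rw [← hclose hne, List.getLast_eq_getElem]
    congr 2
    omega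

/-- A multigraph whose edges join each vertex other than `r` to a vertex of smaller height, with
exactly one such edge for each vertex, is a tree. -/
theorem isTree_of_parent (G : Multigraph A B) (r : A) (child : B → A) (p : A → A) (h : A → ℕ)
    (hinj : Function.Injective child) (hsurj : ∀ z, z ≠ r → ∃ e, child e = z)
    (hends : ∀ e, (G.fst e = child e ∧ G.snd e = p (child e)) ∨
      (G.snd e = child e ∧ G.fst e = p (child e)))
    (hlt : ∀ e, h (p (child e)) < h (child e)) : G.IsTree := by
  have hroot : ∀ n v, h v = n → Relation.ReflTransGen G.Adj v r := by
    intro n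
    induction n using Nat.strong_induction_on with
    | _ n ih =>
      intro v hv
      by_cases hvr : v = r
      · rw [hvr]
      · obtain ⟨e, rfl⟩ := hsurj v hvr
        exact Relation.ReflTransGen.head ⟨e, (hends e).imp id And.symm⟩
          (ih _ (hv ▸ hlt e) _ rfl)
  refine ⟨fun v w => (hroot _ v rfl).trans ?_, ?_⟩
  · have : Std.Symm G.Adj := ⟨fun _ _ => Adj.symm⟩
    exact Std.Symm.symm _ _ (hroot _ w rfl)
  · intro l hl hred d₀ hd₀
    exfalso
    classical
    have hdart : ∀ d : B × Bool, (G.dstart d = child d.1 ∧ G.dfin d = p (child d.1)) ∨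
        (G.dfin d = child d.1 ∧ G.dstart d = p (child d.1)) := by
      rintro ⟨e, _ | _⟩
      · simpa [dstart, dfin] using (hends e).symm
      · simpa [dstart, dfin] using hends e
    obtain ⟨d, hd, hmax⟩ := l.toFinset.exists_max_image (fun d => h (G.dstart d))
      ⟨d₀, by simpa using hd₀⟩
    simp only [List.mem_toFinset] at hd hmax
    have hup : G.dstart d = child d.1 ∧ G.dfin d = p (child d.1) := by
      refine (hdart d).resolve_right fun hdown => ?_
      obtain ⟨d', hd', hs⟩ := hl.exists_succ hd
      have h1 := hmax d' hd'
      rw [hs, hdown.1, hdown.2] at h1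
      exact absurd (hlt d.1) (not_lt.2 h1)
    obtain ⟨d', hd', hs⟩ := hl.exists_pred hd
    have hdown : G.dfin d' = child d'.1 ∧ G.dstart d' = p (child d'.1) := by
      refine (hdart d').resolve_left fun hup' => ?_
      have h1 := hmax d' hd'
      rw [← hs, hup'.1, hup'.2] at h1
      exact absurd (hlt d'.1) (not_lt.2 h1)
    have he : d'.1 = d.1 := hinj (by rw [← hdown.1, hs, hup.1])
    have hne : d'.2 ≠ d.2 := by
      intro hb
      have hdd : d' = d := Prod.ext he hb
      have h1 := hlt d.1
      rw [← hup.2, ← hup.1, ← hs, hdd] at h1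
      exact lt_irrefl _ h1
    refine hred d hd (Set.notMem_empty _) ?_
    have : d' = (d.1, !d.2) := Prod.ext he (Bool.eq_not_of_ne hne)
    exact this ▸ hd'

theorem exists_height [Fintype A] [DecidableEq A] (r : A) (p : A → A)
    (hexit : ∀ X : Finset A, X.Nonempty → r ∉ X → ∃ z ∈ X, p z ∉ X) :
    ∃ h : A → ℕ, ∀ z, z ≠ r → h (p z) < h z := by
  classical
  have hreach : ∀ z, ∃ n, p^[n] z = r := by
    by_contra! hcon
    obtain ⟨z, hz⟩ := hcon
    obtain ⟨x, hx, hpx⟩ := hexit (Finset.univ.filter fun x => ∀ n, p^[n] x ≠ r)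
      ⟨z, by simpa using hz⟩ (by simpa using ⟨0, rfl⟩)
    simp only [Finset.mem_filter, Finset.mem_univ, true_and] at hx hpx
    exact hpx fun n => hx (n + 1)
  refine ⟨fun z => Nat.find (hreach z), fun z hz => ?_⟩
  have hspec := Nat.find_spec (hreach z)
  obtain ⟨m, hm⟩ : ∃ m, Nat.find (hreach z) = m + 1 := by
    refine Nat.exists_eq_succ_of_ne_zero fun h0 => hz ?_
    rw [h0] at hspec
    exact hspec
  rw [hm] at hspec
  change Nat.find (hreach (p z)) < Nat.find (hreach z)
  rw [hm]
  exact Nat.lt_succ_of_le (Nat.find_min' _ hspec)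

end Multigraph
namespace LOG

variable {A B : Type} (G : LOG A B)

/-- One step along an edge of `G` whose endpoints and label all lie in `X`. -/
def StepIn (X : Set A) (x y : A) : Prop :=
  ∃ e, G.init e ∈ X ∧ G.term e ∈ X ∧ G.label e ∈ X ∧
    ((G.init e = x ∧ G.term e = y) ∨ (G.init e = y ∧ G.term e = x))

variable {G}

theorem StepIn.symm {X : Set A} {x y : A} (h : G.StepIn X x y) : G.StepIn X y x := by
  obtain ⟨e, h1, h2, h3, h4⟩ := h
  exact ⟨e, h1, h2, h3, h4.symm⟩

theorem two_le_outWeight [Fintype A] [Fintype B] [DecidableEq A]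
    (hconn : (Multigraph.mk G.init G.term).Connected)
    (hcard : Fintype.card A = Fintype.card B + 1) (hcomp : G.Compressed)
    (hsub : ∀ X : Set A, X ≠ Set.univ → X.Nontrivial →
      ∃ x ∈ X, ∃ y ∈ X, ¬ Relation.ReflTransGen (G.StepIn X) x y)
    (r : A) (hlab : ∀ z, z ≠ r → ∃ e, G.label e = z) (a b : A → A)
    (ha : ∀ e, a (G.label e) = G.init e) (hb : ∀ e, b (G.label e) = G.term e)
    (X : Finset A) (hX : X.Nonempty) (hr : r ∉ X) : 2 ≤ outWeight ∅ a b X := by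
  classical
  by_contra! hlt
  have hweight : outWeight ∅ a b X = ∑ z, (crossing X z (b z) + crossing X z (a z)) := by
    simp [outWeight]
  let I : Finset B := Finset.univ.filter fun e =>
    G.init e ∈ X ∧ G.term e ∈ X ∧ G.label e ∈ X
  have hcount : X.card ≤ I.card + outWeight ∅ a b X := by
    have h1 : X ⊆ I.image G.label ∪ X.filter (fun z => a z ∉ X ∨ b z ∉ X) := by
      intro z hz
      obtain ⟨e, rfl⟩ := hlab z fun h => hr (h ▸ hz)
      by_cases hout : a (G.label e) ∉ X ∨ b (G.label e) ∉ X
      · exact Finset.mem_union_right _ (Finset.mem_filter.2 ⟨hz, hout⟩)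
      · push Not at hout
        rw [ha, hb] at hout
        exact Finset.mem_union_left _ (Finset.mem_image_of_mem _
          (Finset.mem_filter.2 ⟨Finset.mem_univ _, hout.1, hout.2, hz⟩))
    have h2 : (X.filter (fun z => a z ∉ X ∨ b z ∉ X)).card ≤ outWeight ∅ a b X := by
      rw [hweight, Finset.card_filter]
      refine (Finset.sum_le_sum fun z hz => ?_).trans
        (Finset.sum_le_sum_of_subset (Finset.subset_univ X))
      by_cases h3 : a z ∈ X <;> by_cases h4 : b z ∈ X <;> simp [crossing, h3, h4, hz]
    exact ((Finset.card_le_card h1).trans (Finset.card_union_le _ _)).trans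
      (add_le_add Finset.card_image_le h2)
  rcases Finset.eq_singleton_or_nontrivial hX.choose_spec with hsing | hnt
  · set z := hX.choose
    obtain ⟨e, he⟩ := hlab z fun h => hr (h ▸ hX.choose_spec)
    have h1 : crossing X z (b z) + crossing X z (a z) ≤ outWeight ∅ a b X := by
      rw [hweight]
      exact Finset.single_le_sum (f := fun z => crossing X z (b z) + crossing X z (a z))
        (fun _ _ => Nat.zero_le _) (Finset.mem_univ z)
    have h2 := hcomp e
    rw [← ha, ← hb, he] at h2
    rw [hsing] at h1
    simp [crossing, h2.1.symm, h2.2.symm] at h1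
    rw [hsing] at hlt
    omega
  · obtain ⟨x, hx, y, hy, hxy⟩ := hsub X
      (fun h => hr (Finset.mem_coe.1 (h.symm.subset (Set.mem_univ r)))) hnt
    let X₁ := X.filter fun w => Relation.ReflTransGen (G.StepIn X) x w
    let X₂ := X.filter fun w => ¬ Relation.ReflTransGen (G.StepIn X) x w
    have hc1 := hconn.card_inner_lt hcard X₁
      ⟨x, Finset.mem_filter.2 ⟨hx, Relation.ReflTransGen.refl⟩⟩
    have hc2 := hconn.card_inner_lt hcard X₂ ⟨y, Finset.mem_filter.2 ⟨hy, hxy⟩⟩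
    have hI : I ⊆ (Finset.univ.filter fun e => G.init e ∈ X₁ ∧ G.term e ∈ X₁) ∪
        (Finset.univ.filter fun e => G.init e ∈ X₂ ∧ G.term e ∈ X₂) := by
      intro e he
      simp only [I, Finset.mem_filter, Finset.mem_univ, true_and] at he
      have hs : G.StepIn X (G.init e) (G.term e) :=
        ⟨e, he.1, he.2.1, he.2.2, Or.inl ⟨rfl, rfl⟩⟩
      simp only [X₁, X₂, Finset.mem_union, Finset.mem_filter, Finset.mem_univ, true_and, he.1,
        he.2.1]
      by_cases hi : Relation.ReflTransGen (G.StepIn X) x (G.init e)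
      · exact Or.inl ⟨hi, hi.tail hs⟩
      · exact Or.inr ⟨hi, fun ht => hi (ht.tail hs.symm)⟩
    have h1 := (Finset.card_le_card hI).trans (Finset.card_union_le _ _)
    have h2 : X₁.card + X₂.card = X.card := Finset.card_filter_add_card_filter_not _
    simp only at hc1 hc2
    omega

/-- A connected compressed injective LOG with one more vertex than edges and without proper
sub-LOTs has a reorientation whose positive and negative graphs are both trees. -/
theorem exists_reorientation_isTree [Fintype A] [Fintype B]
    (hconn : (Multigraph.mk G.init G.term).Connected)
    (hcard : Fintype.card A = Fintype.card B + 1) (hcomp : G.Compressed)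
    (hinj : G.InjectiveLabels)
    (hsub : ∀ X : Set A, X ≠ Set.univ → X.Nontrivial →
      ∃ x ∈ X, ∃ y ∈ X, ¬ Relation.ReflTransGen (G.StepIn X) x y) :
    ∃ Q : LOG A B, IsReorientation G Q ∧ Q.Wplus.IsTree ∧ Q.Wminus.IsTree := by
  classical
  obtain ⟨r, hr⟩ : ∃ r, ∀ e, G.label e ≠ r := by
    by_contra! hcon
    have := Fintype.card_le_of_surjective G.label hcon
    omega
  have hlab : ∀ z, z ≠ r → ∃ e, G.label e = z := by
    have h1 : Finset.univ.image G.label = Finset.univ.erase r := by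
      refine Finset.eq_of_subset_of_card_le (fun z hz => ?_) ?_
      · obtain ⟨e, -, rfl⟩ := Finset.mem_image.1 hz
        exact Finset.mem_erase.2 ⟨hr e, Finset.mem_univ _⟩
      · rw [Finset.card_erase_of_mem (Finset.mem_univ r), Finset.card_image_of_injective _ hinj,
          Finset.card_univ, Finset.card_univ, hcard]
        rfl
    intro z hz
    have h2 : z ∈ Finset.univ.image G.label := h1 ▸ Finset.mem_erase.2 ⟨hz, Finset.mem_univ z⟩
    simpa using h2
  let a : A → A := Function.extend G.label G.init id
  let b : A → A := Function.extend G.label G.term id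
  have ha : ∀ e, a (G.label e) = G.init e := fun e => Function.Injective.extend_apply hinj _ _ e
  have hb : ∀ e, b (G.label e) = G.term e := fun e => Function.Injective.extend_apply hinj _ _ e
  obtain ⟨f, g, hfg, hf, hg⟩ := exists_split_branchings r a b
    (two_le_outWeight hconn hcard hcomp hsub r hlab a b ha hb)
  obtain ⟨hf', hf'lt⟩ := Multigraph.exists_height r f hf
  obtain ⟨hg', hg'lt⟩ := Multigraph.exists_height r g hg
  refine ⟨⟨fun e => f (G.label e), G.label, fun e => g (G.label e)⟩, ⟨rfl, fun e => ?_⟩, ?_, ?_⟩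
  · simpa only [ha, hb] using hfg (G.label e)
  · exact Multigraph.isTree_of_parent _ r G.label f hf' hinj hlab
      (fun e => Or.inr ⟨rfl, rfl⟩) (fun e => hf'lt _ (hr e))
  · exact Multigraph.isTree_of_parent _ r G.label g hg' hinj hlab
      (fun e => Or.inl ⟨rfl, rfl⟩) (fun e => hg'lt _ (hr e))

end LOG
namespace Multigraph

variable {A A' B : Type}

theorem IsTree.map {G : Multigraph A B} (h : G.IsTree) (G' : Multigraph A' B) (ψ : A → A')
    (hψ : Function.Bijective ψ) (hfst : ∀ e, G'.fst e = ψ (G.fst e))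
    (hsnd : ∀ e, G'.snd e = ψ (G.snd e)) : G'.IsTree := by
  have hstart : ∀ d, G'.dstart d = ψ (G.dstart d) := by
    rintro ⟨e, _ | _⟩ <;> simp [dstart, hfst, hsnd]
  have hfin : ∀ d, G'.dfin d = ψ (G.dfin d) := by
    rintro ⟨e, _ | _⟩ <;> simp [dfin, hfst, hsnd]
  refine ⟨fun v w => ?_, fun l hl => h.2 l ?_⟩
  · obtain ⟨v, rfl⟩ := hψ.2 v
    obtain ⟨w, rfl⟩ := hψ.2 w
    refine Relation.ReflTransGen.lift ψ ?_ _ _ (h.1 v w)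
    rintro x y ⟨e, he⟩
    refine ⟨e, ?_⟩
    rw [hfst, hsnd]
    rcases he with ⟨rfl, rfl⟩ | ⟨rfl, rfl⟩ <;> simp
  · obtain ⟨h1, h2, h3⟩ := hl
    refine ⟨h1, h2.imp fun d d' hd => hψ.1 ?_, fun hne => hψ.1 ?_⟩
    · rwa [hfin, hstart] at hd
    · simpa only [hfin, hstart] using h3 hne

/-- A list of darts is an edge path from one vertex to another. -/
def IsPath (G : Multigraph A B) : List (B × Bool) → A → A → Prop
  | [], u, v => u = v
  | d :: l, u, v => G.dstart d = u ∧ G.IsPath l (G.dfin d) v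

theorem isPath_of_isChain (G : Multigraph A B) (d : B × Bool) (l : List (B × Bool))
    (h : List.IsChain (fun d d' => G.dfin d = G.dstart d') (d :: l)) :
    G.IsPath (d :: l) (G.dstart d) (G.dfin ((d :: l).getLast (List.cons_ne_nil d l))) := by
  induction l generalizing d with
  | nil => exact ⟨rfl, rfl⟩
  | cons d' l ih =>
    rw [List.isChain_cons_cons] at h
    refine ⟨rfl, ?_⟩
    rw [h.1, List.getLast_cons (List.cons_ne_nil d' l)]
    exact ih d' h.2

theorem IsPath.isChain {G : Multigraph A B} (d : B × Bool) (l : List (B × Bool)) {u v : A}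
    (h : G.IsPath (d :: l) u v) :
    List.IsChain (fun d d' => G.dfin d = G.dstart d') (d :: l) ∧ G.dstart d = u ∧
      G.dfin ((d :: l).getLast (List.cons_ne_nil d l)) = v := by
  induction l generalizing d u with
  | nil => exact ⟨List.isChain_singleton _, h.1, h.2⟩
  | cons d' l ih =>
    obtain ⟨h1, h2, h3⟩ := ih d' h.2
    refine ⟨List.isChain_cons_cons.2 ⟨h2.symm, h1⟩, h.1, ?_⟩
    rw [List.getLast_cons (List.cons_ne_nil d' l)]
    exact h3

theorem isCycle_iff_isPath (G : Multigraph A B) (l : List (B × Bool)) :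
    G.IsCycle l ↔ l ≠ [] ∧ ∃ u, G.IsPath l u u := by
  rcases l with _ | ⟨d, l⟩
  · simp [IsCycle]
  · constructor
    · rintro ⟨hne, hchain, hclose⟩
      refine ⟨hne, G.dstart d, ?_⟩
      have h := G.isPath_of_isChain d l hchain
      rwa [hclose hne] at h
    · rintro ⟨hne, u, hu⟩
      obtain ⟨h1, h2, h3⟩ := hu.isChain
      exact ⟨hne, h1, fun _ => h3.trans h2.symm⟩

open Classical in
/-- Discard the darts over edges of `E₀`. -/
noncomputable def restrictDarts (E₀ : Set B) (l : List (B × Bool)) : List ({e // e ∉ E₀} × Bool) :=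
  l.filterMap fun d => if h : d.1 ∉ E₀ then some (⟨d.1, h⟩, d.2) else none

theorem mem_restrictDarts {E₀ : Set B} {l : List (B × Bool)} {e : {e // e ∉ E₀}} {s : Bool} :
    (e, s) ∈ restrictDarts E₀ l ↔ (e.1, s) ∈ l := by
  classical
  simp only [restrictDarts, List.mem_filterMap]
  constructor
  · rintro ⟨d, hd, hd'⟩
    split_ifs at hd' with h
    obtain ⟨rfl, rfl⟩ := Prod.mk.inj (Option.some.inj hd')
    exact hd
  · intro h
    exact ⟨_, h, by simp [e.2]⟩

/-- If collapsing the edges of `E₀` gives a forest, then the multigraph is a forest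
relative to `E₀`. -/
theorem IsForest.isForestRel {G : Multigraph A B} {E₀ : Set B} {G' : Multigraph A' {e // e ∉ E₀}}
    (hG' : G'.IsForest) (π : A → A') (hfst : ∀ e, G'.fst e = π (G.fst e.1))
    (hsnd : ∀ e, G'.snd e = π (G.snd e.1)) (hcol : ∀ e ∈ E₀, π (G.fst e) = π (G.snd e)) :
    G.IsForestRel E₀ := by
  classical
  have hpath : ∀ l u v, G.IsPath l u v → G'.IsPath (restrictDarts E₀ l) (π u) (π v) := by
    intro l
    induction l with
    | nil => rintro u v rfl; rfl
    | cons d l ih =>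
      rintro u v ⟨rfl, h⟩
      have h' := ih _ _ h
      by_cases hd : d.1 ∈ E₀
      · have h1 : restrictDarts E₀ (d :: l) = restrictDarts E₀ l := by
          simp [restrictDarts, hd]
        have h2 : π (G.dstart d) = π (G.dfin d) := by
          obtain ⟨e, _ | _⟩ := d
          · simpa [dstart, dfin] using (hcol e hd).symm
          · simpa [dstart, dfin] using hcol e hd
        rwa [h1, h2]
      · have h1 : restrictDarts E₀ (d :: l) = (⟨d.1, hd⟩, d.2) :: restrictDarts E₀ l := by
          simp [restrictDarts, hd]
        rw [h1]
        obtain ⟨e, _ | _⟩ := d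
        · exact ⟨by simp [dstart, hsnd], by simpa [dfin, hfst] using h'⟩
        · exact ⟨by simp [dstart, hfst], by simpa [dfin, hsnd] using h'⟩
  intro l hl hred d hd
  by_contra hdE
  have hmem : ((⟨d.1, hdE⟩ : {e // e ∉ E₀}), d.2) ∈ restrictDarts E₀ l :=
    mem_restrictDarts.2 hd
  obtain ⟨-, u, hu⟩ := (G.isCycle_iff_isPath l).1 hl
  refine hG' (restrictDarts E₀ l)
    ((G'.isCycle_iff_isPath _).2 ⟨List.ne_nil_of_mem hmem, π u, hpath l u u hu⟩) ?_ _ hmem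
  rintro ⟨e, s⟩ he - hrev
  exact hred (e.1, s) (mem_restrictDarts.1 he) e.2 (mem_restrictDarts.1 hrev)

theorem ReachIn.mono {G : Multigraph A B} {E₁ E₂ : Set B} (h : E₁ ⊆ E₂) {v w : A}
    (hvw : G.ReachIn E₁ v w) : G.ReachIn E₂ v w :=
  Relation.ReflTransGen.mono (fun _ _ ⟨e, he, hxy⟩ => ⟨e, h he, hxy⟩) _ _ hvw

theorem ReachIn.symm {G : Multigraph A B} {E₁ : Set B} {v w : A}
    (hvw : G.ReachIn E₁ v w) : G.ReachIn E₁ w v := by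
  induction hvw with
  | refl => exact Relation.ReflTransGen.refl
  | tail _ h ih =>
    obtain ⟨e, he, hxy⟩ := h
    exact Relation.ReflTransGen.head ⟨e, he, hxy.symm⟩ ih

theorem reachIn_edge (G : Multigraph A B) {E₁ : Set B} {e : B} (he : e ∈ E₁) :
    G.ReachIn E₁ (G.fst e) (G.snd e) :=
  Relation.ReflTransGen.single ⟨e, he, Or.inl ⟨rfl, rfl⟩⟩

end Multigraph

namespace LOG

variable {V E : Type}

/-- The underlying multigraph of a LOG. -/
def skeleton (G : LOG V E) : Multigraph V E := ⟨G.init, G.term⟩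

theorem subgraph_connected_iff (G : LOG V E) (VS : Set V) (ES : Set E)
    (hinit : ∀ e ∈ ES, G.init e ∈ VS) (hterm : ∀ e ∈ ES, G.term e ∈ VS) :
    (G.subgraph VS ES).Connected ↔
      VS.Nonempty ∧ ∀ v ∈ VS, ∀ w ∈ VS, G.skeleton.ReachIn ES v w := by
  constructor
  · intro h
    refine ⟨Set.nonempty_coe_sort.1 h.nonempty, fun v hv w hw => ?_⟩
    have h1 := (SimpleGraph.reachable_iff_reflTransGen _ _).1 (h.preconnected ⟨v, hv⟩ ⟨w, hw⟩)
    refine Relation.ReflTransGen.lift Subtype.val ?_ _ _ h1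
    intro x y hxy
    rw [subgraph, SimpleGraph.fromRel_adj] at hxy
    rcases hxy.2 with ⟨e, he, hxy⟩ | ⟨e, he, hxy⟩
    · exact ⟨e, he, Or.inl hxy⟩
    · exact ⟨e, he, Or.inr hxy⟩
  · rintro ⟨hne, h⟩
    have : Nonempty VS := hne.to_subtype
    refine ⟨fun v w => ?_⟩
    have key : ∀ y, G.skeleton.ReachIn ES v y →
        ∃ hy : y ∈ VS, (G.subgraph VS ES).Reachable v ⟨y, hy⟩ := by
      intro y hy
      induction hy with
      | refl => exact ⟨v.2, SimpleGraph.Reachable.refl _⟩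
      | @tail b y _ hstep ih =>
        obtain ⟨hb, hvb⟩ := ih
        obtain ⟨e, he, hxy⟩ := hstep
        have hy : y ∈ VS := by
          rcases hxy with ⟨-, rfl⟩ | ⟨rfl, -⟩
          · exact hterm e he
          · exact hinit e he
        refine ⟨hy, hvb.trans ?_⟩
        by_cases hby : b = y
        · subst hby; exact SimpleGraph.Reachable.refl _
        · refine SimpleGraph.Adj.reachable ?_
          rw [subgraph, SimpleGraph.fromRel_adj]
          exact ⟨fun h => hby (congrArg Subtype.val h),
            hxy.imp (fun h => ⟨e, he, h⟩) (fun h => ⟨e, he, h⟩)⟩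
    exact (key w (h v v.2 w w.2)).2

theorem IsTreeGraph.connected {G : LOG V E} (h : G.IsTreeGraph) : G.skeleton.Connected := by
  intro v w
  have h1 := (SimpleGraph.reachable_iff_reflTransGen _ _).1 (h.2.2.connected.preconnected v w)
  refine Relation.ReflTransGen.mono ?_ _ _ h1
  intro x y hxy
  rw [graph, SimpleGraph.fromRel_adj] at hxy
  rcases hxy.2 with ⟨e, hxy⟩ | ⟨e, hxy⟩
  · exact ⟨e, Or.inl hxy⟩
  · exact ⟨e, Or.inr hxy⟩

theorem IsTreeGraph.card_eq [Fintype V] [Fintype E] {G : LOG V E} (h : G.IsTreeGraph) :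
    Fintype.card E + 1 = Fintype.card V := by
  classical
  rw [← h.2.2.card_edgeFinset]
  congr 1
  rw [← Finset.card_univ]
  refine Finset.card_bij (fun e _ => s(G.init e, G.term e)) ?_ ?_ ?_
  · intro e _
    rw [SimpleGraph.mem_edgeFinset, SimpleGraph.mem_edgeSet, graph, SimpleGraph.fromRel_adj]
    exact ⟨h.1 e, Or.inl ⟨e, rfl, rfl⟩⟩
  · intro e _ f _ hef
    exact h.2.1 hef
  · intro s hs
    induction s with
    | h x y =>
      rw [SimpleGraph.mem_edgeFinset, SimpleGraph.mem_edgeSet, graph, SimpleGraph.fromRel_adj] at hs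
      rcases hs.2 with ⟨e, rfl, rfl⟩ | ⟨e, rfl, rfl⟩
      · exact ⟨e, Finset.mem_univ _, rfl⟩
      · exact ⟨e, Finset.mem_univ _, Sym2.eq_swap⟩

theorem IsProperSubLOT.exists_isMaxProperSubLOT [Finite V] [Finite E] {G : LOG V E}
    {VS : Set V} {ES : Set E} (h : G.IsProperSubLOT VS ES) :
    ∃ VS' ES', G.IsMaxProperSubLOT VS' ES' ∧ VS ⊆ VS' ∧ ES ⊆ ES' := by
  obtain ⟨⟨VS', ES'⟩, hle, hmax⟩ := Finite.exists_le_maximal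
    (p := fun x : Set V × Set E => G.IsProperSubLOT x.1 x.2) (a := (VS, ES)) h
  refine ⟨VS', ES', ⟨hmax.1, fun VS'' ES'' h'' h1 h2 => ?_⟩, hle.1, hle.2⟩
  have h3 := hmax.2 (y := (VS'', ES'')) h'' ⟨h1, h2⟩
  exact ⟨h1.antisymm h3.1, h2.antisymm h3.2⟩

end LOG
namespace LOG

variable {V E : Type} {n : ℕ}

/-- `π` collapses each of the vertex sets `VS i` to one of its points. -/
structure IsCollapse (VS : Fin n → Set V) (π : V → V) : Prop where
  outside : ∀ v, (∀ i, v ∉ VS i) → π v = v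
  inside : ∀ i, ∃ t ∈ VS i, ∀ v ∈ VS i, π v = t

namespace IsCollapse

variable {VS : Fin n → Set V} {π : V → V}

theorem eq_of_mem (h : IsCollapse VS π) {i : Fin n} {v w : V} (hv : v ∈ VS i) (hw : w ∈ VS i) :
    π v = π w := by
  obtain ⟨t, -, ht⟩ := h.inside i
  rw [ht v hv, ht w hw]

theorem apply_mem (h : IsCollapse VS π) {i : Fin n} {v : V} (hv : v ∈ VS i) : π v ∈ VS i := by
  obtain ⟨t, ht, ht'⟩ := h.inside i
  rwa [ht' v hv]

theorem apply_eq_or (h : IsCollapse VS π) (v : V) : π v = v ∨ ∃ i, v ∈ VS i ∧ π v ∈ VS i := by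
  by_cases hv : ∃ i, v ∈ VS i
  · obtain ⟨i, hi⟩ := hv
    exact Or.inr ⟨i, hi, h.apply_mem hi⟩
  · exact Or.inl (h.outside v (not_exists.1 hv))

theorem eq_iff (h : IsCollapse VS π) (hdisj : ∀ i j, i ≠ j → VS i ∩ VS j = ∅) (v w : V) :
    π v = π w ↔ v = w ∨ ∃ i, v ∈ VS i ∧ w ∈ VS i := by
  constructor
  · intro hvw
    have huniq : ∀ i j x, x ∈ VS i → x ∈ VS j → i = j := by
      intro i j x hi hj
      by_contra hij
      exact (hdisj i j hij).subset ⟨hi, hj⟩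
    rcases h.apply_eq_or v with hv | ⟨i, hv, hv'⟩ <;> rcases h.apply_eq_or w with hw | ⟨j, hw, hw'⟩
    · exact Or.inl (by rw [← hv, hvw, hw])
    · exact Or.inr ⟨j, by rwa [← hv, hvw], hw⟩
    · exact Or.inr ⟨i, hv, by rwa [← hw, ← hvw]⟩
    · rw [hvw] at hv'
      obtain rfl := huniq i j _ hv' hw'
      exact Or.inr ⟨i, hv, hw⟩
  · rintro (rfl | ⟨i, hv, hw⟩)
    · rfl
    · exact h.eq_of_mem hv hw

theorem exists_isCollapse (VS : Fin n → Set V) (hne : ∀ i, (VS i).Nonempty)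
    (hdisj : ∀ i j, i ≠ j → VS i ∩ VS j = ∅) : ∃ π, IsCollapse VS π := by
  classical
  refine ⟨fun v => if h : ∃ i, v ∈ VS i then (hne h.choose).some else v, ?_, ?_⟩
  · intro v hv
    exact dif_neg (not_exists.2 hv)
  · intro i
    refine ⟨(hne i).some, (hne i).some_mem, fun v hv => ?_⟩
    have h : ∃ i, v ∈ VS i := ⟨i, hv⟩
    have hi : h.choose = i := by
      by_contra hij
      exact (hdisj _ i hij).subset ⟨h.choose_spec, hv⟩
    simp only [dif_pos h, hi]

theorem comp_apply (h : IsCollapse VS π) (hdisj : ∀ i j, i ≠ j → VS i ∩ VS j = ∅)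
    {ρ : V → V} (hρ : IsCollapse VS ρ) (v : V) : ρ (π v) = ρ v :=
  (hρ.eq_iff hdisj _ _).2 ((h.apply_eq_or v).imp id fun ⟨i, h1, h2⟩ => ⟨i, h2, h1⟩)

/-- The collapsed vertices do not depend on the choice of the collapsing map. -/
theorem bijective_range (h : IsCollapse VS π) (hdisj : ∀ i j, i ≠ j → VS i ∩ VS j = ∅)
    {ρ : V → V} (hρ : IsCollapse VS ρ) :
    Function.Bijective (fun x : Set.range π => (⟨ρ x.1, Set.mem_range_self _⟩ : Set.range ρ)) := by
  constructor
  · rintro ⟨_, v, rfl⟩ ⟨_, w, rfl⟩ hvw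
    simp only [Subtype.mk.injEq, h.comp_apply hdisj hρ] at hvw
    exact Subtype.ext ((h.eq_iff hdisj v w).2 ((hρ.eq_iff hdisj v w).1 hvw))
  · rintro ⟨_, v, rfl⟩
    exact ⟨⟨π v, Set.mem_range_self v⟩, Subtype.ext (h.comp_apply hdisj hρ v)⟩

end IsCollapse

/-- The LOG obtained by deleting the edges in `ET` and identifying vertices along `π`. -/
def collapse (P : LOG V E) (ET : Set E) (π : V → V) : LOG (Set.range π) {e // e ∉ ET} where
  init e := ⟨π (P.init e.1), Set.mem_range_self _⟩
  label e := ⟨π (P.label e.1), Set.mem_range_self _⟩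
  term e := ⟨π (P.term e.1), Set.mem_range_self _⟩

section Family

variable {P : LOG V E} {VS : Fin n → Set V} {ES : Fin n → Set E}

theorem IsSubLOT.reachIn {VS : Set V} {ES : Set E} (h : P.IsSubLOT VS ES) {v w : V} (hv : v ∈ VS)
    (hw : w ∈ VS) : P.skeleton.ReachIn ES v w :=
  ((P.subgraph_connected_iff VS ES h.init_mem h.term_mem).1 h.connected).2 v hv w hw

variable {π : V → V}

theorem IsCollapse.reachIn (hπ : IsCollapse VS π) (hsub : ∀ i, P.IsSubLOT (VS i) (ES i)) {F : Set E}
    {v : V} (hF : ∀ i, v ∈ VS i → ES i ⊆ F) : P.skeleton.ReachIn F v (π v) := by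
  rcases hπ.apply_eq_or v with h | ⟨i, h1, h2⟩
  · rw [h]; exact Relation.ReflTransGen.refl
  · exact ((hsub i).reachIn h1 h2).mono (hF i h1)

theorem IsCollapse.collapse_connected (hπ : IsCollapse VS π) (htree : P.IsTreeGraph)
    (hsub : ∀ i, P.IsSubLOT (VS i) (ES i)) :
    (P.collapse (⋃ i, ES i) π).skeleton.Connected := by
  rintro ⟨_, v, rfl⟩ ⟨_, w, rfl⟩
  induction htree.connected v w with
  | refl => exact Relation.ReflTransGen.refl
  | @tail x y _ hstep ih =>
    obtain ⟨e, he⟩ := hstep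
    by_cases heT : e ∈ ⋃ i, ES i
    · obtain ⟨i, hi⟩ := Set.mem_iUnion.1 heT
      have h1 : π x = π y := by
        rcases he with ⟨rfl, rfl⟩ | ⟨rfl, rfl⟩
        · exact hπ.eq_of_mem ((hsub i).init_mem e hi) ((hsub i).term_mem e hi)
        · exact hπ.eq_of_mem ((hsub i).term_mem e hi) ((hsub i).init_mem e hi)
      simpa only [h1] using ih
    · refine ih.tail ⟨⟨e, heT⟩, ?_⟩
      rcases he with ⟨rfl, rfl⟩ | ⟨rfl, rfl⟩
      · exact Or.inl ⟨rfl, rfl⟩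
      · exact Or.inr ⟨rfl, rfl⟩

variable [Fintype V] [Fintype E]

/-- A sub-LOT of a tree contains every edge joining two of its vertices. -/
theorem IsSubLOT.mem_of_endpoints (htree : P.IsTreeGraph) {VS : Set V} {ES : Set E}
    (h : P.IsSubLOT VS ES) {e : E} (hi : P.init e ∈ VS) (ht : P.term e ∈ VS) : e ∈ ES := by
  classical
  by_contra he
  let G : Multigraph V {f // f ≠ e} := ⟨fun f => P.init f.1, fun f => P.term f.1⟩
  have hES : ∀ {v w}, P.skeleton.ReachIn ES v w → Relation.ReflTransGen G.Adj v w := by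
    intro v w hvw
    refine Relation.ReflTransGen.mono ?_ _ _ hvw
    rintro x y ⟨f, hf, hxy⟩
    exact ⟨⟨f, fun hfe => he (hfe ▸ hf)⟩, hxy⟩
  have hconn : G.Connected := by
    intro v w
    induction htree.connected v w with
    | refl => exact Relation.ReflTransGen.refl
    | tail _ hstep ih =>
      refine ih.trans ?_
      obtain ⟨f, hf⟩ := hstep
      by_cases hfe : f = e
      · subst hfe
        rcases hf with ⟨rfl, rfl⟩ | ⟨rfl, rfl⟩
        · exact hES (h.reachIn hi ht)
        · exact hES (h.reachIn ht hi)
      · exact Relation.ReflTransGen.single ⟨⟨f, hfe⟩, hf⟩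
  have : Nonempty V := ⟨P.init e⟩
  have h1 := hconn.card_le
  have h2 := htree.card_eq
  have h3 : 0 < Fintype.card E := Fintype.card_pos_iff.2 ⟨e⟩
  simp only [Fintype.card_subtype_compl, Fintype.card_subtype_eq, ne_eq] at h1
  omega

theorem IsProperSubLOT.subset_iUnion
    (hcompl : ∀ VS' ES', P.IsMaxProperSubLOT VS' ES' → ∃ i, VS' = VS i ∧ ES' = ES i)
    {VS' : Set V} {ES' : Set E} (h : P.IsProperSubLOT VS' ES') : ES' ⊆ ⋃ i, ES i := by
  obtain ⟨VS'', ES'', hmax, -, hE⟩ := h.exists_isMaxProperSubLOT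
  obtain ⟨i, -, rfl⟩ := hcompl _ _ hmax
  exact hE.trans (Set.subset_iUnion ES i)

/-- An edge outside the maximal proper sub-LOTs which meets one of them is not labeled by a
vertex of that sub-LOT. -/
theorem label_notMem (htree : P.IsTreeGraph) (hbdry : P.BoundaryReduced)
    (hmax : ∀ i, P.IsMaxProperSubLOT (VS i) (ES i))
    (hcompl : ∀ VS' ES', P.IsMaxProperSubLOT VS' ES' → ∃ i, VS' = VS i ∧ ES' = ES i)
    {e : E} (he : e ∉ ⋃ i, ES i) {i : Fin n} {x y : V} (hx : x ∈ VS i)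
    (hxy : (P.init e = x ∧ P.term e = y) ∨ (P.init e = y ∧ P.term e = x)) :
    P.label e ∉ VS i := by
  intro hl
  have hT := (hmax i).1.1
  have hei : e ∉ ES i := fun h => he (Set.mem_iUnion_of_mem i h)
  have hy : y ∉ VS i := by
    intro hy
    refine hei (hT.mem_of_endpoints htree ?_ ?_) <;>
      rcases hxy with ⟨h1, h2⟩ | ⟨h1, h2⟩ <;> simp [h1, h2, hx, hy]
  have hinit : ∀ f ∈ insert e (ES i), P.init f ∈ insert y (VS i) := by
    rintro f (rfl | hf)
    · rcases hxy with ⟨h1, -⟩ | ⟨h1, -⟩ <;> simp [h1, hx]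
    · exact Or.inr (hT.init_mem f hf)
  have hterm : ∀ f ∈ insert e (ES i), P.term f ∈ insert y (VS i) := by
    rintro f (rfl | hf)
    · rcases hxy with ⟨-, h1⟩ | ⟨-, h1⟩ <;> simp [h1, hx]
    · exact Or.inr (hT.term_mem f hf)
  have hsub : P.IsSubLOT (insert y (VS i)) (insert e (ES i)) := by
    refine ⟨Set.insert_nonempty _ _, hinit, hterm, ?_, ?_⟩
    · rintro f (rfl | hf)
      · exact Or.inr hl
      · exact Or.inr (hT.label_mem f hf)
    · rw [subgraph_connected_iff _ _ _ hinit hterm]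
      have key : ∀ v ∈ insert y (VS i), P.skeleton.ReachIn (insert e (ES i)) x v := by
        rintro v (rfl | hv)
        · have h1 : P.skeleton.ReachIn (insert e (ES i)) (P.init e) (P.term e) :=
            P.skeleton.reachIn_edge (Set.mem_insert e _)
          rcases hxy with ⟨h2, h3⟩ | ⟨h2, h3⟩ <;> rw [h2, h3] at h1
          · exact h1
          · exact h1.symm
        · exact (hT.reachIn hx hv).mono (Set.subset_insert _ _)
      exact ⟨Set.insert_nonempty _ _, fun v hv w hw => (key v hv).symm.trans (key w hw)⟩
  by_cases hall : insert y (VS i) = Set.univ ∧ insert e (ES i) = Set.univ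
  · have hmem : ∀ f, f ≠ e → f ∈ ES i := fun f hf =>
      (hall.2.symm.subset (Set.mem_univ f)).resolve_left hf
    obtain ⟨f, hf⟩ := hbdry y ⟨e, by rcases hxy with ⟨-, h1⟩ | ⟨h1, -⟩ <;> simp [h1], by
      intro f hf
      by_contra hfe
      rcases hf with rfl | rfl
      · exact hy (hT.init_mem f (hmem f hfe))
      · exact hy (hT.term_mem f (hmem f hfe))⟩
    by_cases hfe : f = e
    · exact hy (by rwa [← hf, hfe])
    · exact hy (hf ▸ hT.label_mem f (hmem f hfe))
  · exact he (IsProperSubLOT.subset_iUnion hcompl ⟨hsub, hall⟩ (Set.mem_insert e _))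

open Classical in
theorem IsCollapse.card_range (hπ : IsCollapse VS π) (htree : P.IsTreeGraph)
    (hsub : ∀ i, P.IsSubLOT (VS i) (ES i)) :
    Fintype.card (Set.range π) = Fintype.card {e // e ∉ ⋃ i, ES i} + 1 := by
  obtain ⟨v₀⟩ := htree.2.2.connected.nonempty
  have : Nonempty (Set.range π) := ⟨⟨π v₀, Set.mem_range_self _⟩⟩
  have h1 := (hπ.collapse_connected htree hsub).card_le
  let G : Multigraph V {e // e ∈ ⋃ i, ES i} := ⟨fun e => P.init e.1, fun e => P.term e.1⟩
  have hreach : ∀ {v w}, P.skeleton.ReachIn (⋃ i, ES i) v w →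
      Relation.ReflTransGen
        (fun x y => G.Adj x y ∨ (x ∈ (Set.range π).toFinset ∧ y ∈ (Set.range π).toFinset)) v w := by
    intro v w hvw
    refine Relation.ReflTransGen.mono ?_ _ _ hvw
    rintro x y ⟨e, he, hxy⟩
    exact Or.inl ⟨⟨e, he⟩, hxy⟩
  have h2 := G.card_le_of_connected_sup (Set.range π).toFinset ⟨π v₀, by simp⟩ fun v w => by
    have hv := hreach (hπ.reachIn hsub (v := v) fun i _ => Set.subset_iUnion ES i)
    have hw := hreach (hπ.reachIn hsub (v := w) fun i _ => Set.subset_iUnion ES i).symm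
    exact (hv.tail (Or.inr ⟨by simp, by simp⟩)).trans hw
  have h3 := htree.card_eq
  rw [Set.toFinset_card] at h2
  have h4 := Fintype.card_subtype_compl fun e => e ∈ ⋃ i, ES i
  have h5 := Fintype.card_subtype_le fun e => e ∈ ⋃ i, ES i
  omega

theorem IsCollapse.collapse_compressed (hπ : IsCollapse VS π) (htree : P.IsTreeGraph)
    (hcomp : P.Compressed) (hbdry : P.BoundaryReduced)
    (hmax : ∀ i, P.IsMaxProperSubLOT (VS i) (ES i))
    (hcompl : ∀ VS' ES', P.IsMaxProperSubLOT VS' ES' → ∃ i, VS' = VS i ∧ ES' = ES i)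
    (hdisj : ∀ i j, i ≠ j → VS i ∩ VS j = ∅) :
    (P.collapse (⋃ i, ES i) π).Compressed := by
  rintro ⟨e, he⟩
  constructor <;> intro h <;>
    rcases (hπ.eq_iff hdisj _ _).1 (congrArg Subtype.val h) with h | ⟨i, h1, h2⟩
  · exact (hcomp e).1 h
  · exact label_notMem htree hbdry hmax hcompl he h2 (Or.inl ⟨rfl, rfl⟩) h1
  · exact (hcomp e).2 h
  · exact label_notMem htree hbdry hmax hcompl he h2 (Or.inr ⟨rfl, rfl⟩) h1

theorem IsCollapse.exists_not_reach (hπ : IsCollapse VS π)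
    (hmax : ∀ i, P.IsMaxProperSubLOT (VS i) (ES i))
    (hcompl : ∀ VS' ES', P.IsMaxProperSubLOT VS' ES' → ∃ i, VS' = VS i ∧ ES' = ES i)
    (X : Set (Set.range π)) (hX : X ≠ Set.univ) (hnt : X.Nontrivial) :
    ∃ x ∈ X, ∃ y ∈ X,
      ¬ Relation.ReflTransGen ((P.collapse (⋃ i, ES i) π).StepIn X) x y := by
  by_contra! hcon
  let p : V → Set.range π := fun v => ⟨π v, Set.mem_range_self v⟩
  let F : Set E := {e | p (P.init e) ∈ X ∧ p (P.term e) ∈ X ∧ p (P.label e) ∈ X}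
  have hsub := fun i => (hmax i).1.1
  have hF : ∀ v, p v ∈ X → ∀ i, v ∈ VS i → ES i ⊆ F := by
    intro v hv i hvi e he
    have hp : ∀ w ∈ VS i, p w ∈ X := by
      intro w hw
      have : p w = p v := Subtype.ext (hπ.eq_of_mem hw hvi)
      rwa [this]
    exact ⟨hp _ ((hsub i).init_mem e he), hp _ ((hsub i).term_mem e he),
      hp _ ((hsub i).label_mem e he)⟩
  have hpr : ∀ v, p v ∈ X → P.skeleton.ReachIn F v (π v) := fun v hv =>
    hπ.reachIn hsub (hF v hv)
  have hlift : ∀ x y, Relation.ReflTransGen ((P.collapse (⋃ i, ES i) π).StepIn X) x y →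
      P.skeleton.ReachIn F x.1 y.1 := by
    intro x y hxy
    induction hxy with
    | refl => exact Relation.ReflTransGen.refl
    | tail _ hstep ih =>
      refine ih.trans ?_
      obtain ⟨e, h1, h2, h3, h4⟩ := hstep
      have he : P.skeleton.ReachIn F (π (P.init e.1)) (π (P.term e.1)) :=
        ((hpr _ h1).symm.trans (P.skeleton.reachIn_edge
          (show e.1 ∈ F from ⟨h1, h2, h3⟩))).trans (hpr _ h2)
      rcases h4 with ⟨rfl, rfl⟩ | ⟨rfl, rfl⟩
      · exact he
      · exact he.symm
  obtain ⟨x, hx, y, hy, hne⟩ := hnt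
  obtain ⟨e, heF⟩ : ∃ e : {e // e ∉ ⋃ i, ES i}, e.1 ∈ F := by
    rcases Relation.ReflTransGen.cases_head (hcon x hx y hy) with h | ⟨_, ⟨e, h1, h2, h3, -⟩, -⟩
    · exact absurd h hne
    · exact ⟨e, h1, h2, h3⟩
  have hLOT : P.IsSubLOT (p ⁻¹' X) F := by
    refine ⟨⟨e.1, heF⟩, fun e he => he.1, fun e he => he.2.1, fun e he => he.2.2, ?_⟩
    rw [subgraph_connected_iff _ _ _ (fun e he => he.1) (fun e he => he.2.1)]
    exact ⟨⟨_, heF.1⟩, fun v hv w hw =>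
      ((hpr v hv).trans (hlift _ _ (hcon _ hv _ hw))).trans (hpr w hw).symm⟩
  refine e.2 (IsProperSubLOT.subset_iUnion hcompl ⟨hLOT, fun hall => hX ?_⟩ heF)
  refine Set.eq_univ_of_forall ?_
  rintro ⟨_, v, rfl⟩
  exact hall.1.symm.subset (Set.mem_univ v)

end Family

end LOG

/-- **Existence of a good reorientation (relative version of the Huck–Rosebrock theorem).**
Let `P` be a reduced labeled oriented tree whose maximal proper sub-LOTs
`Tᵢ = (VS i, ES i)` are pairwise disjoint, with union `T`, and assume `P` is injective
relative to `T`.  Then there is a reorientation `Q` of `P`, reversing only edges of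
`P − T`, such that `W⁺(Q/T)` is a tree relative to `W⁺(T/T)` and `W⁻(Q/T)` is a tree
relative to `W⁻(T/T)`; equivalently, for each sign the multigraph obtained from `W^±(Q)`
by deleting the edges contributed by edges of `T` and identifying, for each `i`, all
vertices of `Tᵢ` to a single vertex, is a tree.  In particular `Q = P(Q)` satisfies the
Stallings test relative to `T = P(T)`: every relator of `Q` has exponent sum zero, and
`W⁺(Q)` or `W⁻(Q)` is a forest relative to the subgraph coming from `T`. -/
theorem exists_reorientation_relative_tree {V E : Type} [Fintype V] [Fintype E] {n : ℕ}
    (P : LOG V E) (htree : P.IsTreeGraph) (hred : P.Reduced)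
    (VS : Fin n → Set V) (ES : Fin n → Set E)
    (hmax : ∀ i, P.IsMaxProperSubLOT (VS i) (ES i))
    (hcompl : ∀ VS' ES', P.IsMaxProperSubLOT VS' ES' → ∃ i, VS' = VS i ∧ ES' = ES i)
    (hdisj : ∀ i j, i ≠ j → VS i ∩ VS j = ∅)
    (hrelinj : P.RelInjective VS ES) :
    ∃ Q : LOG V E, IsReorientation P Q ∧
      (∀ e ∈ ⋃ i, ES i, Q.init e = P.init e ∧ Q.term e = P.term e) ∧
      (∀ π : V → V, (∀ v, (∀ i, v ∉ VS i) → π v = v) →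
        (∀ i, ∃ t ∈ VS i, ∀ v ∈ VS i, π v = t) →
          (collapsedWplus Q (⋃ i, ES i) π).IsTree ∧
          (collapsedWminus Q (⋃ i, ES i) π).IsTree) ∧
      (∀ e, expSum (Q.relWord e) = 0) ∧
      (Q.Wplus.IsForestRel { e | e ∈ ⋃ i, ES i } ∨
       Q.Wminus.IsForestRel { e | e ∈ ⋃ i, ES i }) := by
  classical
  have hsub := fun i => (hmax i).1.1
  have hne : ∀ i, (VS i).Nonempty := fun i =>
    let ⟨e, he⟩ := (hsub i).edge_nonempty
    ⟨_, (hsub i).init_mem e he⟩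
  obtain ⟨π₀, hπ₀⟩ := LOG.IsCollapse.exists_isCollapse VS hne hdisj
  obtain ⟨R, ⟨hRl, hR⟩, hRp, hRm⟩ := LOG.exists_reorientation_isTree
    (hπ₀.collapse_connected htree hsub) (hπ₀.card_range htree hsub)
    (hπ₀.collapse_compressed htree hred.1 hred.2.1 hmax hcompl hdisj)
    (fun e f hef => Subtype.ext (hrelinj π₀ hπ₀.outside hπ₀.inside e.1 f.1 e.2 f.2
      (congrArg Subtype.val hef)))
    (hπ₀.exists_not_reach hmax hcompl)
  let keep : E → Prop := fun e => ∀ h : e ∉ ⋃ i, ES i,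
    R.init ⟨e, h⟩ = (P.collapse (⋃ i, ES i) π₀).init ⟨e, h⟩ ∧
      R.term ⟨e, h⟩ = (P.collapse (⋃ i, ES i) π₀).term ⟨e, h⟩
  let Q : LOG V E := ⟨fun e => if keep e then P.init e else P.term e, P.label,
    fun e => if keep e then P.term e else P.init e⟩
  have hQT : ∀ e ∈ ⋃ i, ES i, Q.init e = P.init e ∧ Q.term e = P.term e := by
    intro e he
    have hk : keep e := fun h => absurd he h
    exact ⟨if_pos hk, if_pos hk⟩
  have hQR : ∀ e : {e // e ∉ ⋃ i, ES i},
      (R.init e).1 = π₀ (Q.init e.1) ∧ (R.term e).1 = π₀ (Q.term e.1) := by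
    intro e
    by_cases hk : keep e.1
    · simp only [Q, if_pos hk]
      exact ⟨congrArg Subtype.val (hk e.2).1, congrArg Subtype.val (hk e.2).2⟩
    · simp only [Q, if_neg hk]
      have h := (hR e).resolve_left fun h => hk fun _ => h
      exact ⟨congrArg Subtype.val h.1, congrArg Subtype.val h.2⟩
  have hRl' : ∀ e, (R.label e).1 = π₀ (P.label e.1) := fun e =>
    congrArg Subtype.val (congrFun hRl e)
  have htrees : ∀ ρ, LOG.IsCollapse VS ρ →
      (collapsedWplus Q (⋃ i, ES i) ρ).IsTree ∧ (collapsedWminus Q (⋃ i, ES i) ρ).IsTree := by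
    intro ρ hc
    refine ⟨hRp.map _ _ (hπ₀.bijective_range hdisj hc) ?_ ?_,
      hRm.map _ _ (hπ₀.bijective_range hdisj hc) ?_ ?_⟩ <;>
      intro e <;> refine Subtype.ext ?_
    · simp [collapsedWplus, LOG.Wplus, (hQR e).1, hπ₀.comp_apply hdisj hc]
    · simp [collapsedWplus, LOG.Wplus, hRl', hπ₀.comp_apply hdisj hc, Q]
    · simp [collapsedWminus, LOG.Wminus, hRl', hπ₀.comp_apply hdisj hc, Q]
    · simp [collapsedWminus, LOG.Wminus, (hQR e).2, hπ₀.comp_apply hdisj hc]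
  refine ⟨Q, ⟨rfl, fun e => ?_⟩, hQT, fun ρ h1 h2 => htrees ρ ⟨h1, h2⟩, fun e => rfl, Or.inl ?_⟩
  · by_cases hk : keep e
    · exact Or.inl ⟨if_pos hk, if_pos hk⟩
    · exact Or.inr ⟨if_neg hk, if_neg hk⟩
  · refine (htrees π₀ hπ₀).1.2.isForestRel (fun v => ⟨π₀ v, Set.mem_range_self v⟩)
      (fun e => rfl) (fun e => rfl) fun e he => Subtype.ext ?_
    obtain ⟨i, hi⟩ := Set.mem_iUnion.1 he
    refine hπ₀.eq_of_mem (i := i) ?_ ((hsub i).label_mem e hi)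
    change Q.init e ∈ VS i
    rw [(hQT e he).1]
    exact (hsub i).init_mem e hi
end
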